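/- For every cutoff χ as in the context there exists N such that for every n ∈ 16ℕ with n ≥ N the following holds: ‖v_{0,n}‖_{B^1_{∞,1}(𝕋)} ≤ 1/(log log n); and if u : [0, 1/log n] × 𝕋 → ℝ is a smooth solution of the periodic Novikov equation with u(0,·) = v_{0,n}, then there exists t₀ ∈ (0, 1/log n] such that ‖u(t₀,·)‖_{B^1_{∞,1}(𝕋)} ≥ log log n. -/

import Mathlib

open MeasureTheory Filter Function
open scoped ENNReal NNReal

noncomputable section

/-- The Fourier coefficient `û(ξ) = ∫_{-π}^{π} e^{-i x ξ} u(x) dx` of a `2π`-periodic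
function on the torus. -/
def fCoeff (u : ℝ → ℂ) (ξ : ℤ) : ℂ :=
  ∫ x in (-Real.pi)..Real.pi, Complex.exp (-Complex.I * x * ξ) * u x

/-- A Littlewood–Paley cutoff function: smooth, even, `0 ≤ χ ≤ 1`, `χ = 1` on `[-3/4,3/4]`,
`supp χ ⊆ (-4/3, 4/3)`, nonincreasing on `[0,∞)`. -/
structure LPCutoff where
  χ : ℝ → ℝ
  smooth : ContDiff ℝ (⊤ : ℕ∞) χ
  even : ∀ x, χ (-x) = χ x
  nonneg : ∀ x, 0 ≤ χ x
  le_one : ∀ x, χ x ≤ 1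
  eq_one : ∀ x ∈ Set.Icc (-(3/4) : ℝ) (3/4 : ℝ), χ x = 1
  supp : ∀ x, χ x ≠ 0 → x ∈ Set.Ioo (-(4/3) : ℝ) (4/3 : ℝ)
  decay : AntitoneOn χ (Set.Ici 0)

/-- `φ(ξ) = χ(ξ/2) - χ(ξ)`. -/
def LPCutoff.phi (c : LPCutoff) (x : ℝ) : ℝ := c.χ (x / 2) - c.χ x

/-- The dyadic block `Δ_j u` (for `j ≥ -1`). -/
def LPblock (c : LPCutoff) (j : ℤ) (u : ℝ → ℂ) (x : ℝ) : ℂ :=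
  if j = -1 then
    (1 / (2 * Real.pi)) * ∑' ξ : ℤ, (c.χ ξ : ℂ) * fCoeff u ξ * Complex.exp (Complex.I * x * ξ)
  else
    (1 / (2 * Real.pi)) *
      ∑' ξ : ℤ, (c.phi ((2:ℝ) ^ (-j) * ξ) : ℂ) * fCoeff u ξ * Complex.exp (Complex.I * x * ξ)

/-- The low-frequency cut-off `S_j u`. -/
def LPlow (c : LPCutoff) (j : ℤ) (u : ℝ → ℂ) (x : ℝ) : ℂ :=
  (1 / (2 * Real.pi)) *
    ∑' ξ : ℤ, (c.χ ((2:ℝ) ^ (-j) * ξ) : ℂ) * fCoeff u ξ * Complex.exp (Complex.I * x * ξ)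

/-- The `L^∞(𝕋)` (sup) norm, with values in `ℝ≥0∞`. -/
def supNormE {E : Type*} [NormedAddCommGroup E] (f : ℝ → E) : ℝ≥0∞ :=
  ⨆ x : ℝ, (‖f x‖₊ : ℝ≥0∞)

/-- View a real-valued function as a complex-valued one. -/
def toC (f : ℝ → ℝ) : ℝ → ℂ := fun x => (f x : ℂ)

/-- The `2π`-periodic square wave: `1/2` on `(0,π)`, `-1/2` on `(-π,0)`, `0` on `{-π,0,π}`. -/
def hFun (x : ℝ) : ℝ :=
  let y := x - 2 * Real.pi * ⌊(x + Real.pi) / (2 * Real.pi)⌋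
  if y = 0 ∨ y = -Real.pi then 0 else if 0 < y then 1/2 else -1/2

/-- The low-frequency part `f_n = S_{n/2} h` (real-valued). -/
def fLow (c : LPCutoff) (n : ℕ) : ℝ → ℝ := fun x => (LPlow c ((n : ℤ) / 2) (toC hFun) x).re

/-- The initial data `v_{0,n}` for the periodic Novikov equation. -/
def v0NV (c : LPCutoff) (n : ℕ) : ℝ → ℝ := fun x =>
  (2:ℝ) ^ (-(n:ℤ)) * (n:ℝ) ^ (-(1:ℝ)/4) * Real.log n * Real.cos ((2:ℝ) ^ (n:ℕ) * x) *
    (1 + (n:ℝ) ^ (-(1:ℝ)/4) * fLow c n x) + (n:ℝ) ^ (-(1:ℝ)/4)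

/-- The `B^1_{∞,1}(𝕋)` norm `Σ_{j ≥ -1} 2^j ‖Δ_j u‖_{L^∞}`, with values in `ℝ≥0∞`. -/
def besov1E (c : LPCutoff) (u : ℝ → ℂ) : ℝ≥0∞ :=
  ∑' k : ℕ, (2:ℝ≥0∞) ^ ((k:ℤ) - 1) * supNormE (LPblock c ((k:ℤ) - 1) u)

/-- `u` is a smooth, spatially `2π`-periodic solution of the periodic Novikov equation
`∂_t u - ∂_t ∂_x² u + 4 u² ∂_x u = 3 u ∂_x u ∂_x² u + u² ∂_x³ u` on `[0,T] × 𝕋`. -/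
def IsNovikovSolution (T : ℝ) (u : ℝ → ℝ → ℝ) : Prop :=
  ContDiff ℝ (⊤ : ℕ∞) (Function.uncurry u) ∧
  (∀ t, Function.Periodic (u t) (2 * Real.pi)) ∧
  ∀ t ∈ Set.Icc (0:ℝ) T, ∀ x : ℝ,
    deriv (fun s => u s x) t - deriv (fun s => deriv (deriv (u s)) x) t
        + 4 * (u t x) ^ 2 * deriv (u t) x
      = 3 * u t x * deriv (u t) x * deriv (deriv (u t)) x +
          (u t x) ^ 2 * deriv (deriv (deriv (u t))) x

section
noncomputable section

/-- partial derivative in `x`. -/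
def pX (F : ℝ → ℝ → ℝ) : ℝ → ℝ → ℝ := fun t x => fderiv ℝ (uncurry F) (t, x) (0, 1)

/-- partial derivative in `t`. -/
def pT (F : ℝ → ℝ → ℝ) : ℝ → ℝ → ℝ := fun t x => fderiv ℝ (uncurry F) (t, x) (1, 0)

/-- joint smoothness. -/
def Sm (F : ℝ → ℝ → ℝ) : Prop := ContDiff ℝ (⊤ : ℕ∞) (uncurry F)

lemma Sm.fd {F : ℝ → ℝ → ℝ} (h : Sm F) : ContDiff ℝ (⊤ : ℕ∞) (fderiv ℝ (uncurry F)) :=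
  ContDiff.fderiv_right (m := (⊤ : ℕ∞)) h (by simp)

lemma Sm.diff {F : ℝ → ℝ → ℝ} (h : Sm F) : Differentiable ℝ (uncurry F) :=
  ContDiff.differentiable h (by simp)

lemma Sm.pX {F : ℝ → ℝ → ℝ} (h : Sm F) : Sm (pX F) := by
  have := (h.fd).clm_apply (contDiff_const (c := ((0 : ℝ), (1 : ℝ))))
  exact this

lemma Sm.pT {F : ℝ → ℝ → ℝ} (h : Sm F) : Sm (pT F) := by
  have := (h.fd).clm_apply (contDiff_const (c := ((1 : ℝ), (0 : ℝ))))
  exact this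

lemma Sm.cont {F : ℝ → ℝ → ℝ} (h : Sm F) : Continuous (uncurry F) := ContDiff.continuous h

lemma Sm.chain {F : ℝ → ℝ → ℝ} (h : Sm F) {X : ℝ → ℝ} {X' t : ℝ} (hX : HasDerivAt X X' t) :
    HasDerivAt (fun s => F s (X s)) (_root_.pT F t (X t) + X' * _root_.pX F t (X t)) t := by
  have h1 : HasDerivAt (fun s => (s, X s)) ((1 : ℝ), X') t := (hasDerivAt_id t).prodMk hX
  have h2 := (h.diff (t, X t)).hasFDerivAt.comp_hasDerivAt (f := fun s => (s, X s)) t h1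
  convert! h2 using 1
  have : ((1 : ℝ), X') = (1, 0) + X' • ((0 : ℝ), (1 : ℝ)) := by simp
  rw [this, map_add, map_smul]; rfl

lemma Sm.dx {F : ℝ → ℝ → ℝ} (h : Sm F) (t x : ℝ) :
    HasDerivAt (F t) (_root_.pX F t x) x := by
  have h1 : HasDerivAt (fun s => (t, s)) ((0 : ℝ), (1 : ℝ)) x :=
    (hasDerivAt_const x t).prodMk (hasDerivAt_id x)
  exact (h.diff (t, x)).hasFDerivAt.comp_hasDerivAt (f := fun s => (t, s)) x h1

lemma Sm.dt {F : ℝ → ℝ → ℝ} (h : Sm F) (t x : ℝ) :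
    HasDerivAt (fun s => F s x) (_root_.pT F t x) t := by
  have := h.chain (X := fun _ => x) (hasDerivAt_const t x)
  simpa using this

lemma Sm.comm {F : ℝ → ℝ → ℝ} (h : Sm F) (t x : ℝ) :
    _root_.pT (_root_.pX F) t x = _root_.pX (_root_.pT F) t x := by
  have hd : Differentiable ℝ (fderiv ℝ (uncurry F)) := h.fd.differentiable (by simp)
  have key : ∀ v w : ℝ × ℝ, fderiv ℝ (fun p => fderiv ℝ (uncurry F) p v) (t, x) w
      = fderiv ℝ (fderiv ℝ (uncurry F)) (t, x) w v := by
    intro v w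
    have := ((hd (t, x)).hasFDerivAt.clm_apply (hasFDerivAt_const v (t, x))).fderiv
    rw [this]; simp
  have sym := second_derivative_symmetric (f := uncurry F) (f' := fderiv ℝ (uncurry F))
    (f'' := fderiv ℝ (fderiv ℝ (uncurry F)) (t, x)) (x := (t, x))
    (fun y => (h.diff y).hasFDerivAt) (hd (t, x)).hasFDerivAt (1, 0) (0, 1)
  show fderiv ℝ (fun p => fderiv ℝ (uncurry F) p (0, 1)) (t, x) (1, 0)
    = fderiv ℝ (fun p => fderiv ℝ (uncurry F) p (1, 0)) (t, x) (0, 1)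
  rw [key, key, sym]

lemma per_deriv {f f' : ℝ → ℝ} {p : ℝ} (hf : Periodic f p) (h : ∀ x, HasDerivAt f (f' x) x) :
    Periodic f' p := by
  intro x
  have h1 : HasDerivAt (fun y => f (y + p)) (f' (x + p)) x := (h (x + p)).comp_add_const x p
  have h2 : (fun y => f (y + p)) = f := funext hf
  rw [h2] at h1
  exact h1.unique (h x)

/-- The first-order system form of the Novikov equation. -/
structure Sys (T : ℝ) (u g gx ut gt R S : ℝ → ℝ → ℝ) : Prop where
  cu : Continuous (uncurry u)
  cg : Continuous (uncurry g)
  cgx : Continuous (uncurry gx)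
  cut : Continuous (uncurry ut)
  cgt : Continuous (uncurry gt)
  cR : Continuous (uncurry R)
  cS : Continuous (uncurry S)
  pu : ∀ t, Periodic (u t) (2 * Real.pi)
  pg : ∀ t, Periodic (g t) (2 * Real.pi)
  pR : ∀ t, Periodic (R t) (2 * Real.pi)
  pS : ∀ t, Periodic (S t) (2 * Real.pi)
  dux : ∀ t x, HasDerivAt (u t) (g t x) x
  dgx : ∀ t x, HasDerivAt (g t) (gx t x) x
  chu : ∀ (X : ℝ → ℝ) (X' t : ℝ), HasDerivAt X X' t →
    HasDerivAt (fun s => u s (X s)) (ut t (X t) + X' * g t (X t)) t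
  chg : ∀ (X : ℝ → ℝ) (X' t : ℝ), HasDerivAt X X' t →
    HasDerivAt (fun s => g s (X s)) (gt t (X t) + X' * gx t (X t)) t
  eu : ∀ t ∈ Set.Icc (0:ℝ) T, ∀ x, ut t x + (u t x) ^ 2 * g t x = R t x
  eg : ∀ t ∈ Set.Icc (0:ℝ) T, ∀ x, gt t x + (u t x) ^ 2 * gx t x =
    -(1/2) * u t x * (g t x) ^ 2 + (u t x) ^ 3 + S t x
  dR : ∀ t ∈ Set.Icc (0:ℝ) T, ∀ x, HasDerivAt (R t)
    ((u t x) ^ 3 + (3/2) * u t x * (g t x) ^ 2 + S t x) x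
  dS : ∀ t ∈ Set.Icc (0:ℝ) T, ∀ x, HasDerivAt (S t) (R t x + (1/2) * (g t x) ^ 3) x

lemma Sys.of_novikov {T : ℝ} {u : ℝ → ℝ → ℝ} (h : IsNovikovSolution T u) :
    ∃ g gx ut gt R S, Sys T u g gx ut gt R S := by
  obtain ⟨hs, hp, heq⟩ := h
  have hu : Sm u := hs
  set g := pX u with hg
  set q := pX g with hq
  set r := pX q with hr
  set ut := pT u with hut
  have sg : Sm g := hu.pX
  have sq : Sm q := sg.pX
  have sr : Sm r := sq.pX
  have sut : Sm ut := hu.pT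
  -- derivative of ut
  have c1 : ∀ t x, pX ut t x = pT g t x := fun t x => (hu.comm t x).symm
  have c1' : pX ut = pT g := by funext t x; exact c1 t x
  have c2 : ∀ t x, pX (pT g) t x = pT q t x := fun t x => (sg.comm t x).symm
  have d1 : ∀ t x, HasDerivAt (ut t) (pT g t x) x := fun t x => c1 t x ▸ sut.dx t x
  have d2 : ∀ t x, HasDerivAt (pT g t) (pT q t x) x := fun t x => c2 t x ▸ sg.pT.dx t x
  have e0 : ∀ t, deriv (u t) = g t := fun t => funext fun x => (hu.dx t x).deriv
  have e1 : ∀ t, deriv (g t) = q t := fun t => funext fun x => (sg.dx t x).deriv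
  have e2 : ∀ t, deriv (q t) = r t := fun t => funext fun x => (sq.dx t x).deriv
  have pde : ∀ t ∈ Set.Icc (0:ℝ) T, ∀ x : ℝ, ut t x - pT q t x + 4 * (u t x) ^ 2 * g t x
      = 3 * u t x * g t x * q t x + (u t x) ^ 2 * r t x := by
    intro t ht x
    have := heq t ht x
    simp only [e0, e1, e2] at this
    rw [(hu.dt t x).deriv, (sq.dt t x).deriv] at this
    exact this
  have pg : ∀ t, Periodic (g t) (2 * Real.pi) := fun t => per_deriv (hp t) (hu.dx t)
  have pq : ∀ t, Periodic (q t) (2 * Real.pi) := fun t => per_deriv (pg t) (sg.dx t)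
  have put : ∀ t, Periodic (ut t) (2 * Real.pi) := by
    intro t x
    have h1 := hu.dt t (x + 2 * Real.pi)
    have h2 : (fun s => u s (x + 2 * Real.pi)) = fun s => u s x := funext fun s => hp s x
    rw [h2] at h1
    exact h1.unique (hu.dt t x)
  have pgt : ∀ t, Periodic (pT g t) (2 * Real.pi) := fun t => per_deriv (put t) (d1 t)
  let R : ℝ → ℝ → ℝ := fun t x => ut t x + (u t x) ^ 2 * g t x
  let S : ℝ → ℝ → ℝ := fun t x => pT g t x + (u t x) ^ 2 * q t x + (1/2) * u t x * (g t x) ^ 2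
    - (u t x) ^ 3
  have cu : Continuous fun p : ℝ × ℝ => u p.1 p.2 := hu.cont
  have cg : Continuous fun p : ℝ × ℝ => g p.1 p.2 := sg.cont
  have cq : Continuous fun p : ℝ × ℝ => q p.1 p.2 := sq.cont
  have cut : Continuous fun p : ℝ × ℝ => ut p.1 p.2 := sut.cont
  have cgt : Continuous fun p : ℝ × ℝ => pT g p.1 p.2 := sg.pT.cont
  refine ⟨g, q, ut, pT g, R, S, ?_⟩
  refine ⟨hu.cont, sg.cont, sq.cont, sut.cont, sg.pT.cont, ?_, ?_, hp, pg, ?_, ?_,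
    hu.dx, sg.dx, fun X X' t hX => hu.chain hX, fun X X' t hX => sg.chain hX, ?_, ?_, ?_, ?_⟩
  · show Continuous fun p : ℝ × ℝ => ut p.1 p.2 + (u p.1 p.2) ^ 2 * g p.1 p.2
    fun_prop
  · show Continuous fun p : ℝ × ℝ => pT g p.1 p.2 + (u p.1 p.2) ^ 2 * q p.1 p.2
      + (1/2) * u p.1 p.2 * (g p.1 p.2) ^ 2 - (u p.1 p.2) ^ 3
    fun_prop
  · intro t x
    simp only [R, put t x, hp t x, pg t x]
  · intro t x
    simp only [S, pgt t x, hp t x, pg t x, pq t x]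
  · intro t _ x; rfl
  · intro t _ x; simp only [S]; ring
  · intro t _ x
    have := (d1 t x).add (((hu.dx t x).pow 2).mul (sg.dx t x))
    convert! this using 1
    simp only [S, ← hg, ← hq, Pi.pow_apply]
    ring
  · intro t ht x
    have := (((d2 t x).add (((hu.dx t x).pow 2).mul (sq.dx t x))).add
      ((((hu.dx t x).const_mul (1/2)).mul ((sg.dx t x).pow 2)))).sub ((hu.dx t x).pow 3)
    convert! this using 1
    simp only [R, ← hg, ← hq, ← hr, Pi.pow_apply]
    push_cast
    linear_combination (pde t ht x)

end
end

section
noncomputable section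

lemma per_max {f : ℝ → ℝ} (hc : Continuous f) (hp : Periodic f (2 * Real.pi)) :
    ∃ x0, ∀ x, f x ≤ f x0 := by
  obtain ⟨x0, _, h⟩ := (isCompact_Icc (a := (0:ℝ)) (b := 2 * Real.pi)).exists_isMaxOn
    ⟨0, by simp [Real.pi_pos.le]⟩ hc.continuousOn
  refine ⟨x0, fun x => ?_⟩
  obtain ⟨y, hy, hxy⟩ := hp.exists_mem_Ico₀ (by positivity) x
  rw [hxy]
  exact h ⟨hy.1, hy.2.le⟩

lemma max_principle {p q : ℝ → ℝ} {σ c : ℝ} (hσ : σ ^ 2 = 1) (hp : Periodic p (2 * Real.pi))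
    (hd : ∀ x, HasDerivAt p (σ * p x + q x) x) (hq : ∀ x, |q x| ≤ c) (x : ℝ) : |p x| ≤ c := by
  have hcont : Continuous p := continuous_iff_continuousAt.2 fun x => (hd x).continuousAt
  obtain ⟨x0, h0⟩ := per_max (f := fun x => p x ^ 2) (by fun_prop) (fun x => by simp only [hp x])
  have hmax : IsLocalMax (fun x => p x ^ 2) x0 := Filter.Eventually.of_forall h0
  have hz := hmax.hasDerivAt_eq_zero ((hd x0).pow 2)
  have hc0 : 0 ≤ c := (abs_nonneg _).trans (hq x0)
  have : |p x0| ≤ c := by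
    by_cases h : p x0 = 0
    · simpa [h] using hc0
    · have : σ * p x0 + q x0 = 0 := by
        simp at hz
        rcases hz with hz | hz
        · exact absurd hz h
        · exact hz
      have h2 : p x0 = - σ * q x0 := by linear_combination σ * this - p x0 * hσ
      have h3 : |σ| = 1 := by
        rw [← sq_abs] at hσ
        nlinarith [abs_nonneg σ]
      rw [h2, abs_mul, abs_neg, h3, one_mul]
      exact hq x0
  exact (sq_le_sq.1 (h0 x)).trans this

lemma abs_A_le {u g m : ℝ} (hu : |u| ≤ m) (hg : |g| ≤ m) :
    |u ^ 3| ≤ m ^ 3 ∧ |u * g ^ 2| ≤ m ^ 3 ∧ |g ^ 3| ≤ m ^ 3 := by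
  have hm : 0 ≤ m := (abs_nonneg u).trans hu
  refine ⟨?_, ?_, ?_⟩
  · rw [abs_pow]; gcongr
  · rw [abs_mul, abs_pow]
    calc |u| * |g| ^ 2 ≤ m * m ^ 2 := by gcongr
      _ = m ^ 3 := by ring
  · rw [abs_pow]; gcongr

section
variable {T : ℝ} {u g gx ut gt R S : ℝ → ℝ → ℝ}

lemma Sys.bdRS (H : Sys T u g gx ut gt R S) {t m : ℝ} (ht : t ∈ Set.Icc (0:ℝ) T)
    (hu : ∀ x, |u t x| ≤ m) (hg : ∀ x, |g t x| ≤ m) (x : ℝ) :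
    |R t x| ≤ 3 * m ^ 3 ∧ |S t x| ≤ 3 * m ^ 3 := by
  have hp : ∀ x, |R t x + S t x| ≤ 3 * m ^ 3 := by
    refine max_principle (σ := 1) (q := fun x => (u t x) ^ 3 + (3/2) * u t x * (g t x) ^ 2
      + (1/2) * (g t x) ^ 3) (by norm_num) (fun x => by simp only [H.pR t x, H.pS t x])
      (fun x => ?_) (fun x => ?_)
    · convert! (H.dR t ht x).add (H.dS t ht x) using 1; ring
    · obtain ⟨h1, h2, h3⟩ := abs_A_le (hu x) (hg x)
      rw [abs_le] at *
      constructor <;> nlinarith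
  have hq : ∀ x, |R t x - S t x| ≤ 3 * m ^ 3 := by
    refine max_principle (σ := -1) (q := fun x => (u t x) ^ 3 + (3/2) * u t x * (g t x) ^ 2
      - (1/2) * (g t x) ^ 3) (by norm_num) (fun x => by simp only [H.pR t x, H.pS t x])
      (fun x => ?_) (fun x => ?_)
    · convert! (H.dR t ht x).sub (H.dS t ht x) using 1; ring
    · obtain ⟨h1, h2, h3⟩ := abs_A_le (hu x) (hg x)
      rw [abs_le] at *
      constructor <;> nlinarith
  have h1 := hp x
  have h2 := hq x
  rw [abs_le] at h1 h2
  constructor <;> rw [abs_le] <;> constructor <;> linarith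

lemma bdd_of_per {f : ℝ → ℝ → ℝ} (hc : Continuous (uncurry f))
    (hp : ∀ t, Periodic (f t) (2 * Real.pi)) (a b : ℝ) :
    ∃ C, 0 ≤ C ∧ ∀ t ∈ Set.Icc a b, ∀ x, |f t x| ≤ C := by
  obtain ⟨C, hC⟩ := ((isCompact_Icc (a := a) (b := b)).prod
    (isCompact_Icc (a := (0:ℝ)) (b := 2 * Real.pi))).exists_bound_of_continuousOn hc.continuousOn
  refine ⟨max C 0, le_max_right _ _, fun t ht x => ?_⟩
  obtain ⟨y, hy, hxy⟩ := (hp t).exists_mem_Ico₀ (by positivity) x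
  rw [hxy]
  exact (hC (t, y) ⟨ht, hy.1, hy.2.le⟩).trans (le_max_left _ _)

lemma lip_of_deriv {f f' : ℝ → ℝ} {C : ℝ} (h : ∀ x, HasDerivAt f (f' x) x) (hb : ∀ x, |f' x| ≤ C)
    (x y : ℝ) : |f x - f y| ≤ C * |x - y| := by
  have := Convex.norm_image_sub_le_of_norm_hasDerivWithin_le (s := Set.univ) (f := f) (f' := f')
    (C := C) (x := y) (y := x) (fun x _ => (h x).hasDerivWithinAt) (fun x _ => hb x) convex_univ
    trivial trivial
  simpa using this

lemma Sys.dusq (H : Sys T u g gx ut gt R S) (t x : ℝ) :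
    HasDerivAt (fun y => (u t y) ^ 2) (2 * u t x * g t x) x := by
  have := (H.dux t x).pow 2
  convert! this using 1
  push_cast; ring

lemma Sys.char (H : Sys T u g gx ut gt R S) {t : ℝ} (ht : t ∈ Set.Icc (0:ℝ) T) (x : ℝ) :
    ∃ X : ℝ → ℝ, X t = x ∧ ∀ s ∈ Set.Ioo (-1:ℝ) (T + 1), HasDerivAt X ((u s (X s)) ^ 2) s := by
  obtain ⟨Cu, hCu, hu⟩ := bdd_of_per H.cu H.pu (-1) (T + 1)
  obtain ⟨Cg, hCg, hg⟩ := bdd_of_per H.cg H.pg (-1) (T + 1)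
  have ht' : t ∈ Set.Icc (-1:ℝ) (T + 1) := ⟨by linarith [ht.1], by linarith [ht.2]⟩
  have hT : 0 ≤ T := ht.1.trans ht.2
  let K : ℝ≥0 := ⟨2 * Cu * Cg, by positivity⟩
  let L : ℝ≥0 := ⟨Cu ^ 2, by positivity⟩
  let a : ℝ≥0 := ⟨Cu ^ 2 * (T + 2), by positivity⟩
  have PL : IsPicardLindelof (fun s y => (u s y) ^ 2) (⟨t, ht'⟩ : Set.Icc (-1:ℝ) (T + 1)) x
      a 0 L K := by
    constructor
    · intro s hs
      apply LipschitzWith.lipschitzOnWith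
      apply LipschitzWith.of_dist_le_mul
      intro y z
      rw [Real.dist_eq, Real.dist_eq]
      refine lip_of_deriv (H.dusq s) (C := 2 * Cu * Cg) (fun y => ?_) y z
      rw [abs_mul, abs_mul, abs_two]
      gcongr
      · exact hu s hs y
      · exact hg s hs y
    · intro y _
      have : Continuous fun s => u s y := H.cu.comp (by fun_prop : Continuous fun s => (s, y))
      exact (this.pow 2).continuousOn
    · intro s hs y _
      rw [Real.norm_eq_abs, abs_pow]
      have := hu s hs y
      show |u s y| ^ 2 ≤ Cu ^ 2
      gcongr
    · show Cu ^ 2 * max (T + 1 - t) (t - (-1)) ≤ Cu ^ 2 * (T + 2) - 0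
      rw [sub_zero]
      gcongr
      apply max_le <;> linarith [ht.1, ht.2]
  obtain ⟨X, hX, hd⟩ := PL.exists_eq_forall_mem_Icc_hasDerivWithinAt₀
  refine ⟨X, hX, fun s hs => ?_⟩
  exact (hd s ⟨hs.1.le, hs.2.le⟩).hasDerivAt (Icc_mem_nhds hs.1 hs.2)

/-- Integrating along a curve. -/
lemma curve_bound {f f' : ℝ → ℝ} {t C : ℝ} (ht : 0 ≤ t)
    (hd : ∀ s ∈ Set.Icc (0:ℝ) t, HasDerivAt f (f' s) s) (hb : ∀ s ∈ Set.Icc (0:ℝ) t, |f' s| ≤ C) :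
    |f t - f 0| ≤ C * t := by
  have := norm_image_sub_le_of_norm_deriv_le_segment' (a := 0) (b := t) (C := C)
    (fun s hs => (hd s hs).hasDerivWithinAt) (fun s hs => hb s ⟨hs.1, hs.2.le⟩) t ⟨ht, le_rfl⟩
  simpa using this

/-- One step of the bootstrap. -/
lemma Sys.step (H : Sys T u g gx ut gt R S) {M t : ℝ} (ht : t ∈ Set.Icc (0:ℝ) T)
    (hb : ∀ s ∈ Set.Icc (0:ℝ) t, ∀ x, |u s x| ≤ M ∧ |g s x| ≤ M) (x : ℝ) :
    ∃ x', |u t x - u 0 x'| ≤ 3 * M ^ 3 * t ∧ |g t x - g 0 x'| ≤ (9/2) * M ^ 3 * t := by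
  obtain ⟨X, hX, hd⟩ := H.char ht x
  have hm : ∀ s ∈ Set.Icc (0:ℝ) t, s ∈ Set.Icc (0:ℝ) T := fun s hs => ⟨hs.1, hs.2.trans ht.2⟩
  have hI : ∀ s ∈ Set.Icc (0:ℝ) t, s ∈ Set.Ioo (-1:ℝ) (T+1) := fun s hs =>
    ⟨by linarith [hs.1], by linarith [(hm s hs).2]⟩
  refine ⟨X 0, ?_, ?_⟩
  · rw [← hX]
    refine curve_bound (f := fun s => u s (X s)) ht.1
      (fun s hs => H.chu X _ s (hd s (hI s hs))) (fun s hs => ?_)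
    rw [H.eu s (hm s hs)]
    exact (H.bdRS (hm s hs) (fun x => (hb s hs x).1) (fun x => (hb s hs x).2) _).1
  · rw [← hX]
    refine curve_bound (f := fun s => g s (X s)) ht.1
      (fun s hs => H.chg X _ s (hd s (hI s hs))) (fun s hs => ?_)
    rw [H.eg s (hm s hs)]
    have h1 := (H.bdRS (hm s hs) (fun x => (hb s hs x).1) (fun x => (hb s hs x).2) (X s)).2
    obtain ⟨h2, h3, -⟩ := abs_A_le (hb s hs (X s)).1 (hb s hs (X s)).2
    rw [abs_le] at *
    constructor <;> nlinarith

lemma Sys.boot (H : Sys T u g gx ut gt R S) {M : ℝ} (hM : 0 < M) (hT : 0 ≤ T)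
    (h0 : ∀ x, |u 0 x| ≤ M / 2 ∧ |g 0 x| ≤ M / 2) (hsmall : (9/2) * M ^ 3 * T ≤ M / 4) :
    ∀ s ∈ Set.Icc (0:ℝ) T, ∀ x, |u s x| ≤ M ∧ |g s x| ≤ M := by
  -- uniform continuity
  have unif : ∀ {f : ℝ → ℝ → ℝ}, Continuous (uncurry f) → (∀ t, Periodic (f t) (2 * Real.pi)) →
      ∃ δ > 0, ∀ s ∈ Set.Icc (0:ℝ) T, ∀ t ∈ Set.Icc (0:ℝ) T, |s - t| < δ → ∀ x,
        |f s x - f t x| < M / 4 := by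
    intro f hc hp
    have hk := ((isCompact_Icc (a := (0:ℝ)) (b := T)).prod
      (isCompact_Icc (a := (0:ℝ)) (b := 2 * Real.pi))).uniformContinuousOn_of_continuous
        hc.continuousOn
    rw [Metric.uniformContinuousOn_iff] at hk
    obtain ⟨δ, hδ, h⟩ := hk (M / 4) (by positivity)
    refine ⟨δ, hδ, fun s hs t ht hst x => ?_⟩
    have hpp : Periodic (fun x => (f s x, f t x)) (2 * Real.pi) := fun x => by
      simp only [hp s x, hp t x]
    obtain ⟨y, hy, hxyp⟩ := hpp.exists_mem_Ico₀ (by positivity) x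
    have hxy : f s x = f s y := congrArg Prod.fst hxyp
    have hxy' : f t x = f t y := congrArg Prod.snd hxyp
    rw [hxy, hxy']
    have := h (s, y) ⟨hs, hy.1, hy.2.le⟩ (t, y) ⟨ht, hy.1, hy.2.le⟩ (by
      rw [Prod.dist_eq]; simp [Real.dist_eq, hst])
    simpa [Real.dist_eq] using this
  obtain ⟨δ1, hδ1, h1⟩ := unif H.cu H.pu
  obtain ⟨δ2, hδ2, h2⟩ := unif H.cg H.pg
  set δ := min δ1 δ2 / 2 with hδ
  have hδp : 0 < δ := by positivity
  have ind : ∀ k : ℕ, ∀ s ∈ Set.Icc (0:ℝ) T, s ≤ k * δ → ∀ x,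
      |u s x| ≤ 3 / 4 * M ∧ |g s x| ≤ 3 / 4 * M := by
    intro k
    induction k with
    | zero =>
      intro s hs hk x
      have : s = 0 := le_antisymm (by simpa using hk) hs.1
      subst this
      exact ⟨(h0 x).1.trans (by linarith), (h0 x).2.trans (by linarith)⟩
    | succ k ih =>
      intro t ht hk x
      have hb : ∀ s ∈ Set.Icc (0:ℝ) t, ∀ x, |u s x| ≤ M ∧ |g s x| ≤ M := by
        intro s hs x
        have hsT : s ∈ Set.Icc (0:ℝ) T := ⟨hs.1, hs.2.trans ht.2⟩
        by_cases hsk : s ≤ k * δ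
        · have := ih s hsT hsk x
          exact ⟨this.1.trans (by linarith), this.2.trans (by linarith)⟩
        · push Not at hsk
          have hk0 : (k:ℝ) * δ ∈ Set.Icc (0:ℝ) T := ⟨by positivity, hsk.le.trans hsT.2⟩
          have hlt : |s - k * δ| < min δ1 δ2 := by
            rw [abs_of_pos (by linarith)]
            have : s ≤ (k + 1 : ℕ) * δ := hs.2.trans hk
            push_cast at this
            have : s - k * δ ≤ δ := by linarith
            linarith [half_lt_self (show 0 < min δ1 δ2 by positivity)]
          have a1 := h1 s hsT _ hk0 (hlt.trans_le (min_le_left _ _)) x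
          have a2 := h2 s hsT _ hk0 (hlt.trans_le (min_le_right _ _)) x
          have a3 := ih _ hk0 le_rfl x
          rw [abs_lt] at a1 a2
          obtain ⟨a3, a4⟩ := a3
          rw [abs_le] at a3 a4
          constructor <;> rw [abs_le] <;> constructor <;> linarith
      obtain ⟨x', hx1, hx2⟩ := H.step ht hb x
      have hM3 : (9/2) * M ^ 3 * t ≤ M / 4 := le_trans (by gcongr; exact ht.2) hsmall
      have hM3' : 0 ≤ M ^ 3 * t := mul_nonneg (by positivity) ht.1
      obtain ⟨b1, b2⟩ := h0 x'
      rw [abs_le] at hx1 hx2 b1 b2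
      constructor <;> rw [abs_le] <;> constructor <;> linarith
  intro s hs x
  obtain ⟨k, hk⟩ := exists_nat_ge (s / δ)
  have := ind k s hs (by rwa [div_le_iff₀ hδp] at hk) x
  exact ⟨this.1.trans (by linarith), this.2.trans (by linarith)⟩

end

end
end

section
noncomputable section

/-- Kernel properties used in the dynamical argument. -/
structure Ker (K K' : ℝ → ℝ) (Λ Λ' : ℝ) : Prop where
  dK : ∀ y, HasDerivAt K (K' y) y
  cK' : Continuous K'
  per : Periodic K (2 * Real.pi)
  odd : ∀ y, K (-y) = - K y
  b1 : ∫ y in (-Real.pi)..Real.pi, |K y| ≤ Λ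
  b2 : ∫ y in (-Real.pi)..Real.pi, |y| * |K' y| ≤ Λ
  b3 : ∀ y, |y| ≤ Real.pi → |y| * |K y| ≤ Real.pi
  b4 : ∫ y in (-Real.pi)..Real.pi, |K' y| ≤ Λ'

lemma Ker.cK {K K' : ℝ → ℝ} {Λ Λ' : ℝ} (h : Ker K K' Λ Λ') : Continuous K :=
  continuous_iff_continuousAt.2 fun x => (h.dK x).continuousAt

lemma odd_int_zero {f : ℝ → ℝ} (h : ∀ y, f (-y) = - f y) (a : ℝ) : ∫ y in (-a)..a, f y = 0 := by
  have h1 : ∫ y in (-a)..a, f (-y) = ∫ y in (-a)..a, f y := by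
    rw [intervalIntegral.integral_comp_neg]; simp
  simp only [h, intervalIntegral.integral_neg] at h1
  linarith

lemma abs_int_le {f F : ℝ → ℝ} (hF : Continuous F)
    (h : ∀ y, |y| ≤ Real.pi → |f y| ≤ F y) :
    |∫ y in (-Real.pi)..Real.pi, f y| ≤ ∫ y in (-Real.pi)..Real.pi, F y := by
  rw [← Real.norm_eq_abs]
  have hpi : -Real.pi ≤ Real.pi := by linarith [Real.pi_pos]
  refine intervalIntegral.norm_integral_le_of_norm_le hpi ?_ (hF.intervalIntegrable _ _)
  refine Filter.Eventually.of_forall fun y hy => h y ?_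
  rw [abs_le]; exact ⟨hy.1.le, hy.2⟩

lemma int_eq_of_diff {A B D : ℝ → ℝ} {a b : ℝ} (cB : Continuous B) (cD : Continuous D)
    (h : ∀ y, A y = B y + D y) (hD : ∫ y in a..b, D y = 0) :
    ∫ y in a..b, A y = ∫ y in a..b, B y := by
  simp only [h]
  rw [intervalIntegral.integral_add (cB.intervalIntegrable _ _) (cD.intervalIntegrable _ _), hD,
    add_zero]

lemma hasDeriv_int {G Gt Gx : ℝ → ℝ → ℝ} (cG : Continuous (uncurry G))
    (cGt : Continuous (uncurry Gt)) (cGx : Continuous (uncurry Gx))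
    (ch : ∀ (X : ℝ → ℝ) (X' t : ℝ), HasDerivAt X X' t →
      HasDerivAt (fun s => G s (X s)) (Gt t (X t) + X' * Gx t (X t)) t)
    {x0 v K : ℝ → ℝ} {α β t : ℝ} (hx : ∀ s ∈ Set.Ioo α β, HasDerivAt x0 (v s) s)
    (hv : ContinuousOn v (Set.Ioo α β)) (hK : Continuous K) (ht : t ∈ Set.Ioo α β) :
    HasDerivAt (fun s => ∫ y in (-Real.pi)..Real.pi, G s (x0 s + y) * K y)
      (∫ y in (-Real.pi)..Real.pi, (Gt t (x0 t + y) + v t * Gx t (x0 t + y)) * K y) t := by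
  obtain ⟨r, hr, hsub⟩ := Metric.nhds_basis_closedBall.mem_iff.1 (isOpen_Ioo.mem_nhds ht)
  have hcx : ContinuousOn x0 (Metric.closedBall t r) := fun s hs =>
    (hx s (hsub hs)).continuousAt.continuousWithinAt
  have hcv : ContinuousOn v (Metric.closedBall t r) := hv.mono hsub
  let F' : ℝ → ℝ → ℝ := fun s y => (Gt s (x0 s + y) + v s * Gx s (x0 s + y)) * K y
  have cpair : ContinuousOn (fun p : ℝ × ℝ => (p.1, x0 p.1 + p.2))
      (Metric.closedBall t r ×ˢ Set.Icc (-Real.pi) Real.pi) := by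
    refine continuousOn_fst.prodMk ((hcx.comp continuousOn_fst fun p hp => hp.1).add continuousOn_snd)
  have hF'c : ContinuousOn (uncurry F') (Metric.closedBall t r ×ˢ Set.Icc (-Real.pi) Real.pi) := by
    refine ContinuousOn.mul (ContinuousOn.add ?_ (ContinuousOn.mul ?_ ?_)) ?_
    · exact cGt.comp_continuousOn cpair
    · exact hcv.comp continuousOn_fst fun p hp => hp.1
    · exact cGx.comp_continuousOn cpair
    · exact (hK.comp continuous_snd).continuousOn
  obtain ⟨C, hC⟩ := ((isCompact_closedBall t r).prod
    (isCompact_Icc (a := -Real.pi) (b := Real.pi))).exists_bound_of_continuousOn hF'c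
  have hpi : -Real.pi ≤ Real.pi := by linarith [Real.pi_pos]
  have cs : ∀ (W : ℝ → ℝ → ℝ), Continuous (uncurry W) → ∀ s, Continuous fun y => W s (x0 s + y) :=
    fun W hW s => hW.comp (by fun_prop : Continuous fun y => (s, x0 s + y))
  refine (intervalIntegral.hasDerivAt_integral_of_dominated_loc_of_deriv_le
    (F := fun s y => G s (x0 s + y) * K y) (F' := F') (s := Metric.closedBall t r)
    (bound := fun _ => C) (Metric.closedBall_mem_nhds t hr) ?_ ?_ ?_ ?_ ?_ ?_).2
  · exact Filter.Eventually.of_forall fun s => ((cs G cG s).mul hK).aestronglyMeasurable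
  · exact ((cs G cG t).mul hK).intervalIntegrable _ _
  · exact ((((cs Gt cGt t)).add (continuous_const.mul (cs Gx cGx t))).mul hK).aestronglyMeasurable
  · refine Filter.Eventually.of_forall fun y hy s hs => ?_
    rw [Set.uIoc_of_le hpi] at hy
    exact hC (s, y) ⟨hs, hy.1.le, hy.2⟩
  · exact intervalIntegrable_const
  · refine Filter.Eventually.of_forall fun y hy s hs => ?_
    have := ch (fun s => x0 s + y) (v s) s ((hx s (hsub hs)).add_const y)
    exact this.mul_const (K y)

section
variable {T : ℝ} {u g gx ut gt R S : ℝ → ℝ → ℝ}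

lemma Sys.traj (H : Sys T u g gx ut gt R S) {M : ℝ}
    (hb : ∀ s ∈ Set.Icc (0:ℝ) T, ∀ x, |u s x| ≤ M ∧ |g s x| ≤ M) {X Y : ℝ → ℝ}
    (hX : ∀ s ∈ Set.Ioo (-1:ℝ) (T + 1), HasDerivAt X ((u s (X s)) ^ 2) s)
    (hY : ∀ s ∈ Set.Ioo (-1:ℝ) (T + 1), HasDerivAt Y ((u s (Y s)) ^ 2) s) {t s : ℝ}
    (hs : 0 ≤ s) (hst : s ≤ t) (ht : t ≤ T) :
    |X s - Y s| ≤ Real.exp (2 * M ^ 2 * T) * |X t - Y t| := by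
  set k := 2 * M ^ 2 with hk
  have hk0 : 0 ≤ k := by positivity
  have hmem : ∀ r ∈ Set.Icc s t, r ∈ Set.Icc (0:ℝ) T := fun r hr => ⟨hs.trans hr.1, hr.2.trans ht⟩
  have hI : ∀ r ∈ Set.Icc s t, r ∈ Set.Ioo (-1:ℝ) (T + 1) := fun r hr =>
    ⟨by linarith [(hmem r hr).1], by linarith [(hmem r hr).2]⟩
  let φ : ℝ → ℝ := fun r => (X r - Y r) ^ 2 * Real.exp (2 * k * r)
  have hd : ∀ r ∈ Set.Icc s t, HasDerivAt φ ((2 * (X r - Y r) * ((u r (X r)) ^ 2 - (u r (Y r)) ^ 2)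
      + 2 * k * (X r - Y r) ^ 2) * Real.exp (2 * k * r)) r := by
    intro r hr
    have h1 := ((hX r (hI r hr)).sub (hY r (hI r hr))).pow 2
    have h2 : HasDerivAt (fun r => Real.exp (2 * k * r)) (Real.exp (2 * k * r) * (2 * k)) r := by
      have := ((hasDerivAt_id r).const_mul (2 * k)).exp
      simpa using this
    convert! h1.mul h2 using 1
    simp
    ring
  have hmono : MonotoneOn φ (Set.Icc s t) := by
    refine monotoneOn_of_deriv_nonneg (convex_Icc s t)
      (fun r hr => (hd r hr).continuousAt.continuousWithinAt)
      (fun r hr => (hd r (interior_subset hr)).differentiableAt.differentiableWithinAt) ?_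
    intro r hr
    have hr := interior_subset hr
    rw [(hd r hr).deriv]
    refine mul_nonneg ?_ (Real.exp_pos _).le
    have hl := lip_of_deriv (H.dusq r) (C := k) (fun x => by
      obtain ⟨h1, h2⟩ := hb r (hmem r hr) x
      have hM : 0 ≤ M := (abs_nonneg _).trans h1
      rw [abs_mul, abs_mul, abs_two, hk]
      calc 2 * |u r x| * |g r x| ≤ 2 * M * M := by gcongr
        _ = 2 * M ^ 2 := by ring) (X r) (Y r)
    have h3 : |(X r - Y r) * ((u r (X r)) ^ 2 - (u r (Y r)) ^ 2)| ≤ k * (X r - Y r) ^ 2 := by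
      rw [abs_mul, ← sq_abs (X r - Y r)]
      calc _ ≤ |X r - Y r| * (k * |X r - Y r|) := by gcongr
        _ = _ := by ring
    have := (abs_le.1 h3).1
    linarith
  have h := hmono (Set.left_mem_Icc.2 hst) (Set.right_mem_Icc.2 hst) hst
  have h2 : (X s - Y s) ^ 2 ≤ (Real.exp (k * T) * |X t - Y t|) ^ 2 := by
    rw [mul_pow, sq_abs, ← Real.exp_nat_mul]
    have e1 : (X s - Y s) ^ 2 * 1 ≤ φ s := by
      apply mul_le_mul_of_nonneg_left _ (sq_nonneg _)
      exact Real.one_le_exp (by positivity)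
    have e2 : φ t ≤ Real.exp ((2:ℕ) * (k * T)) * (X t - Y t) ^ 2 := by
      rw [mul_comm]
      apply mul_le_mul_of_nonneg_left _ (sq_nonneg _)
      apply Real.exp_le_exp.2
      push_cast
      nlinarith
    linarith
  have := abs_le_of_sq_le_sq h2 (by positivity)
  exact this

lemma Sys.diffb (H : Sys T u g gx ut gt R S) {M a ε : ℝ}
    (hb : ∀ s ∈ Set.Icc (0:ℝ) T, ∀ x, |u s x| ≤ M ∧ |g s x| ≤ M)
    (h0 : ∀ x, |u 0 x - a| ≤ ε) {Y : ℝ → ℝ}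
    (hY : ∀ s ∈ Set.Ioo (-1:ℝ) (T + 1), HasDerivAt Y ((u s (Y s)) ^ 2) s) {t : ℝ}
    (ht : t ∈ Set.Icc (0:ℝ) T) (y : ℝ) :
    |u t (Y t + y) - u t (Y t)| ≤
      2 * ε + (11/2) * M ^ 3 * Real.exp (2 * M ^ 2 * T) * T * |y| := by
  obtain ⟨X, hXt, hX⟩ := H.char ht (Y t + y)
  have hM : 0 ≤ M := (abs_nonneg _).trans (hb t ht 0).1
  have hT : 0 ≤ T := ht.1.trans ht.2
  have hm : ∀ s ∈ Set.Icc (0:ℝ) t, s ∈ Set.Icc (0:ℝ) T := fun s hs => ⟨hs.1, hs.2.trans ht.2⟩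
  have hI : ∀ s ∈ Set.Icc (0:ℝ) t, s ∈ Set.Ioo (-1:ℝ) (T+1) := fun s hs =>
    ⟨by linarith [hs.1], by linarith [(hm s hs).2]⟩
  have key : |(u t (X t) - u t (Y t)) - (u 0 (X 0) - u 0 (Y 0))| ≤
      ((11/2) * M ^ 3 * (Real.exp (2 * M ^ 2 * T) * |y|)) * t := by
    refine curve_bound (f := fun s => u s (X s) - u s (Y s)) ht.1
      (fun s hs => (H.chu X _ s (hX s (hI s hs))).sub (H.chu Y _ s (hY s (hI s hs))))
      (fun s hs => ?_)
    rw [H.eu s (hm s hs), H.eu s (hm s hs)]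
    refine (lip_of_deriv (H.dR s (hm s hs)) (C := (11/2) * M ^ 3) (fun x => ?_) _ _).trans ?_
    · have h1 := (H.bdRS (hm s hs) (fun x => (hb s (hm s hs) x).1)
        (fun x => (hb s (hm s hs) x).2) x).2
      obtain ⟨h2, h3, -⟩ := abs_A_le (hb s (hm s hs) x).1 (hb s (hm s hs) x).2
      rw [abs_le] at *
      constructor <;> nlinarith
    · gcongr
      have := H.traj hb hX hY hs.1 hs.2 ht.2
      rwa [hXt, add_sub_cancel_left] at this
  rw [hXt] at key
  have h1 := h0 (X 0)
  have h2 := h0 (Y 0)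
  have h3 : ((11/2) * M ^ 3 * (Real.exp (2 * M ^ 2 * T) * |y|)) * t ≤
      (11/2) * M ^ 3 * Real.exp (2 * M ^ 2 * T) * T * |y| := by
    calc _ ≤ ((11/2) * M ^ 3 * (Real.exp (2 * M ^ 2 * T) * |y|)) * T := by gcongr; exact ht.2
      _ = _ := by ring
  have key := key.trans h3
  generalize (11/2) * M ^ 3 * Real.exp (2 * M ^ 2 * T) * T * |y| = Z at *
  rw [abs_le] at *
  constructor <;> linarith [key.1, key.2, h1.1, h1.2, h2.1, h2.2]

/-- derivative of localized integrals, after integrating by parts. -/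
lemma Sys.dint (H : Sys T u g gx ut gt R S) {K K' : ℝ → ℝ} {Λ Λ' : ℝ} (hK : Ker K K' Λ Λ')
    {G Gt Gx : ℝ → ℝ → ℝ} (cG : Continuous (uncurry G))
    (cGt : Continuous (uncurry Gt)) (cGx : Continuous (uncurry Gx))
    (pG : ∀ t, Periodic (G t) (2 * Real.pi))
    (dG : ∀ t x, HasDerivAt (G t) (Gx t x) x)
    (ch : ∀ (X : ℝ → ℝ) (X' t : ℝ), HasDerivAt X X' t →
      HasDerivAt (fun s => G s (X s)) (Gt t (X t) + X' * Gx t (X t)) t)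
    {Y : ℝ → ℝ} (hY : ∀ s ∈ Set.Ioo (-1:ℝ) (T + 1), HasDerivAt Y ((u s (Y s)) ^ 2) s) {t : ℝ}
    (ht : t ∈ Set.Icc (0:ℝ) T) :
    HasDerivAt (fun s => ∫ y in (-Real.pi)..Real.pi, G s (Y s + y) * K y)
      (∫ y in (-Real.pi)..Real.pi, ((Gt t (Y t + y) + (u t (Y t + y)) ^ 2 * Gx t (Y t + y)) * K y
        + 2 * u t (Y t + y) * g t (Y t + y) * G t (Y t + y) * K y
        + ((u t (Y t + y)) ^ 2 - (u t (Y t)) ^ 2) * G t (Y t + y) * K' y)) t := by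
  have htI : t ∈ Set.Ioo (-1:ℝ) (T + 1) := ⟨by linarith [ht.1], by linarith [ht.2]⟩
  have hYc : ContinuousOn Y (Set.Ioo (-1:ℝ) (T + 1)) := fun s hs =>
    (hY s hs).continuousAt.continuousWithinAt
  have hv : ContinuousOn (fun s => (u s (Y s)) ^ 2) (Set.Ioo (-1:ℝ) (T + 1)) := by
    have : ContinuousOn (fun s => u s (Y s)) (Set.Ioo (-1:ℝ) (T + 1)) :=
      H.cu.comp_continuousOn (continuousOn_id.prodMk hYc)
    exact this.pow 2
  have h := hasDeriv_int cG cGt cGx ch hY hv hK.cK htI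
  convert! h using 1
  have cs : ∀ (W : ℝ → ℝ → ℝ), Continuous (uncurry W) → Continuous fun y => W t (Y t + y) :=
    fun W hW => hW.comp (by fun_prop : Continuous fun y => (t, Y t + y))
  have c1 := cs u H.cu
  have c2 := cs g H.cg
  have c3 := cs G cG
  have c4 := cs Gt cGt
  have c5 := cs Gx cGx
  have c6 := hK.cK
  have c7 := hK.cK'
  let W : ℝ → ℝ := fun y => ((u t (Y t + y)) ^ 2 - (u t (Y t)) ^ 2) * G t (Y t + y) * K y
  have hW : ∀ y, HasDerivAt W ((2 * u t (Y t + y) * g t (Y t + y) * G t (Y t + y)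
      + ((u t (Y t + y)) ^ 2 - (u t (Y t)) ^ 2) * Gx t (Y t + y)) * K y
      + ((u t (Y t + y)) ^ 2 - (u t (Y t)) ^ 2) * G t (Y t + y) * K' y) y := by
    intro y
    have e1 : HasDerivAt (fun y => (u t (Y t + y)) ^ 2 - (u t (Y t)) ^ 2)
        (2 * u t (Y t + y) * g t (Y t + y)) y :=
      ((H.dusq t (Y t + y)).comp_const_add (Y t) y).sub_const _
    have e2 : HasDerivAt (fun y => G t (Y t + y)) (Gx t (Y t + y)) y :=
      (dG t (Y t + y)).comp_const_add (Y t) y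
    exact (e1.mul e2).mul (hK.dK y)
  have hint := intervalIntegral.integral_eq_sub_of_hasDerivAt (a := -Real.pi) (b := Real.pi)
    (fun y _ => hW y) (Continuous.intervalIntegrable
      ((((((continuous_const.mul c1).mul c2).mul c3).add
        (((c1.pow 2).sub continuous_const).mul c5)).mul c6).add
        ((((c1.pow 2).sub continuous_const).mul c3).mul c7)) _ _)
  have hper : W Real.pi = W (-Real.pi) := by
    have e : ∀ z, z + Real.pi = (z + -Real.pi) + 2 * Real.pi := fun z => by ring
    have e1 := H.pu t (Y t + -Real.pi)
    have e2 := pG t (Y t + -Real.pi)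
    have e3 := hK.per (-Real.pi)
    rw [← e] at e1 e2
    have e4 : -Real.pi + 2 * Real.pi = Real.pi := by ring
    rw [e4] at e3
    simp only [W, e1, e2, e3]
  rw [hper, sub_self] at hint
  refine int_eq_of_diff ((c4.add (continuous_const.mul c5)).mul c6)
      ((((((continuous_const.mul c1).mul c2).mul c3).add
        (((c1.pow 2).sub continuous_const).mul c5)).mul c6).add
        ((((c1.pow 2).sub continuous_const).mul c3).mul c7)) (fun y => ?_) hint
  simp only [Pi.mul_apply, Pi.add_apply, Pi.sub_apply, Pi.pow_apply]
  ring

end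

end
end

section
noncomputable section

lemma sq_diff_le {p q M d : ℝ} (hp : |p| ≤ M) (hq : |q| ≤ M) (h : |p - q| ≤ d) :
    |p ^ 2 - q ^ 2| ≤ 2 * M * d := by
  have : p ^ 2 - q ^ 2 = (p + q) * (p - q) := by ring
  rw [this, abs_mul]
  have h1 : |p + q| ≤ 2 * M := (abs_add_le _ _).trans (by linarith)
  have : 0 ≤ M := (abs_nonneg _).trans hp
  gcongr

section
variable {T : ℝ} {u g gx ut gt R S : ℝ → ℝ → ℝ}

lemma Sys.dJ (H : Sys T u g gx ut gt R S) {K K' : ℝ → ℝ} {Λ Λ' M : ℝ} (hK : Ker K K' Λ Λ')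
    (hb : ∀ s ∈ Set.Icc (0:ℝ) T, ∀ x, |u s x| ≤ M ∧ |g s x| ≤ M)
    {Y : ℝ → ℝ} (hY : ∀ s ∈ Set.Ioo (-1:ℝ) (T + 1), HasDerivAt Y ((u s (Y s)) ^ 2) s) :
    ∃ J' : ℝ → ℝ, ∀ t ∈ Set.Icc (0:ℝ) T,
      HasDerivAt (fun s => ∫ y in (-Real.pi)..Real.pi, (g s (Y s + y)) ^ 2 * K y) (J' t) t ∧
      |J' t| ≤ 13 * M ^ 4 * Λ := by
  have cG : Continuous (uncurry fun s x => (g s x) ^ 2) := by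
    have := H.cg.pow 2
    exact this
  have cGt : Continuous (uncurry fun s x => 2 * g s x * gt s x) :=
    (continuous_const.mul H.cg).mul H.cgt
  have cGx : Continuous (uncurry fun s x => 2 * g s x * gx s x) :=
    (continuous_const.mul H.cg).mul H.cgx
  have key := fun t (ht : t ∈ Set.Icc (0:ℝ) T) => H.dint hK cG cGt cGx
    (fun t x => by simp only [H.pg t x])
    (fun t x => by convert! (H.dgx t x).pow 2 using 1; simp)
    (fun X X' t hX => by convert! (H.chg X X' t hX).pow 2 using 1; simp; ring) hY ht
  refine ⟨_, fun t ht => ⟨key t ht, ?_⟩⟩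
  have cK := hK.cK
  have cK' := hK.cK'
  refine (abs_int_le (F := fun y => 11 * M ^ 4 * |K y| + 2 * M ^ 4 * (|y| * |K' y|))
    (by fun_prop) fun y hy => ?_).trans ?_
  · obtain ⟨hu, hg⟩ := hb t ht (Y t + y)
    have hM : 0 ≤ M := (abs_nonneg _).trans hu
    have hS := (H.bdRS ht (fun x => (hb t ht x).1) (fun x => (hb t ht x).2) (Y t + y)).2
    obtain ⟨h2, h3, h4⟩ := abs_A_le hu hg
    have eg := H.eg t ht (Y t + y)
    have hl := lip_of_deriv (H.dusq t) (C := 2 * M ^ 2) (fun x => by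
      obtain ⟨h1, h2⟩ := hb t ht x
      rw [abs_mul, abs_mul, abs_two]
      calc 2 * |u t x| * |g t x| ≤ 2 * M * M := by gcongr
        _ = 2 * M ^ 2 := by ring) (Y t + y) (Y t)
    rw [add_sub_cancel_left] at hl
    generalize u t (Y t + y) = U at *
    generalize g t (Y t + y) = G at *
    generalize gt t (Y t + y) = Gt at *
    generalize gx t (Y t + y) = Gx at *
    generalize S t (Y t + y) = S' at *
    generalize u t (Y t) = V at *
    have e : (2 * G * Gt + U ^ 2 * (2 * G * Gx)) * K y + 2 * U * G * G ^ 2 * K y +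
        (U ^ 2 - V ^ 2) * G ^ 2 * K' y = G * ((U * G ^ 2 + 2 * U ^ 3 + 2 * S')) * K y
        + (U ^ 2 - V ^ 2) * G ^ 2 * K' y := by
      linear_combination (2 * G * K y) * eg
    rw [e]
    have b1 : |G * (U * G ^ 2 + 2 * U ^ 3 + 2 * S') * K y| ≤ 11 * M ^ 4 * |K y| := by
      rw [abs_mul, abs_mul]
      have : |U * G ^ 2 + 2 * U ^ 3 + 2 * S'| ≤ 9 * M ^ 3 := by
        rw [abs_le] at *
        constructor <;> linarith [h2.1, h2.2, h3.1, h3.2, hS.1, hS.2]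
      calc |G| * |U * G ^ 2 + 2 * U ^ 3 + 2 * S'| * |K y| ≤ M * (9 * M ^ 3) * |K y| := by gcongr
        _ = 9 * M ^ 4 * |K y| := by ring
        _ ≤ _ := by gcongr; norm_num
    have b2 : |(U ^ 2 - V ^ 2) * G ^ 2 * K' y| ≤ 2 * M ^ 4 * (|y| * |K' y|) := by
      rw [abs_mul, abs_mul, abs_pow G]
      calc _ ≤ (2 * M ^ 2 * |y|) * M ^ 2 * |K' y| := by gcongr
        _ = _ := by ring
    exact (abs_add_le _ _).trans (add_le_add b1 b2)
  · rw [intervalIntegral.integral_add (Continuous.intervalIntegrable (by fun_prop) _ _)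
      (Continuous.intervalIntegrable (by fun_prop) _ _), intervalIntegral.integral_const_mul,
      intervalIntegral.integral_const_mul]
    have := hK.b1
    have := hK.b2
    have : 0 ≤ M ^ 4 := by positivity
    nlinarith [mul_le_mul_of_nonneg_left hK.b1 this, mul_le_mul_of_nonneg_left hK.b2 this]

lemma Sys.dI (H : Sys T u g gx ut gt R S) {K K' : ℝ → ℝ} {Λ Λ' M a ε : ℝ} (hK : Ker K K' Λ Λ')
    (hb : ∀ s ∈ Set.Icc (0:ℝ) T, ∀ x, |u s x| ≤ M ∧ |g s x| ≤ M)
    (h0 : ∀ x, |u 0 x - a| ≤ ε) (hε : 0 ≤ ε)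
    {Y : ℝ → ℝ} (hY : ∀ s ∈ Set.Ioo (-1:ℝ) (T + 1), HasDerivAt Y ((u s (Y s)) ^ 2) s) :
    ∃ I' : ℝ → ℝ, ∀ t ∈ Set.Icc (0:ℝ) T,
      HasDerivAt (fun s => ∫ y in (-Real.pi)..Real.pi, (g s (Y s + y)) * K y) (I' t) t ∧
      |I' t - (3/2) * a * ∫ y in (-Real.pi)..Real.pi, (g t (Y t + y)) ^ 2 * K y| ≤
        (3/2) * (ε + 3 * M ^ 3 * T) * M ^ 2 * Λ + 13 * Real.pi ^ 2 * M ^ 3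
        + 2 * M ^ 2 * (2 * ε * Λ' + (11/2) * M ^ 3 * Real.exp (2 * M ^ 2 * T) * T * Λ) := by
  have key := fun t (ht : t ∈ Set.Icc (0:ℝ) T) => H.dint hK H.cg H.cgt H.cgx H.pg H.dgx H.chg hY ht
  refine ⟨_, fun t ht => ⟨key t ht, ?_⟩⟩
  have hM : 0 ≤ M := (abs_nonneg _).trans (hb t ht 0).1
  have hT : 0 ≤ T := ht.1.trans ht.2
  have cK := hK.cK
  have cK' := hK.cK'
  have cs : ∀ (W : ℝ → ℝ → ℝ), Continuous (uncurry W) → Continuous fun y => W t (Y t + y) :=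
    fun W hW => hW.comp (by fun_prop : Continuous fun y => (t, Y t + y))
  have c1 := cs u H.cu
  have c2 := cs g H.cg
  have c3 := cs S H.cS
  set F : ℝ → ℝ := fun x => (u t x) ^ 3 + S t x with hF
  have dF : ∀ x, HasDerivAt F (3 * (u t x) ^ 2 * g t x + (R t x + (1/2) * (g t x) ^ 3)) x := by
    intro x
    have := ((H.dux t x).pow 3).add (H.dS t ht x)
    convert! this using 1
  have hFl := lip_of_deriv dF (C := (13/2) * M ^ 3) (fun x => by
    obtain ⟨hu, hg⟩ := hb t ht x
    have hR := (H.bdRS ht (fun x => (hb t ht x).1) (fun x => (hb t ht x).2) x).1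
    have h4 := (abs_A_le hu hg).2.2
    have h5 := (abs_A_le hg hu).2.1
    rw [abs_le] at *
    constructor <;> nlinarith [h4.1, h4.2, h5.1, h5.2, hR.1, hR.2])
  set B := (11/2) * M ^ 3 * Real.exp (2 * M ^ 2 * T) * T with hB
  have hB0 : 0 ≤ B := by positivity
  -- rewrite the difference
  have e : (∫ y in (-Real.pi)..Real.pi, ((gt t (Y t + y) + (u t (Y t + y)) ^ 2 * gx t (Y t + y)) * K y
        + 2 * u t (Y t + y) * g t (Y t + y) * g t (Y t + y) * K y
        + ((u t (Y t + y)) ^ 2 - (u t (Y t)) ^ 2) * g t (Y t + y) * K' y))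
      - (3/2) * a * ∫ y in (-Real.pi)..Real.pi, (g t (Y t + y)) ^ 2 * K y
      = ∫ y in (-Real.pi)..Real.pi, ((3/2) * (u t (Y t + y) - a) * (g t (Y t + y)) ^ 2 * K y
        + (F (Y t + y) - F (Y t)) * K y
        + ((u t (Y t + y)) ^ 2 - (u t (Y t)) ^ 2) * g t (Y t + y) * K' y) := by
    have hz : ∫ y in (-Real.pi)..Real.pi, K y = 0 := odd_int_zero hK.odd _
    have e0 : ∫ y in (-Real.pi)..Real.pi, F (Y t) * K y = 0 := by
      rw [intervalIntegral.integral_const_mul, hz, mul_zero]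
    have e1 : ∫ y in (-Real.pi)..Real.pi, (3/2) * a * ((g t (Y t + y)) ^ 2 * K y) =
      (3/2) * a * ∫ y in (-Real.pi)..Real.pi, (g t (Y t + y)) ^ 2 * K y :=
        intervalIntegral.integral_const_mul _ _
    rw [← e1]
    have cF : Continuous fun y => F (Y t + y) := (c1.pow 3).add c3
    have ccN : Continuous fun y => ((3/2) * (u t (Y t + y) - a) * (g t (Y t + y)) ^ 2 * K y
        + (F (Y t + y) - F (Y t)) * K y
        + ((u t (Y t + y)) ^ 2 - (u t (Y t)) ^ 2) * g t (Y t + y) * K' y) := 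
      ((((continuous_const.mul (c1.sub continuous_const)).mul (c2.pow 2)).mul cK).add
        ((cF.sub continuous_const).mul cK)).add
        ((((c1.pow 2).sub continuous_const).mul c2).mul cK')
    have cc1 : Continuous fun y => (3/2) * a * ((g t (Y t + y)) ^ 2 * K y) :=
      continuous_const.mul ((c2.pow 2).mul cK)
    have cc0 : Continuous fun y => F (Y t) * K y := continuous_const.mul cK
    rw [sub_eq_iff_eq_add, ← intervalIntegral.integral_add (ccN.intervalIntegrable _ _)
      (cc1.intervalIntegrable _ _)]
    refine int_eq_of_diff (ccN.add cc1) cc0 (fun y => ?_) e0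
    have eg := H.eg t ht (Y t + y)
    simp only [hF]
    linear_combination (K y) * eg
  rw [e]
  refine (abs_int_le (F := fun y => (3/2) * (ε + 3 * M ^ 3 * T) * M ^ 2 * |K y|
    + ((13/2) * M ^ 3) * Real.pi + (4 * M ^ 2 * ε * |K' y| + 2 * M ^ 2 * B * (|y| * |K' y|)))
    (by fun_prop) fun y hy => ?_).trans ?_
  · have b1 : |(3/2) * (u t (Y t + y) - a) * (g t (Y t + y)) ^ 2 * K y| ≤
        (3/2) * (ε + 3 * M ^ 3 * T) * M ^ 2 * |K y| := by
      obtain ⟨x', hx, -⟩ := H.step ht (fun s hs => hb s ⟨hs.1, hs.2.trans ht.2⟩) (Y t + y)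
      have h1 : |u t (Y t + y) - a| ≤ ε + 3 * M ^ 3 * T := by
        have h2 := h0 x'
        have h3 : 3 * M ^ 3 * t ≤ 3 * M ^ 3 * T := by gcongr; exact ht.2
        rw [abs_le] at *
        constructor <;> linarith [hx.1, hx.2, h2.1, h2.2]
      have hg := (hb t ht (Y t + y)).2
      rw [abs_mul, abs_mul, abs_mul, abs_pow, abs_of_pos (by norm_num : (0:ℝ) < 3/2)]
      gcongr
    have b2 : |(F (Y t + y) - F (Y t)) * K y| ≤ (13/2) * M ^ 3 * Real.pi := by
      have h1 := hFl (Y t + y) (Y t)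
      rw [add_sub_cancel_left] at h1
      rw [abs_mul]
      calc _ ≤ (13/2) * M ^ 3 * |y| * |K y| := by gcongr
        _ = (13/2) * M ^ 3 * (|y| * |K y|) := by ring
        _ ≤ _ := by gcongr; exact hK.b3 y hy
    have b3 : |((u t (Y t + y)) ^ 2 - (u t (Y t)) ^ 2) * g t (Y t + y) * K' y| ≤
        4 * M ^ 2 * ε * |K' y| + 2 * M ^ 2 * B * (|y| * |K' y|) := by
      have h1 := sq_diff_le (hb t ht (Y t + y)).1 (hb t ht (Y t)).1 (H.diffb hb h0 hY ht y)
      rw [abs_mul, abs_mul]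
      calc _ ≤ (2 * M * (2 * ε + B * |y|)) * M * |K' y| := by
            gcongr
            exact (hb t ht (Y t + y)).2
        _ = _ := by ring
    exact (abs_add_le _ _).trans (add_le_add ((abs_add_le _ _).trans (add_le_add b1 b2)) b3)
  · have hi : ∀ f : ℝ → ℝ, Continuous f → IntervalIntegrable f volume (-Real.pi) Real.pi :=
      fun f hf => hf.intervalIntegrable _ _
    rw [intervalIntegral.integral_add (hi _ (by fun_prop)) (hi _ (by fun_prop)),
      intervalIntegral.integral_add (hi _ (by fun_prop)) (hi _ (by fun_prop)),
      intervalIntegral.integral_add (hi _ (by fun_prop)) (hi _ (by fun_prop)),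
      intervalIntegral.integral_const_mul, intervalIntegral.integral_const_mul (4 * M ^ 2 * ε),
      intervalIntegral.integral_const_mul (2 * M ^ 2 * B), intervalIntegral.integral_const]
    have q1 := mul_le_mul_of_nonneg_left hK.b1
      (by positivity : 0 ≤ (3/2) * (ε + 3 * M ^ 3 * T) * M ^ 2)
    have q2 := mul_le_mul_of_nonneg_left hK.b4 (by positivity : 0 ≤ 4 * M ^ 2 * ε)
    have q3 := mul_le_mul_of_nonneg_left hK.b2 (by positivity : 0 ≤ 2 * M ^ 2 * B)
    simp only [smul_eq_mul]
    nlinarith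

/-- The main dynamical estimate. -/
lemma Sys.dyn (H : Sys T u g gx ut gt R S) {K K' : ℝ → ℝ} {Λ Λ' M a ε : ℝ} (hK : Ker K K' Λ Λ')
    (hb : ∀ s ∈ Set.Icc (0:ℝ) T, ∀ x, |u s x| ≤ M ∧ |g s x| ≤ M)
    (h0 : ∀ x, |u 0 x - a| ≤ ε) (hε : 0 ≤ ε) (ha : 0 ≤ a) (hT : 0 ≤ T) :
    ∃ x0, |(∫ y in (-Real.pi)..Real.pi, g T (x0 + y) * K y)
        - (∫ y in (-Real.pi)..Real.pi, g 0 y * K y)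
        - (3/2) * a * T * ∫ y in (-Real.pi)..Real.pi, (g 0 y) ^ 2 * K y| ≤
        ((3/2) * (ε + 3 * M ^ 3 * T) * M ^ 2 * Λ + 13 * Real.pi ^ 2 * M ^ 3
        + 2 * M ^ 2 * (2 * ε * Λ' + (11/2) * M ^ 3 * Real.exp (2 * M ^ 2 * T) * T * Λ)
        + (3/2) * a * (13 * M ^ 4 * Λ * T)) * T := by
  obtain ⟨Y, hY0, hY⟩ := H.char (Set.left_mem_Icc.2 hT) 0
  obtain ⟨J', hJ⟩ := H.dJ hK hb hY
  obtain ⟨I', hI⟩ := H.dI hK hb h0 hε hY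
  set I : ℝ → ℝ := fun s => ∫ y in (-Real.pi)..Real.pi, g s (Y s + y) * K y with hIdef
  set J : ℝ → ℝ := fun s => ∫ y in (-Real.pi)..Real.pi, (g s (Y s + y)) ^ 2 * K y with hJdef
  have hJb : ∀ t ∈ Set.Icc (0:ℝ) T, |J t - J 0| ≤ 13 * M ^ 4 * Λ * T := by
    intro t ht
    have hm : ∀ s ∈ Set.Icc (0:ℝ) t, s ∈ Set.Icc (0:ℝ) T := fun s hs => ⟨hs.1, hs.2.trans ht.2⟩
    refine (curve_bound ht.1 (fun s hs => (hJ s (hm s hs)).1)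
      (fun s hs => (hJ s (hm s hs)).2)).trans ?_
    have : 0 ≤ 13 * M ^ 4 * Λ := (abs_nonneg _).trans (hJ t ht).2
    gcongr
    exact ht.2
  refine ⟨Y T, ?_⟩
  have hc := curve_bound (f := fun s => I s - (3/2) * a * J 0 * s)
    (f' := fun s => I' s - (3/2) * a * J 0) hT
    (fun s hs => by
      have := (hI s hs).1.sub ((hasDerivAt_id s).const_mul ((3/2) * a * J 0))
      rw [mul_one] at this
      exact this) (C := ((3/2) * (ε + 3 * M ^ 3 * T) * M ^ 2 * Λ + 13 * Real.pi ^ 2 * M ^ 3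
        + 2 * M ^ 2 * (2 * ε * Λ' + (11/2) * M ^ 3 * Real.exp (2 * M ^ 2 * T) * T * Λ)
        + (3/2) * a * (13 * M ^ 4 * Λ * T))) (fun s hs => by
      have h1 := (hI s hs).2
      have h2 := hJb s hs
      have e : I' s - (3/2) * a * J 0 = (I' s - (3/2) * a * J s) + (3/2) * a * (J s - J 0) := by
        ring
      rw [e]
      refine (abs_add_le _ _).trans (add_le_add h1 ?_)
      rw [abs_mul, abs_of_nonneg (by positivity : 0 ≤ (3/2) * a)]
      gcongr)
  have eI : I 0 = ∫ y in (-Real.pi)..Real.pi, g 0 y * K y := by simp only [hIdef, hY0, zero_add]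
  have eJ : J 0 = ∫ y in (-Real.pi)..Real.pi, (g 0 y) ^ 2 * K y := by
    simp only [hJdef, hY0, zero_add]
  rw [← eI, ← eJ]
  refine le_trans (le_of_eq ?_) hc
  congr 1
  simp only [hIdef]
  ring

end

end
end

section
noncomputable section

/-- Fejér-type conjugate kernel. -/
def KN (N : ℕ) (y : ℝ) : ℝ := ∑ k ∈ Finset.range N, (1 - k / N) * Real.sin (k * y)
/-- its derivative. -/
def KN' (N : ℕ) (y : ℝ) : ℝ := ∑ k ∈ Finset.range N, (1 - k / N) * (k * Real.cos (k * y))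

lemma KN_deriv (N : ℕ) (y : ℝ) : HasDerivAt (KN N) (KN' N y) y := by
  unfold KN KN'
  refine HasDerivAt.fun_sum fun k _ => ?_
  have h := (((hasDerivAt_id y).const_mul (k:ℝ)).sin).const_mul (1 - (k:ℝ) / N)
  simp only [id, mul_one] at h
  rw [mul_comm (k:ℝ) (Real.cos _)]
  exact h

lemma KN'_cont (N : ℕ) : Continuous (KN' N) := by unfold KN'; fun_prop
lemma KN_cont (N : ℕ) : Continuous (KN N) := by unfold KN; fun_prop

lemma KN_odd (N : ℕ) (y : ℝ) : KN N (-y) = - KN N y := by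
  simp [KN, Finset.sum_neg_distrib]

lemma KN_per (N : ℕ) : Periodic (KN N) (2 * Real.pi) := by
  intro y
  unfold KN
  refine Finset.sum_congr rfl fun k _ => ?_
  have : (k:ℝ) * (y + 2 * Real.pi) = k * y + k * (2 * Real.pi) := by ring
  rw [this, Real.sin_add_nat_mul_two_pi]

lemma sin_sum_id (y : ℝ) (N : ℕ) : 2 * (1 - Real.cos y) * ∑ k ∈ Finset.range (N+1), Real.sin (k * y)
    = Real.sin y + Real.sin (N * y) - Real.sin ((N + 1) * y) := by
  induction N with
  | zero => simp
  | succ n ih =>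
    rw [Finset.sum_range_succ, mul_add, ih]
    push_cast
    have e1 : ((n:ℝ) + 1 + 1) * y = (n + 1) * y + y := by ring
    have e2 : (n:ℝ) * y = (n + 1) * y - y := by ring
    rw [e1, e2, Real.sin_add, Real.sin_sub]
    ring

lemma KN_aux (y : ℝ) (N : ℕ) :
    2 * (1 - Real.cos y) * ∑ k ∈ Finset.range N, ((N:ℝ) - k) * Real.sin (k * y) =
    N * Real.sin y - Real.sin (N * y) := by
  induction N with
  | zero => simp
  | succ n ih =>
    have e : ∑ k ∈ Finset.range (n+1), (((n+1 : ℕ):ℝ) - k) * Real.sin (k * y) =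
      ∑ k ∈ Finset.range n, ((n:ℝ) - k) * Real.sin (k * y) +
        ∑ k ∈ Finset.range (n+1), Real.sin (k * y) := by
      have : ∑ k ∈ Finset.range n, ((n:ℝ) - k) * Real.sin (k * y) =
        ∑ k ∈ Finset.range (n+1), ((n:ℝ) - k) * Real.sin (k * y) := by
        rw [Finset.sum_range_succ]; simp
      rw [this, ← Finset.sum_add_distrib]
      refine Finset.sum_congr rfl fun k _ => ?_
      push_cast; ring
    rw [e, mul_add, ih, sin_sum_id]
    push_cast; ring

lemma KN_closed {N : ℕ} (hN : 0 < N) (y : ℝ) :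
    2 * (1 - Real.cos y) * KN N y = Real.sin y - Real.sin (N * y) / N := by
  have h := KN_aux y N
  have hN' : (N:ℝ) ≠ 0 := by positivity
  have e : ∑ k ∈ Finset.range N, ((N:ℝ) - k) * Real.sin (k * y) = N * KN N y := by
    unfold KN
    rw [Finset.mul_sum]
    refine Finset.sum_congr rfl fun k _ => ?_
    field_simp
  rw [e] at h
  field_simp
  linarith

lemma KN'_closed {N : ℕ} (hN : 0 < N) (y : ℝ) :
    2 * (1 - Real.cos y) * KN' N y = Real.cos y - Real.cos (N * y) - 2 * Real.sin y * KN N y := by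
  have hN' : (N:ℝ) ≠ 0 := by positivity
  have h1 : HasDerivAt (fun y => 2 * (1 - Real.cos y) * KN N y)
      (2 * Real.sin y * KN N y + 2 * (1 - Real.cos y) * KN' N y) y := by
    have := (((Real.hasDerivAt_cos y).const_sub 1).const_mul 2).mul (KN_deriv N y)
    convert! this using 1
    ring
  have h2 : HasDerivAt (fun y => 2 * (1 - Real.cos y) * KN N y)
      (Real.cos y - Real.cos (N * y)) y := by
    simp only [KN_closed hN]
    have h3 := (((hasDerivAt_id y).const_mul (N:ℝ)).sin).div_const (N:ℝ)
    have := (Real.hasDerivAt_sin y).sub h3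
    convert! this using 1
    simp
    field_simp
  linarith [h1.unique h2]

lemma abs_sin_nat (N : ℕ) (y : ℝ) : |Real.sin (N * y)| ≤ N * |Real.sin y| := by
  induction N with
  | zero => simp
  | succ n ih =>
    push_cast
    rw [add_mul, one_mul, Real.sin_add]
    have h1 : |Real.sin (n * y) * Real.cos y| ≤ |Real.sin (n * y)| := by
      rw [abs_mul]; exact mul_le_of_le_one_right (abs_nonneg _) (Real.abs_cos_le_one _)
    have h2 : |Real.cos (n * y) * Real.sin y| ≤ |Real.sin y| := by
      rw [abs_mul]; exact mul_le_of_le_one_left (abs_nonneg _) (Real.abs_cos_le_one _)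
    have := abs_add_le (Real.sin (n * y) * Real.cos y) (Real.cos (n * y) * Real.sin y)
    linarith

lemma KN_le (N : ℕ) (y : ℝ) : |KN N y| ≤ N := by
  unfold KN
  refine (Finset.abs_sum_le_sum_abs _ _).trans ?_
  have : ∀ k ∈ Finset.range N, |(1 - (k:ℝ) / N) * Real.sin (k * y)| ≤ 1 := by
    intro k hk
    have hk' : (k:ℝ) < N := by exact_mod_cast Finset.mem_range.1 hk
    have hN : (0:ℝ) < N := (Nat.cast_nonneg k).trans_lt hk'
    have h1 : (k:ℝ) / N ≤ 1 := (div_le_one hN).2 hk'.le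
    have h2 : 0 ≤ (k:ℝ) / N := by positivity
    rw [abs_mul, abs_of_nonneg (by linarith)]
    exact mul_le_one₀ (by linarith) (abs_nonneg _) (Real.abs_sin_le_one _)
  simpa using Finset.sum_le_sum this

lemma KN'_le (N : ℕ) (y : ℝ) : |KN' N y| ≤ N ^ 2 := by
  unfold KN'
  refine (Finset.abs_sum_le_sum_abs _ _).trans ?_
  have : ∀ k ∈ Finset.range N, |(1 - (k:ℝ) / N) * (k * Real.cos (k * y))| ≤ N := by
    intro k hk
    have hk' : (k:ℝ) < N := by exact_mod_cast Finset.mem_range.1 hk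
    have hN : (0:ℝ) < N := (Nat.cast_nonneg k).trans_lt hk'
    have h1 : (k:ℝ) / N ≤ 1 := (div_le_one hN).2 hk'.le
    have h2 : 0 ≤ (k:ℝ) / N := by positivity
    have h3 : |(k:ℝ) * Real.cos (k * y)| ≤ N := by
      rw [abs_mul, Nat.abs_cast]
      calc (k:ℝ) * |Real.cos (k * y)| ≤ N * 1 := by gcongr; exact Real.abs_cos_le_one _
        _ = N := mul_one _
    rw [abs_mul, abs_of_nonneg (by linarith)]
    calc _ ≤ 1 * (N:ℝ) := by gcongr; linarith
      _ = N := one_mul _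
  refine (Finset.sum_le_sum this).trans (le_of_eq ?_)
  simp; ring

lemma one_sub_cos_ge {y : ℝ} (hy : |y| ≤ Real.pi) :
    4 * y ^ 2 ≤ Real.pi ^ 2 * (2 * (1 - Real.cos y)) := by
  have h := Real.mul_abs_le_abs_sin (x := y / 2) (by rw [abs_div, abs_two]; linarith)
  have e : 1 - Real.cos y = 2 * Real.sin (y / 2) ^ 2 := by
    have := Real.cos_two_mul' (y / 2)
    have h2 := Real.sin_sq_add_cos_sq (y / 2)
    rw [show 2 * (y / 2) = y by ring] at this
    linarith
  rw [e]
  have h1 : (2 / Real.pi * |y / 2|) ^ 2 ≤ |Real.sin (y / 2)| ^ 2 := by gcongr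
  rw [sq_abs, mul_pow, sq_abs] at h1
  have hp := Real.pi_pos
  have : (2 / Real.pi) ^ 2 * (y / 2) ^ 2 = y ^ 2 / Real.pi ^ 2 := by field_simp
  rw [this, div_le_iff₀ (by positivity)] at h1
  linarith

lemma sin_sq_le (y : ℝ) : Real.sin y ^ 2 ≤ 2 * (1 - Real.cos y) := by
  nlinarith [Real.sin_sq_add_cos_sq y, sq_nonneg (1 - Real.cos y)]

/-- `(1 - cos y) |K|^2 ≤ 2`, more precisely `2(1-cos y) K² ≤ 4`. -/
lemma KN_sq {N : ℕ} (hN : 0 < N) (y : ℝ) : 2 * (1 - Real.cos y) * (KN N y) ^ 2 ≤ 4 ∧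
    |Real.sin y * KN N y| ≤ 2 := by
  have h := KN_closed hN y
  have hN' : (0:ℝ) < N := by positivity
  have hb : |2 * (1 - Real.cos y) * KN N y| ≤ 2 * |Real.sin y| := by
    rw [h]
    have h1 : |Real.sin (N * y) / N| ≤ |Real.sin y| := by
      rw [abs_div, Nat.abs_cast, div_le_iff₀ hN']
      linarith [abs_sin_nat N y]
    have := abs_sub (Real.sin y) (Real.sin (N * y) / N)
    linarith
  have hs := sin_sq_le y
  have h0 : 0 ≤ 2 * (1 - Real.cos y) := by linarith [Real.cos_le_one y]
  generalize 2 * (1 - Real.cos y) = d at *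
  rcases h0.eq_or_lt with hd | hd
  · rw [← hd] at hs ⊢
    have : Real.sin y = 0 := by
      have := sq_nonneg (Real.sin y)
      exact pow_eq_zero_iff (two_ne_zero) |>.1 (le_antisymm hs this)
    rw [this]; norm_num
  · have h2 : (d * KN N y) ^ 2 ≤ (2 * |Real.sin y|) ^ 2 := by
      rw [← sq_abs (d * KN N y)]; gcongr
    rw [mul_pow, mul_pow, sq_abs] at h2
    have key : d * (KN N y) ^ 2 ≤ 4 := by
      by_contra hc
      push Not at hc
      nlinarith
    refine ⟨key, ?_⟩
    apply abs_le_of_sq_le_sq _ (by norm_num)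
    rw [mul_pow]
    nlinarith [sq_nonneg (KN N y)]

lemma KN_b3 {N : ℕ} (hN : 0 < N) {y : ℝ} (hy : |y| ≤ Real.pi) : |y| * |KN N y| ≤ Real.pi := by
  have h1 := (KN_sq hN y).1
  have h2 := one_sub_cos_ge hy
  rw [← abs_mul]
  apply abs_le_of_sq_le_sq _ Real.pi_pos.le
  rw [mul_pow]
  nlinarith [sq_nonneg (KN N y), sq_nonneg Real.pi]

lemma KN'_b {N : ℕ} (hN : 0 < N) {y : ℝ} (hy : |y| ≤ Real.pi) : y ^ 2 * |KN' N y| ≤ 15 := by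
  have h1 := KN'_closed hN y
  have h2 := one_sub_cos_ge hy
  have h3 := (KN_sq hN y).2
  have h0 : 0 ≤ 2 * (1 - Real.cos y) := by linarith [Real.cos_le_one y]
  have h4 : 2 * (1 - Real.cos y) * |KN' N y| ≤ 6 := by
    rw [← abs_of_nonneg h0, ← abs_mul, h1]
    have a1 := Real.abs_cos_le_one y
    have a2 := Real.abs_cos_le_one (N * y)
    rw [abs_le] at *
    constructor <;> linarith [a1.1, a1.2, a2.1, a2.2, h3.1, h3.2]
  have hp : Real.pi ^ 2 ≤ 10 := by
    nlinarith [Real.pi_lt_d2, Real.pi_pos]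
  have := mul_le_mul_of_nonneg_right h2 (abs_nonneg (KN' N y))
  nlinarith [mul_le_mul_of_nonneg_left h4 (sq_nonneg Real.pi)]

lemma int_log {N : ℕ} (hN : 0 < N) :
    ∫ y in (-Real.pi)..Real.pi, (N:ℝ) / (1 + N * |y|) = 2 * Real.log (1 + N * Real.pi) := by
  have hN' : (0:ℝ) < N := by positivity
  have hp := Real.pi_pos
  have hc : Continuous fun y : ℝ => (N:ℝ) / (1 + N * |y|) := by
    refine continuous_const.div (by fun_prop) fun y => ?_
    positivity
  have h1 : ∫ y in (0:ℝ)..Real.pi, (N:ℝ) / (1 + N * |y|) = Real.log (1 + N * Real.pi) := by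
    have : ∀ y ∈ Set.uIcc 0 Real.pi, HasDerivAt (fun y => Real.log (1 + N * y))
        ((N:ℝ) / (1 + N * |y|)) y := by
      intro y hy
      rw [Set.uIcc_of_le hp.le] at hy
      have hy0 := hy.1
      rw [abs_of_nonneg hy0]
      have := (((hasDerivAt_id y).const_mul (N:ℝ)).const_add 1).log
        (by simp only [id]; positivity)
      simpa using this
    rw [intervalIntegral.integral_eq_sub_of_hasDerivAt this (hc.intervalIntegrable _ _)]
    simp
  have h2 : ∫ y in (-Real.pi)..0, (N:ℝ) / (1 + N * |y|) = Real.log (1 + N * Real.pi) := by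
    rw [← h1]
    have := intervalIntegral.integral_comp_neg (a := 0) (b := Real.pi)
      (fun y : ℝ => (N:ℝ) / (1 + N * |y|))
    simp only [abs_neg, neg_zero] at this
    exact this.symm
  rw [← intervalIntegral.integral_add_adjacent_intervals (b := 0) (hc.intervalIntegrable _ _)
    (hc.intervalIntegrable _ _), h1, h2]
  ring

lemma int_arctan {N : ℕ} :
    ∫ y in (-Real.pi)..Real.pi, (N:ℝ) ^ 2 / (1 + (N * y) ^ 2) ≤ N * Real.pi := by
  have hc : Continuous fun y : ℝ => (N:ℝ) ^ 2 / (1 + (N * y) ^ 2) := by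
    refine continuous_const.div (by fun_prop) fun y => ?_
    positivity
  have : ∀ y ∈ Set.uIcc (-Real.pi) Real.pi, HasDerivAt (fun y => N * Real.arctan (N * y))
      ((N:ℝ) ^ 2 / (1 + (N * y) ^ 2)) y := by
    intro y _
    have := (((hasDerivAt_id y).const_mul (N:ℝ)).arctan).const_mul (N:ℝ)
    convert! this using 1
    simp only [id]
    ring
  rw [intervalIntegral.integral_eq_sub_of_hasDerivAt this (hc.intervalIntegrable _ _)]
  have h1 := Real.arctan_lt_pi_div_two (N * Real.pi)
  have h2 := Real.neg_pi_div_two_lt_arctan (N * -Real.pi)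
  have : (0:ℝ) ≤ N := by positivity
  nlinarith

lemma KN_ker {N : ℕ} (hN : 0 < N) :
    Ker (KN N) (KN' N) (38 * Real.log (1 + N * Real.pi)) (16 * (N * Real.pi)) := by
  have hN' : (0:ℝ) < N := by positivity
  have hp := Real.pi_pos
  have hpi : -Real.pi ≤ Real.pi := by linarith
  have cK := KN_cont N
  have cK' := KN'_cont N
  have hc : Continuous fun y : ℝ => (N:ℝ) / (1 + N * |y|) := by
    refine continuous_const.div (by fun_prop) fun y => ?_
    positivity
  have hc2 : Continuous fun y : ℝ => (N:ℝ) ^ 2 / (1 + (N * y) ^ 2) := by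
    refine continuous_const.div (by fun_prop) fun y => ?_
    positivity
  refine ⟨KN_deriv N, cK', KN_per N, KN_odd N, ?_, ?_, fun y => KN_b3 hN, ?_⟩
  · have : 38 * Real.log (1 + N * Real.pi) =
        ∫ y in (-Real.pi)..Real.pi, 19 * ((N:ℝ) / (1 + N * |y|)) := by
      rw [intervalIntegral.integral_const_mul, int_log hN]; ring
    rw [this]
    refine intervalIntegral.integral_mono_on hpi (cK.abs.intervalIntegrable _ _)
      ((continuous_const.mul hc).intervalIntegrable _ _) fun y hy => ?_
    rw [← mul_div_assoc, le_div_iff₀ (by positivity)]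
    have h1 := KN_le N y
    have h2 := KN_b3 hN (abs_le.2 hy)
    nlinarith [Real.pi_lt_four]
  · have : 38 * Real.log (1 + N * Real.pi) =
        ∫ y in (-Real.pi)..Real.pi, 19 * ((N:ℝ) / (1 + N * |y|)) := by
      rw [intervalIntegral.integral_const_mul, int_log hN]; ring
    rw [this]
    refine intervalIntegral.integral_mono_on hpi
      ((continuous_abs.mul cK'.abs).intervalIntegrable _ _)
      ((continuous_const.mul hc).intervalIntegrable _ _) fun y hy => ?_
    rw [← mul_div_assoc, le_div_iff₀ (by positivity)]
    have h1 := KN'_le N y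
    have h2 := KN'_b hN (abs_le.2 hy)
    rw [← sq_abs y] at h2
    have h3 : |y| * |KN' N y| ≤ 4 * N := by
      rw [← abs_of_nonneg (by positivity : 0 ≤ |y| * |KN' N y|)]
      apply abs_le_of_sq_le_sq _ (by positivity)
      have h4 : 0 ≤ |KN' N y| := abs_nonneg _
      calc (|y| * |KN' N y|) ^ 2 = (|y| ^ 2 * |KN' N y|) * |KN' N y| := by ring
        _ ≤ 15 * (N:ℝ) ^ 2 := by gcongr
        _ ≤ (4 * (N:ℝ)) ^ 2 := by nlinarith
    nlinarith
  · have h0 : ∫ y in (-Real.pi)..Real.pi, |KN' N y| ≤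
        ∫ y in (-Real.pi)..Real.pi, 16 * ((N:ℝ) ^ 2 / (1 + (N * y) ^ 2)) := by
      refine intervalIntegral.integral_mono_on hpi (cK'.abs.intervalIntegrable _ _)
        ((continuous_const.mul hc2).intervalIntegrable _ _) fun y hy => ?_
      rw [← mul_div_assoc, le_div_iff₀ (by positivity)]
      have h1 := KN'_le N y
      have h2 := KN'_b hN (abs_le.2 hy)
      nlinarith [mul_le_mul_of_nonneg_left h2 (sq_nonneg (N:ℝ))]
    refine h0.trans ?_
    rw [intervalIntegral.integral_const_mul]
    linarith [int_arctan (N := N)]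

end
end

section
noncomputable section

/-- trigonometric polynomials. -/
def TP (s : Finset ℤ) (a : ℤ → ℂ) (x : ℝ) : ℂ := ∑ ξ ∈ s, a ξ * Complex.exp (Complex.I * x * ξ)

lemma TP_cont (s : Finset ℤ) (a : ℤ → ℂ) : Continuous (TP s a) := by unfold TP; fun_prop

lemma cexp_per (ξ : ℤ) (x : ℝ) : Complex.exp (Complex.I * ((x + 2 * Real.pi : ℝ) : ℂ) * ξ) =
    Complex.exp (Complex.I * x * ξ) := by
  have : Complex.I * ((x + 2 * Real.pi : ℝ) : ℂ) * ξ =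
      Complex.I * x * ξ + ξ * (2 * Real.pi * Complex.I) := by push_cast; ring
  rw [this, Complex.exp_add, Complex.exp_int_mul_two_pi_mul_I, mul_one]

lemma TP_per (s : Finset ℤ) (a : ℤ → ℂ) : Periodic (TP s a) (2 * Real.pi) := by
  intro x
  unfold TP
  refine Finset.sum_congr rfl fun ξ _ => ?_
  rw [cexp_per]

lemma orth (k : ℤ) : ∫ x in (-Real.pi)..Real.pi, Complex.exp (Complex.I * x * k) =
    if k = 0 then 2 * (Real.pi : ℂ) else 0 := by
  split_ifs with h
  · subst h; simp; ring
  · have hk : Complex.I * (k:ℂ) ≠ 0 := mul_ne_zero Complex.I_ne_zero (by exact_mod_cast h)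
    have e : ∀ x : ℝ, Complex.I * x * k = (Complex.I * k) * x := fun x => by ring
    simp only [e]
    rw [integral_exp_mul_complex hk]
    have := cexp_per k (-Real.pi)
    have e2 : -Real.pi + 2 * Real.pi = Real.pi := by ring
    rw [e2, e, e] at this
    rw [this, sub_self, zero_div]

lemma fCoeff_TP (s : Finset ℤ) (a : ℤ → ℂ) (ξ : ℤ) :
    fCoeff (TP s a) ξ = if ξ ∈ s then 2 * (Real.pi : ℂ) * a ξ else 0 := by
  unfold fCoeff TP
  simp only [Finset.mul_sum]
  rw [intervalIntegral.integral_finsetSum]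
  · have : ∀ η ∈ s, ∫ x in (-Real.pi)..Real.pi, Complex.exp (-Complex.I * x * ξ) *
        (a η * Complex.exp (Complex.I * x * η)) = if η = ξ then 2 * (Real.pi:ℂ) * a ξ else 0 := by
      intro η _
      have e : ∀ x : ℝ, Complex.exp (-Complex.I * x * ξ) * (a η * Complex.exp (Complex.I * x * η))
          = a η * Complex.exp (Complex.I * x * ((η - ξ : ℤ))) := by
        intro x
        have : Complex.I * x * ((η - ξ : ℤ) : ℂ) = -Complex.I * x * ξ + Complex.I * x * η := by
          push_cast; ring
        rw [this, Complex.exp_add]; ring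
      simp only [e]
      rw [intervalIntegral.integral_const_mul, orth]
      by_cases h : η = ξ
      · subst h; simp; ring
      · rw [if_neg (sub_ne_zero.2 h), if_neg h, mul_zero]
    rw [Finset.sum_congr rfl this, Finset.sum_ite_eq']
  · intro η _
    exact Continuous.intervalIntegrable (by fun_prop) _ _

/-- Littlewood-Paley multipliers, `k = j + 1`. -/
def mlt (c : LPCutoff) (k : ℕ) (ξ : ℤ) : ℝ :=
  if k = 0 then c.χ ξ else c.phi ((2:ℝ) ^ (-((k:ℤ) - 1)) * ξ)

lemma LPblock_eq (c : LPCutoff) (k : ℕ) (u : ℝ → ℂ) (x : ℝ) :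
    LPblock c ((k:ℤ) - 1) u x = (1 / (2 * Real.pi)) *
      ∑' ξ : ℤ, (mlt c k ξ : ℂ) * fCoeff u ξ * Complex.exp (Complex.I * x * ξ) := by
  unfold LPblock mlt
  rcases k with _ | k
  · simp
  · have : ((k + 1 : ℕ) : ℤ) - 1 ≠ -1 := by push_cast; omega
    rw [if_neg this]
    simp only [Nat.succ_ne_zero, if_false]

lemma mlt_sum (c : LPCutoff) (J : ℕ) (ξ : ℤ) :
    ∑ k ∈ Finset.range (J + 1), mlt c k ξ = c.χ ((ξ:ℝ) / 2 ^ J) := by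
  induction J with
  | zero => simp [mlt]
  | succ n ih =>
    rw [Finset.sum_range_succ, ih, mlt, if_neg (Nat.succ_ne_zero _), LPCutoff.phi]
    have e1 : (2:ℝ) ^ (-(((n + 1 : ℕ) : ℤ) - 1)) * ξ = ξ / 2 ^ n := by
      push_cast
      rw [add_sub_cancel_right, zpow_neg, zpow_natCast]; ring
    rw [e1]
    have e2 : (ξ:ℝ) / 2 ^ n / 2 = ξ / 2 ^ (n + 1) := by rw [pow_succ]; field_simp
    rw [e2]; ring

lemma chi_abs_zero (c : LPCutoff) {x : ℝ} (h : 4 / 3 ≤ |x|) : c.χ x = 0 := by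
  by_contra hc
  have := c.supp x hc
  have h2 := abs_lt.2 ⟨this.1, this.2⟩
  linarith

lemma mlt_eq (c : LPCutoff) (k : ℕ) (ξ : ℤ) :
    mlt c (k + 1) ξ = c.χ ((ξ:ℝ) / 2 ^ (k+1)) - c.χ ((ξ:ℝ) / 2 ^ k) := by
  have h1 := mlt_sum c (k + 1) ξ
  rw [Finset.sum_range_succ, mlt_sum] at h1
  linarith

lemma mlt_zero (c : LPCutoff) {k : ℕ} {ξ : ℤ} (h : 2 ^ (k + 1) ≤ |(ξ:ℝ)|) : mlt c k ξ = 0 := by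
  rcases k with _ | k
  · simp only [mlt, if_true]
    apply chi_abs_zero
    rw [zero_add, pow_one] at h
    linarith
  · rw [mlt_eq, chi_abs_zero, chi_abs_zero, sub_zero]
    · rw [abs_div, abs_of_pos (by positivity : (0:ℝ) < 2 ^ k), le_div_iff₀ (by positivity)]
      have : (0:ℝ) < 2 ^ k := by positivity
      rw [pow_succ, pow_succ] at h
      linarith
    · rw [abs_div, abs_of_pos (by positivity : (0:ℝ) < 2 ^ (k+1)), le_div_iff₀ (by positivity)]
      have : (0:ℝ) < 2 ^ (k+1) := by positivity
      rw [pow_succ] at h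
      linarith

lemma mlt_even (c : LPCutoff) (k : ℕ) (ξ : ℤ) : mlt c k (-ξ) = mlt c k ξ := by
  rcases k with _ | k
  · simp only [mlt, if_true]; push_cast; exact c.even _
  · rw [mlt_eq, mlt_eq]; push_cast; rw [neg_div, neg_div, c.even, c.even]

/-- frequencies up to `2^(k+1)` -/
def frq (k : ℕ) : Finset ℤ := Finset.Ioo (-(2 ^ (k + 1))) (2 ^ (k + 1))

lemma mlt_frq (c : LPCutoff) {k : ℕ} {ξ : ℤ} (h : ξ ∉ frq k) : mlt c k ξ = 0 := by
  apply mlt_zero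
  by_contra hc
  push Not at hc
  apply h
  rw [abs_lt] at hc
  rw [frq, Finset.mem_Ioo]
  constructor
  · have := hc.1; exact_mod_cast this
  · have := hc.2; exact_mod_cast this

lemma LPblock_TP (c : LPCutoff) (k : ℕ) (u : ℝ → ℂ) :
    LPblock c ((k:ℤ) - 1) u = TP (frq k) fun ξ => (1 / (2 * Real.pi)) *
      ((mlt c k ξ : ℂ) * fCoeff u ξ) := by
  funext x
  rw [LPblock_eq, tsum_eq_sum (s := frq k), TP, Finset.mul_sum]
  · refine Finset.sum_congr rfl fun ξ _ => ?_
    ring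
  · intro ξ hξ
    rw [mlt_frq c hξ]; simp

lemma fCoeff_block (c : LPCutoff) (k : ℕ) (u : ℝ → ℂ) (ξ : ℤ) :
    fCoeff (LPblock c ((k:ℤ) - 1) u) ξ = mlt c k ξ * fCoeff u ξ := by
  rw [LPblock_TP, fCoeff_TP]
  have hp : (Real.pi : ℂ) ≠ 0 := by exact_mod_cast Real.pi_ne_zero
  split_ifs with h
  · field_simp
  · rw [mlt_frq c h]; simp

/-- shifted cosine coefficient. -/
def cosC (x0 : ℝ) (F : ℝ → ℂ) (k : ℕ) : ℂ :=
  ∫ y in (-Real.pi)..Real.pi, F (x0 + y) * Real.cos (k * y)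

lemma shift_int {G : ℝ → ℂ} (hG : Periodic G (2 * Real.pi)) (x0 : ℝ) :
    ∫ y in (-Real.pi)..Real.pi, G (x0 + y) = ∫ y in (-Real.pi)..Real.pi, G y := by
  rw [intervalIntegral.integral_comp_add_left]
  have := hG.intervalIntegral_add_eq (x0 + -Real.pi) (-Real.pi)
  have e1 : x0 + -Real.pi + 2 * Real.pi = x0 + Real.pi := by ring
  have e2 : -Real.pi + 2 * Real.pi = Real.pi := by ring
  rwa [e1, e2] at this

lemma cosC_eq {F : ℝ → ℂ} (hF : Continuous F) (pF : Periodic F (2 * Real.pi)) (x0 : ℝ) (k : ℕ) :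
    cosC x0 F k = (1/2) * (Complex.exp (Complex.I * x0 * ((-k : ℤ))) * fCoeff F (-k) +
      Complex.exp (Complex.I * x0 * (k:ℤ)) * fCoeff F k) := by
  have key : ∀ ξ : ℤ, ∫ y in (-Real.pi)..Real.pi, F (x0 + y) * Complex.exp (-Complex.I * y * ξ)
      = Complex.exp (Complex.I * x0 * ξ) * fCoeff F ξ := by
    intro ξ
    have hp : Periodic (fun x : ℝ => Complex.exp (-Complex.I * x * ξ) * F x) (2 * Real.pi) := by
      intro x
      have := cexp_per (-ξ) x
      have e : ∀ z : ℂ, Complex.I * z * ((-ξ : ℤ)) = -Complex.I * z * ξ := fun z => by push_cast; ring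
      rw [e, e] at this
      simp only [pF x, this]
    rw [fCoeff, ← shift_int hp x0, ← intervalIntegral.integral_const_mul]
    congr 1
    funext y
    have : Complex.exp (-Complex.I * y * ξ) = Complex.exp (Complex.I * x0 * ξ) *
        Complex.exp (-Complex.I * ((x0 + y : ℝ) : ℂ) * ξ) := by
      rw [← Complex.exp_add]; congr 1; push_cast; ring
    rw [this]; ring
  rw [← key, ← key, cosC, ← intervalIntegral.integral_add
    (Continuous.intervalIntegrable (by fun_prop) _ _)
    (Continuous.intervalIntegrable (by fun_prop) _ _), ← intervalIntegral.integral_const_mul]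
  congr 1
  funext y
  rw [Complex.ofReal_cos, Complex.cos]
  push_cast
  have e1 : -Complex.I * (y:ℂ) * (-(k:ℂ)) = k * y * Complex.I := by ring
  have e2 : -Complex.I * (y:ℂ) * (k:ℂ) = -(k * y) * Complex.I := by ring
  rw [e1, e2]
  ring

lemma cosC_block (c : LPCutoff) (j : ℕ) {F : ℝ → ℂ} (hF : Continuous F)
    (pF : Periodic F (2 * Real.pi)) (x0 : ℝ) (k : ℕ) :
    cosC x0 (LPblock c ((j:ℤ) - 1) F) k = mlt c j k * cosC x0 F k := by
  have h1 : Continuous (LPblock c ((j:ℤ) - 1) F) := by rw [LPblock_TP]; exact TP_cont _ _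
  have h2 : Periodic (LPblock c ((j:ℤ) - 1) F) (2 * Real.pi) := by rw [LPblock_TP]; exact TP_per _ _
  rw [cosC_eq h1 h2, cosC_eq hF pF, fCoeff_block, fCoeff_block, mlt_even]
  ring

/-- pairing with the derivative kernel -/
def IN (x0 : ℝ) (N : ℕ) (F : ℝ → ℂ) : ℂ :=
  ∫ y in (-Real.pi)..Real.pi, F (x0 + y) * (KN' N y : ℂ)

lemma IN_eq {F : ℝ → ℂ} (hF : Continuous F) (x0 : ℝ) (N : ℕ) :
    IN x0 N F = ∑ k ∈ Finset.range N, ((1 - (k:ℂ) / N) * k) * cosC x0 F k := by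
  unfold IN cosC
  simp only [← intervalIntegral.integral_const_mul]
  rw [← intervalIntegral.integral_finsetSum]
  · congr 1
    funext y
    unfold KN'
    push_cast
    rw [Finset.mul_sum]
    refine Finset.sum_congr rfl fun k _ => ?_
    ring
  · intro k _
    exact Continuous.intervalIntegrable (by fun_prop) _ _

lemma IN_bound {F : ℝ → ℂ} (x0 : ℝ) {N : ℕ} (hN : 0 < N) {A : ℝ}
    (hA : ∀ x, ‖F x‖ ≤ A) : ‖IN x0 N F‖ ≤ A * (16 * (N * Real.pi)) := by
  have hpi : -Real.pi ≤ Real.pi := by linarith [Real.pi_pos]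
  have hA0 : 0 ≤ A := (norm_nonneg _).trans (hA 0)
  have h1 : ‖IN x0 N F‖ ≤ ∫ y in (-Real.pi)..Real.pi, A * |KN' N y| := by
    refine intervalIntegral.norm_integral_le_of_norm_le hpi ?_
      ((continuous_const.mul (KN'_cont N).abs).intervalIntegrable _ _)
    refine Filter.Eventually.of_forall fun y _ => ?_
    rw [norm_mul, Complex.norm_real, Real.norm_eq_abs]
    gcongr
    exact hA _
  refine h1.trans ?_
  rw [intervalIntegral.integral_const_mul]
  gcongr
  exact (KN_ker hN).b4

/-- bound for band-limited functions. -/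
lemma IN_band {F : ℝ → ℂ} (hF : Continuous F) (x0 : ℝ) {N D : ℕ} (hN : 0 < N) (hD : 0 < D) {A : ℝ}
    (hA : ∀ x, ‖F x‖ ≤ A) (hz : ∀ k, D ≤ k → cosC x0 F k = 0) :
    ‖IN x0 N F‖ ≤ A * (80 * (D * Real.pi)) := by
  have hA0 : 0 ≤ A := (norm_nonneg _).trans (hA 0)
  have hp := Real.pi_pos
  by_cases hDN : N ≤ D
  · refine (IN_bound x0 hN hA).trans ?_
    have : (N:ℝ) ≤ D := by exact_mod_cast hDN
    have h2 : (N:ℝ) * Real.pi ≤ D * Real.pi := by gcongr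
    have h3 : 0 ≤ (D:ℝ) * Real.pi := by positivity
    gcongr A * ?_
    linarith
  · push Not at hDN
    have red : ∀ L, D ≤ L → IN x0 L F =
        ∑ k ∈ Finset.range D, ((1 - (k:ℂ) / L) * k) * cosC x0 F k := by
      intro L hL
      rw [IN_eq hF]
      symm
      refine Finset.sum_subset (Finset.range_subset_range.2 hL) fun k _ hk => ?_
      rw [hz k (by simpa using hk), mul_zero]
    have hDc : (D:ℂ) ≠ 0 := by exact_mod_cast hD.ne'
    have hNc : (N:ℂ) ≠ 0 := by exact_mod_cast hN.ne'
    have e : IN x0 N F = ((2 * (1 - (D:ℝ) / N) : ℝ) : ℂ) * IN x0 (2 * D) F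
        + ((2 * ((D:ℝ) / N) - 1 : ℝ) : ℂ) * IN x0 D F := by
      rw [red N hDN.le, red D le_rfl, red (2 * D) (by omega), Finset.mul_sum, Finset.mul_sum,
        ← Finset.sum_add_distrib]
      refine Finset.sum_congr rfl fun k _ => ?_
      push_cast
      field_simp
      ring
    have hr0 : 0 ≤ (D:ℝ) / N := by positivity
    have hr1 : (D:ℝ) / N ≤ 1 := by
      rw [div_le_one (by exact_mod_cast hN)]; exact_mod_cast hDN.le
    have b1 := IN_bound x0 (N := 2 * D) (by omega) hA
    have b2 := IN_bound x0 hD hA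
    rw [e]
    refine (norm_add_le _ _).trans ?_
    rw [norm_mul, norm_mul, Complex.norm_real, Complex.norm_real, Real.norm_eq_abs,
      Real.norm_eq_abs]
    have c1 : |2 * (1 - (D:ℝ) / N)| ≤ 2 := by rw [abs_le]; constructor <;> linarith
    have c2 : |2 * ((D:ℝ) / N) - 1| ≤ 1 := by rw [abs_le]; constructor <;> linarith
    calc _ ≤ 2 * (A * (16 * ((2 * D : ℕ) * Real.pi))) + 1 * (A * (16 * (D * Real.pi))) := by
          gcongr
      _ = A * (80 * (D * Real.pi)) := by push_cast; ring

end
end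

section
noncomputable section

lemma two_zpow (j : ℤ) : (2:ℝ≥0∞) ^ j = ENNReal.ofReal ((2:ℝ) ^ j) := by
  have h : (2:ℝ) ^ j = (((2:ℝ≥0) ^ j : ℝ≥0) : ℝ) := by push_cast; rfl
  rw [h, ENNReal.ofReal_coe_nnreal, ENNReal.coe_zpow (by norm_num)]; rfl

lemma block_bound (c : LPCutoff) {F : ℝ → ℂ} (hF : Continuous F)
    (pF : Periodic F (2 * Real.pi)) (x0 : ℝ) {N : ℕ} (hN : 0 < N) (k : ℕ) :
    ENNReal.ofReal ‖IN x0 N (LPblock c ((k:ℤ) - 1) F)‖ ≤ ENNReal.ofReal (320 * Real.pi) *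
      ((2:ℝ≥0∞) ^ ((k:ℤ) - 1) * supNormE (LPblock c ((k:ℤ) - 1) F)) := by
  set B := LPblock c ((k:ℤ) - 1) F with hB
  have hBc : Continuous B := by rw [hB, LPblock_TP]; exact TP_cont _ _
  by_cases hs : supNormE B = ⊤
  · rw [hs, ENNReal.mul_top, ENNReal.mul_top]
    · exact le_top
    · rw [ENNReal.ofReal_ne_zero_iff]; positivity
    · rw [two_zpow, ENNReal.ofReal_ne_zero_iff]; positivity
  · set A := (supNormE B).toReal with hA
    have hAe : supNormE B = ENNReal.ofReal A := (ENNReal.ofReal_toReal hs).symm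
    have hAb : ∀ x, ‖B x‖ ≤ A := by
      intro x
      have : (‖B x‖₊ : ℝ≥0∞) ≤ supNormE B := le_iSup (fun x => (‖B x‖₊ : ℝ≥0∞)) x
      have := ENNReal.toReal_mono hs this
      simpa using this
    have h := IN_band hBc x0 (N := N) (D := 2 ^ (k+1)) hN (by positivity) hAb (fun j hj => by
      rw [hB, cosC_block c k hF pF, mlt_zero]
      · simp
      · push_cast
        rw [Nat.abs_cast]
        exact_mod_cast hj)
    rw [two_zpow, hAe, ← ENNReal.ofReal_mul (by positivity), ← ENNReal.ofReal_mul (by positivity)]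
    apply ENNReal.ofReal_le_ofReal
    refine h.trans (le_of_eq ?_)
    rw [zpow_sub_one₀ (by norm_num), zpow_natCast]
    push_cast
    rw [pow_succ]
    ring

/-- Lower bound of the Besov norm by a pairing. -/
lemma besov_lower (c : LPCutoff) {F : ℝ → ℂ} (hF : Continuous F)
    (pF : Periodic F (2 * Real.pi)) (x0 : ℝ) {N : ℕ} (hN : 0 < N) :
    ENNReal.ofReal ‖IN x0 N F‖ ≤ ENNReal.ofReal (320 * Real.pi) * besov1E c F := by
  -- choose J with N ≤ (3/4) 2^J
  obtain ⟨J, hJ⟩ : ∃ J : ℕ, (2 * N : ℕ) ≤ 2 ^ J := ⟨2 * N, Nat.lt_two_pow_self.le⟩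
  have hJ' : 2 * (N:ℝ) ≤ 2 ^ J := by exact_mod_cast hJ
  have e : IN x0 N F = ∑ j ∈ Finset.range (J + 1), IN x0 N (LPblock c ((j:ℤ) - 1) F) := by
    have hBc : ∀ j : ℕ, Continuous (LPblock c ((j:ℤ) - 1) F) := fun j => by
      rw [LPblock_TP]; exact TP_cont _ _
    simp only [fun j : ℕ => IN_eq (hBc j) x0 N, cosC_block c _ hF pF]
    rw [Finset.sum_comm, IN_eq hF]
    refine Finset.sum_congr rfl fun k hk => ?_
    have hk' : (k:ℝ) < N := by exact_mod_cast Finset.mem_range.1 hk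
    have h1 : ∑ j ∈ Finset.range (J + 1), mlt c j k = 1 := by
      rw [mlt_sum]
      apply c.eq_one
      push_cast
      have : (0:ℝ) ≤ (k:ℝ) / 2 ^ J := by positivity
      refine ⟨by linarith, ?_⟩
      rw [div_le_iff₀ (by positivity)]
      linarith [Nat.cast_nonneg (α := ℝ) k]
    have h2 : ∑ j ∈ Finset.range (J + 1), (mlt c j k : ℂ) = 1 := by exact_mod_cast h1
    rw [← Finset.mul_sum, ← Finset.sum_mul, h2, one_mul]
  rw [e]
  calc ENNReal.ofReal ‖∑ j ∈ Finset.range (J + 1), IN x0 N (LPblock c ((j:ℤ) - 1) F)‖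
      ≤ ENNReal.ofReal (∑ j ∈ Finset.range (J + 1), ‖IN x0 N (LPblock c ((j:ℤ) - 1) F)‖) :=
        ENNReal.ofReal_le_ofReal (norm_sum_le _ _)
    _ = ∑ j ∈ Finset.range (J + 1), ENNReal.ofReal ‖IN x0 N (LPblock c ((j:ℤ) - 1) F)‖ :=
        ENNReal.ofReal_sum_of_nonneg fun _ _ => norm_nonneg _
    _ ≤ ∑ j ∈ Finset.range (J + 1), ENNReal.ofReal (320 * Real.pi) *
      ((2:ℝ≥0∞) ^ ((j:ℤ) - 1) * supNormE (LPblock c ((j:ℤ) - 1) F)) :=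
        Finset.sum_le_sum fun j _ => block_bound c hF pF x0 hN j
    _ = ENNReal.ofReal (320 * Real.pi) * ∑ j ∈ Finset.range (J + 1),
      ((2:ℝ≥0∞) ^ ((j:ℤ) - 1) * supNormE (LPblock c ((j:ℤ) - 1) F)) := by rw [Finset.mul_sum]
    _ ≤ _ := by
      gcongr
      exact ENNReal.sum_le_tsum _

/-- integration by parts against a kernel, over a period. -/
lemma ibp {w w' K K' : ℝ → ℝ} (dw : ∀ x, HasDerivAt w (w' x) x) (cw' : Continuous w')
    (pw : Periodic w (2 * Real.pi)) (dK : ∀ x, HasDerivAt K (K' x) x) (cK' : Continuous K')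
    (pK : Periodic K (2 * Real.pi)) :
    ∫ y in (-Real.pi)..Real.pi, w' y * K y = - ∫ y in (-Real.pi)..Real.pi, w y * K' y := by
  have h := intervalIntegral.integral_mul_deriv_eq_deriv_mul (a := -Real.pi) (b := Real.pi)
    (fun x _ => dw x) (fun x _ => dK x) (cw'.intervalIntegrable _ _) (cK'.intervalIntegrable _ _)
  have e1 := pw (-Real.pi)
  have e2 := pK (-Real.pi)
  have e3 : -Real.pi + 2 * Real.pi = Real.pi := by ring
  rw [e3] at e1 e2
  rw [e1, e2, sub_self, zero_sub] at h
  rw [h, neg_neg]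

lemma besov_lower_real (c : LPCutoff) {w w' : ℝ → ℝ} (dw : ∀ x, HasDerivAt w (w' x) x)
    (cw' : Continuous w') (pw : Periodic w (2 * Real.pi)) (x0 : ℝ) {N : ℕ} (hN : 0 < N) :
    ENNReal.ofReal (|∫ y in (-Real.pi)..Real.pi, w' (x0 + y) * KN N y| / (320 * Real.pi))
      ≤ besov1E c (toC w) := by
  have cw : Continuous w := continuous_iff_continuousAt.2 fun x => (dw x).continuousAt
  have h := besov_lower c (F := toC w) (Complex.continuous_ofReal.comp cw)
    (fun x => by simp only [toC, pw x]) x0 hN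
  have e : IN x0 N (toC w) = ((∫ y in (-Real.pi)..Real.pi, w (x0 + y) * KN' N y : ℝ) : ℂ) := by
    rw [IN, ← intervalIntegral.integral_ofReal]
    congr 1
    funext y
    simp [toC]
  have e2 := ibp (w := fun y => w (x0 + y)) (w' := fun y => w' (x0 + y))
    (fun x => (dw (x0 + x)).comp_const_add x0 x) (cw'.comp (by fun_prop))
    (fun x => by simp only [← add_assoc, pw (x0 + x)]) (KN_deriv N) (KN'_cont N) (KN_per N)
  rw [e, Complex.norm_real, Real.norm_eq_abs, ← abs_neg, ← e2] at h
  have hpos : (0:ℝ) < 320 * Real.pi := by positivity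
  rw [ENNReal.ofReal_div_of_pos hpos]
  apply ENNReal.div_le_of_le_mul
  rwa [mul_comm]

end
end

section
noncomputable section

/-- odd sine series. -/
def fS (β : ℕ → ℝ) (P : ℕ) (x : ℝ) : ℝ :=
  ∑ i ∈ Finset.range P, β i * Real.sin (((2 * i + 1 : ℕ) : ℝ) * x)
/-- derivative -/
def fS' (β : ℕ → ℝ) (P : ℕ) (x : ℝ) : ℝ :=
  ∑ i ∈ Finset.range P, β i * (((2 * i + 1 : ℕ) : ℝ) * Real.cos (((2 * i + 1 : ℕ) : ℝ) * x))

lemma fS_deriv (β : ℕ → ℝ) (P : ℕ) (x : ℝ) : HasDerivAt (fS β P) (fS' β P x) x := by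
  unfold fS fS'
  refine HasDerivAt.fun_sum fun k _ => ?_
  have h := (((hasDerivAt_id x).const_mul ((2 * k + 1 : ℕ):ℝ)).sin).const_mul (β k)
  simp only [id, mul_one] at h
  rw [mul_comm ((2 * k + 1 : ℕ):ℝ) (Real.cos _)]
  exact h

lemma fS'_cont (β : ℕ → ℝ) (P : ℕ) : Continuous (fS' β P) := by unfold fS'; fun_prop
lemma fS_cont (β : ℕ → ℝ) (P : ℕ) : Continuous (fS β P) := by unfold fS; fun_prop

lemma fS_odd (β : ℕ → ℝ) (P : ℕ) (y : ℝ) : fS β P (-y) = - fS β P y := by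
  unfold fS
  rw [← Finset.sum_neg_distrib]
  refine Finset.sum_congr rfl fun k _ => ?_
  rw [mul_neg, Real.sin_neg]; ring

lemma fS_per (β : ℕ → ℝ) (P : ℕ) : Periodic (fS β P) (2 * Real.pi) := by
  intro y
  unfold fS
  refine Finset.sum_congr rfl fun k _ => ?_
  rw [mul_add, Real.sin_add_nat_mul_two_pi]

lemma abel {b e : ℕ → ℝ} {B : ℝ} (hb : Antitone b) (hb0 : ∀ i, 0 ≤ b i)
    (hB : ∀ r, |∑ i ∈ Finset.range r, e i| ≤ B) (r : ℕ) :
    |∑ i ∈ Finset.range r, b i * e i| ≤ b 0 * B := by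
  have key : ∀ r, |(∑ i ∈ Finset.range r, b i * e i) - b r * ∑ i ∈ Finset.range r, e i| ≤
      (b 0 - b r) * B := by
    intro r
    induction r with
    | zero => simp
    | succ n ih =>
      have e1 : (∑ i ∈ Finset.range (n+1), b i * e i) - b (n+1) * ∑ i ∈ Finset.range (n+1), e i =
        ((∑ i ∈ Finset.range n, b i * e i) - b n * ∑ i ∈ Finset.range n, e i)
        + (b n - b (n+1)) * ∑ i ∈ Finset.range (n+1), e i := by
        simp only [Finset.sum_range_succ]; ring
      rw [e1]
      have h1 : 0 ≤ b n - b (n+1) := sub_nonneg.2 (hb (Nat.le_succ n))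
      have h2 : |(b n - b (n+1)) * ∑ i ∈ Finset.range (n+1), e i| ≤ (b n - b (n+1)) * B := by
        rw [abs_mul, abs_of_nonneg h1]
        exact mul_le_mul_of_nonneg_left (hB _) h1
      have := abs_add_le ((∑ i ∈ Finset.range n, b i * e i) - b n * ∑ i ∈ Finset.range n, e i)
        ((b n - b (n+1)) * ∑ i ∈ Finset.range (n+1), e i)
      linarith
  have h1 := key r
  have h2 : |b r * ∑ i ∈ Finset.range r, e i| ≤ b r * B := by
    rw [abs_mul, abs_of_nonneg (hb0 r)]
    exact mul_le_mul_of_nonneg_left (hB _) (hb0 r)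
  rw [abs_le] at *
  constructor <;> linarith [h1.1, h1.2, h2.1, h2.2]

lemma sin_partial (x : ℝ) (q r : ℕ) :
    2 * Real.sin x * ∑ i ∈ Finset.range r, Real.sin (((2 * (q + i) + 1 : ℕ) : ℝ) * x) =
      Real.cos (2 * q * x) - Real.cos (2 * (q + r) * x) := by
  induction r with
  | zero => simp
  | succ n ih =>
    rw [Finset.sum_range_succ, mul_add, ih]
    push_cast
    have e1 : (2 * ((q:ℝ) + n) + 1) * x = 2 * (q + n) * x + x := by ring
    have e2 : 2 * ((q:ℝ) + (n + 1)) * x = (2 * (q + n) * x + x) + x := by ring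
    have e3 : Real.cos (2 * ((q:ℝ) + n) * x) = Real.cos ((2 * ((q:ℝ) + n) * x + x) - x) := by
      congr 1; ring
    rw [e1, e2, e3, Real.cos_add (2 * ((q:ℝ) + n) * x + x) x, Real.cos_sub]
    ring

lemma fS_bdd {β : ℕ → ℝ} (hb : Antitone β) (hb0 : ∀ i, 0 ≤ β i)
    (hb1 : ∀ i, β i * ((2 * i + 1 : ℕ) : ℝ) ≤ 1) (P : ℕ) (x : ℝ) : |fS β P x| ≤ 3 := by
  set s := |Real.sin x| with hs
  have hs0 : 0 ≤ s := abs_nonneg _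
  have hs1 : s ≤ 1 := Real.abs_sin_le_one x
  have hterm : ∀ i, |β i * Real.sin (((2 * i + 1 : ℕ) : ℝ) * x)| ≤ s := by
    intro i
    rw [abs_mul, abs_of_nonneg (hb0 i)]
    calc β i * |Real.sin (((2 * i + 1 : ℕ) : ℝ) * x)| ≤ β i * (((2 * i + 1 : ℕ) : ℝ) * s) := by
          gcongr
          · exact hb0 i
          · exact abs_sin_nat _ _
      _ = (β i * ((2 * i + 1 : ℕ) : ℝ)) * s := by ring
      _ ≤ 1 * s := by gcongr; exact hb1 i
      _ = s := one_mul s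
  have hlow : ∀ q, |fS β q x| ≤ q * s := by
    intro q
    unfold fS
    refine (Finset.abs_sum_le_sum_abs _ _).trans ((Finset.sum_le_sum fun i _ => hterm i).trans ?_)
    simp
  rcases hs0.eq_or_lt with h | h
  · have := hlow P
    rw [← h, mul_zero] at this
    linarith
  · set q := ⌈1 / s⌉₊ with hq
    have hq1 : 1 / s ≤ q := Nat.le_ceil _
    have hq2 : (q:ℝ) < 1 / s + 1 := Nat.ceil_lt_add_one (by positivity)
    have hqs : (q:ℝ) * s ≤ 2 := by
      have : (1 / s + 1) * s = 1 + s := by field_simp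
      nlinarith
    have hqs1 : 1 ≤ (q:ℝ) * s := by rwa [div_le_iff₀ h] at hq1
    by_cases hP : P ≤ q
    · have h1 := hlow P
      have : (P:ℝ) * s ≤ q * s := by gcongr
      linarith
    · push Not at hP
      obtain ⟨r, rfl⟩ := Nat.exists_eq_add_of_le hP.le
      have e : fS β (q + r) x = fS β q x + ∑ i ∈ Finset.range r, β (q + i) *
          Real.sin (((2 * (q + i) + 1 : ℕ) : ℝ) * x) := by
        unfold fS
        rw [Finset.sum_range_add]
      have hB : ∀ r, |∑ i ∈ Finset.range r, Real.sin (((2 * (q + i) + 1 : ℕ) : ℝ) * x)| ≤ 1 / s := by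
        intro r
        have h1 := sin_partial x q r
        have h2 : |2 * Real.sin x * ∑ i ∈ Finset.range r,
            Real.sin (((2 * (q + i) + 1 : ℕ) : ℝ) * x)| ≤ 2 := by
          rw [h1]
          have a1 := Real.abs_cos_le_one (2 * q * x)
          have a2 := Real.abs_cos_le_one (2 * (q + r) * x)
          rw [abs_le] at *
          constructor <;> linarith [a1.1, a1.2, a2.1, a2.2]
        rw [abs_mul, abs_mul, abs_two] at h2
        rw [le_div_iff₀ h]
        linarith
      have h3 := abel (b := fun i => β (q + i)) (fun i j hij => hb (by omega)) (fun i => hb0 _) hB r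
      have h4 : β (q + 0) * (1 / s) ≤ 1 := by
        have := hb1 q
        rw [add_zero, mul_one_div, div_le_one h]
        push_cast at this
        have hb0q := hb0 q
        by_contra hc
        push Not at hc
        have : (q:ℝ) * s < q * β q := by
          apply mul_lt_mul_of_pos_left hc
          by_contra h0
          push Not at h0
          nlinarith
        nlinarith
      rw [e]
      have := abs_add_le (fS β q x) (∑ i ∈ Finset.range r, β (q + i) *
          Real.sin (((2 * (q + i) + 1 : ℕ) : ℝ) * x))
      linarith [hlow q]

lemma fS'_bdd {β : ℕ → ℝ} (hb0 : ∀ i, 0 ≤ β i)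
    (hb1 : ∀ i, β i * ((2 * i + 1 : ℕ) : ℝ) ≤ 1) (P : ℕ) (x : ℝ) : |fS' β P x| ≤ P := by
  unfold fS'
  refine (Finset.abs_sum_le_sum_abs _ _).trans ?_
  have : ∀ i ∈ Finset.range P, |β i * (((2 * i + 1 : ℕ) : ℝ) *
      Real.cos (((2 * i + 1 : ℕ) : ℝ) * x))| ≤ 1 := by
    intro i _
    rw [← mul_assoc, abs_mul, abs_of_nonneg (mul_nonneg (hb0 i) (Nat.cast_nonneg _))]
    exact mul_le_one₀ (hb1 i) (abs_nonneg _) (Real.abs_cos_le_one _)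
  simpa using Finset.sum_le_sum this

lemma int_cos_int (k : ℤ) : ∫ x in (-Real.pi)..Real.pi, Real.cos (k * x) =
    if k = 0 then 2 * Real.pi else 0 := by
  split_ifs with h
  · subst h; simp; ring
  · have hk : (k:ℝ) ≠ 0 := by exact_mod_cast h
    rw [intervalIntegral.integral_comp_mul_left _ hk, integral_cos]
    simp [Real.sin_int_mul_pi]

lemma int_sin_sin {j k : ℕ} (hj : 0 < j) :
    ∫ x in (-Real.pi)..Real.pi, Real.sin (j * x) * Real.sin (k * x) =
    if j = k then Real.pi else 0 := by
  have e : ∀ x : ℝ, Real.sin (j * x) * Real.sin (k * x) =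
      (1/2) * (Real.cos (((j:ℤ) - k : ℤ) * x)) - (1/2) * (Real.cos (((j:ℤ) + k : ℤ) * x)) := by
    intro x
    push_cast
    rw [sub_mul, add_mul, Real.cos_sub, Real.cos_add]; ring
  simp only [e]
  rw [intervalIntegral.integral_sub (Continuous.intervalIntegrable (by fun_prop) _ _)
    (Continuous.intervalIntegrable (by fun_prop) _ _), intervalIntegral.integral_const_mul,
    intervalIntegral.integral_const_mul, int_cos_int, int_cos_int, if_neg (by omega : (j:ℤ) + k ≠ 0)]
  by_cases h : j = k
  · subst h; simp
  · rw [if_neg h, if_neg (by omega : (j:ℤ) - k ≠ 0)]; simp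

lemma int_sin_KN {j N : ℕ} (hj : 0 < j) :
    ∫ x in (-Real.pi)..Real.pi, Real.sin (j * x) * KN N x =
    if j < N then Real.pi * (1 - j / N) else 0 := by
  unfold KN
  simp only [Finset.mul_sum]
  rw [intervalIntegral.integral_finsetSum (fun k _ => Continuous.intervalIntegrable (by fun_prop) _ _)]
  have : ∀ k ∈ Finset.range N, ∫ x in (-Real.pi)..Real.pi, Real.sin (j * x) *
      ((1 - (k:ℝ) / N) * Real.sin (k * x)) = if j = k then Real.pi * (1 - j / N) else 0 := by
    intro k _
    have e : ∀ x : ℝ, Real.sin (j * x) * ((1 - (k:ℝ) / N) * Real.sin (k * x)) =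
      (1 - (k:ℝ) / N) * (Real.sin (j * x) * Real.sin (k * x)) := fun x => by ring
    simp only [e]
    rw [intervalIntegral.integral_const_mul, int_sin_sin hj]
    split_ifs with h
    · subst h; ring
    · simp
  rw [Finset.sum_congr rfl this, Finset.sum_ite_eq]
  simp

lemma int_fS_KN {β : ℕ → ℝ} {P q : ℕ} (hb0 : ∀ i, 0 ≤ β i) (hq : 0 < q) (hqP : q ≤ P)
    (hb : ∀ i < q, β i = 2 / Real.pi / ((2 * i + 1 : ℕ) : ℝ)) :
    Real.log q - 1 ≤ ∫ x in (-Real.pi)..Real.pi, fS β P x * KN (2 * q) x := by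
  have hp := Real.pi_pos
  have e : ∫ x in (-Real.pi)..Real.pi, fS β P x * KN (2 * q) x = ∑ i ∈ Finset.range P, β i *
      (if 2 * i + 1 < 2 * q then Real.pi * (1 - ((2 * i + 1 : ℕ) : ℝ) / ((2 * q : ℕ) : ℝ)) else 0) := by
    unfold fS
    simp only [Finset.sum_mul]
    have cK := KN_cont (2 * q)
    rw [intervalIntegral.integral_finsetSum
      (fun k _ => Continuous.intervalIntegrable (by fun_prop) _ _)]
    refine Finset.sum_congr rfl fun i _ => ?_
    rw [← int_sin_KN (by omega), ← intervalIntegral.integral_const_mul]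
    congr 1; funext x; ring
  rw [e]
  have hq' : (0:ℝ) < q := by exact_mod_cast hq
  have h1 : ∑ i ∈ Finset.range q, (1 / ((i:ℝ) + 1) - 1 / q) ≤ ∑ i ∈ Finset.range P, β i *
      (if 2 * i + 1 < 2 * q then Real.pi * (1 - ((2 * i + 1 : ℕ) : ℝ) / ((2 * q : ℕ) : ℝ)) else 0) := by
    refine le_trans ?_ (Finset.sum_le_sum_of_subset_of_nonneg (Finset.range_subset_range.2 hqP) ?_)
    · refine Finset.sum_le_sum fun i hi => ?_
      have hi := Finset.mem_range.1 hi
      rw [if_pos (by omega), hb i hi]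
      push_cast
      have hi' : (i:ℝ) + 1 ≤ q := by exact_mod_cast hi
      have hi0 : (0:ℝ) ≤ i := Nat.cast_nonneg i
      have : 2 / Real.pi / (2 * (i:ℝ) + 1) * (Real.pi * (1 - (2 * (i:ℝ) + 1) / (2 * q))) =
        2 / (2 * (i:ℝ) + 1) - 1 / q := by field_simp
      rw [this]
      have h2 : 1 / ((i:ℝ) + 1) ≤ 2 / (2 * (i:ℝ) + 1) := by
        rw [div_le_div_iff₀ (by positivity) (by positivity)]; linarith
      linarith
    · intro i _ _
      split_ifs with h
      · have h' : ((2 * i + 1 : ℕ) : ℝ) ≤ ((2 * q : ℕ) : ℝ) := by exact_mod_cast h.le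
        have h2 : ((2 * i + 1 : ℕ) : ℝ) / ((2 * q : ℕ) : ℝ) ≤ 1 :=
          (div_le_one (by push_cast; linarith)).2 h'
        have := hb0 i
        have h3 : 0 ≤ 1 - ((2 * i + 1 : ℕ) : ℝ) / ((2 * q : ℕ) : ℝ) := by linarith
        positivity
      · simp
  refine le_trans ?_ h1
  rw [Finset.sum_sub_distrib]
  have h2 : ∑ i ∈ Finset.range q, (1 / (q:ℝ)) = 1 := by simp; field_simp
  rw [h2]
  have h3 := log_add_one_le_harmonic q
  have h4 : ((harmonic q : ℚ) : ℝ) = ∑ i ∈ Finset.range q, 1 / ((i:ℝ) + 1) := by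
    simp [harmonic]
  have h5 : Real.log q ≤ Real.log ((q + 1 : ℕ) : ℝ) := Real.log_le_log hq' (by push_cast; linarith)
  linarith

end
end

section
noncomputable section

lemma hFun_pos {x : ℝ} (h0 : 0 < x) (h1 : x < Real.pi) : hFun x = 1/2 := by
  have hf : ⌊(x + Real.pi) / (2 * Real.pi)⌋ = 0 := by
    rw [Int.floor_eq_zero_iff]
    constructor
    · have := Real.pi_pos; positivity
    · rw [div_lt_one (by linarith)]; linarith
  simp only [hFun, hf]
  simp only [Int.cast_zero, mul_zero, sub_zero]
  rw [if_neg (by push Not; constructor <;> linarith), if_pos h0]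

lemma hFun_neg {x : ℝ} (h0 : x < 0) (h1 : -Real.pi < x) : hFun x = -1/2 := by
  have hf : ⌊(x + Real.pi) / (2 * Real.pi)⌋ = 0 := by
    rw [Int.floor_eq_zero_iff]
    have := Real.pi_pos
    constructor
    · apply div_nonneg <;> linarith
    · rw [div_lt_one (by linarith)]; linarith
  simp only [hFun, hf]
  simp only [Int.cast_zero, mul_zero, sub_zero]
  rw [if_neg (by push Not; constructor <;> linarith), if_neg (by linarith)]

lemma fCoeff_h (ξ : ℤ) : fCoeff (toC hFun) ξ =
    -Complex.I * ((∫ x in (0:ℝ)..Real.pi, Real.sin (ξ * x) : ℝ) : ℂ) := by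
  have hp := Real.pi_pos
  unfold fCoeff
  set E : ℝ → ℂ := fun x => Complex.exp (-Complex.I * x * ξ) with hE
  have cE : Continuous E := by rw [hE]; fun_prop
  have ae_ne : ∀ z : ℝ, ∀ᵐ x : ℝ, x ≠ z := fun z => by
    rw [ae_iff]; simp
  have a1 : ∀ᵐ x : ℝ, x ∈ Set.uIoc 0 Real.pi → (1/2 : ℂ) * E x = E x * toC hFun x := by
    filter_upwards [ae_ne Real.pi] with x hx hx2
    rw [Set.uIoc_of_le hp.le] at hx2
    rw [toC, hFun_pos hx2.1 (lt_of_le_of_ne hx2.2 hx)]; push_cast; ring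
  have a2 : ∀ᵐ x : ℝ, x ∈ Set.uIoc (-Real.pi) 0 → (-1/2 : ℂ) * E x = E x * toC hFun x := by
    filter_upwards [ae_ne 0] with x hx hx2
    rw [Set.uIoc_of_le (by linarith)] at hx2
    rw [toC, hFun_neg (lt_of_le_of_ne hx2.2 hx) hx2.1]; push_cast; ring
  have i1 : IntervalIntegrable (fun x => E x * toC hFun x) volume 0 Real.pi := by
    have h : IntervalIntegrable (fun x => (1/2 : ℂ) * E x) volume 0 Real.pi :=
      (continuous_const.mul cE).intervalIntegrable _ _
    refine h.congr_ae ?_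
    exact (ae_restrict_iff' measurableSet_uIoc).2 a1
  have i2 : IntervalIntegrable (fun x => E x * toC hFun x) volume (-Real.pi) 0 := by
    have h : IntervalIntegrable (fun x => (-1/2 : ℂ) * E x) volume (-Real.pi) 0 :=
      (continuous_const.mul cE).intervalIntegrable _ _
    refine h.congr_ae ?_
    exact (ae_restrict_iff' measurableSet_uIoc).2 a2
  rw [← intervalIntegral.integral_add_adjacent_intervals i2 i1,
    ← intervalIntegral.integral_congr_ae a1, ← intervalIntegral.integral_congr_ae a2]
  have e3 : ∫ x in (-Real.pi)..0, (-1/2 : ℂ) * E x = ∫ x in (0:ℝ)..Real.pi, (-1/2 : ℂ) * E (-x) := by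
    rw [intervalIntegral.integral_comp_neg (fun x => (-1/2 : ℂ) * E x)]; simp
  rw [e3, ← intervalIntegral.integral_add (Continuous.intervalIntegrable (by fun_prop) _ _)
    (Continuous.intervalIntegrable (by fun_prop) _ _), ← intervalIntegral.integral_ofReal,
    ← intervalIntegral.integral_const_mul]
  congr 1
  funext x
  simp only [hE]
  rw [Complex.ofReal_sin, Complex.sin]
  push_cast
  have e1 : -Complex.I * -(x:ℂ) * ξ = ξ * x * Complex.I := by ring
  have e2 : -Complex.I * (x:ℂ) * ξ = -(ξ * x) * Complex.I := by ring
  rw [e1, e2]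
  ring_nf
  rw [Complex.I_sq]
  ring

lemma int_sin_half (ξ : ℤ) (hξ : ξ ≠ 0) : ∫ x in (0:ℝ)..Real.pi, Real.sin (ξ * x) =
    (1 - Real.cos (ξ * Real.pi)) / ξ := by
  have hk : (ξ:ℝ) ≠ 0 := by exact_mod_cast hξ
  rw [intervalIntegral.integral_comp_mul_left _ hk, integral_sin]
  simp
  field_simp

lemma fCoeff_h_even {ξ : ℤ} (h : Even ξ) : fCoeff (toC hFun) ξ = 0 := by
  rw [fCoeff_h]
  by_cases h0 : ξ = 0
  · subst h0; simp
  · rw [int_sin_half ξ h0]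
    obtain ⟨r, rfl⟩ := h
    have : (((r + r : ℤ)) : ℝ) * Real.pi = r * (2 * Real.pi) := by push_cast; ring
    rw [this, Real.cos_int_mul_two_pi]
    simp

lemma fCoeff_h_odd {ξ : ℤ} (h : Odd ξ) : fCoeff (toC hFun) ξ = -Complex.I * ((2 / ξ : ℝ) : ℂ) := by
  rw [fCoeff_h, int_sin_half]
  · obtain ⟨r, rfl⟩ := h
    have : (((2 * r + 1 : ℤ)) : ℝ) * Real.pi = Real.pi + r * (2 * Real.pi) := by push_cast; ring
    rw [this, Real.cos_add_int_mul_two_pi, Real.cos_pi]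
    norm_num
  · rintro rfl; simp at h

/-- coefficients of `fLow` -/
def bet (c : LPCutoff) (P : ℕ) (i : ℕ) : ℝ :=
  2 / Real.pi * c.χ (((2 * i + 1 : ℕ) : ℝ) / P) / ((2 * i + 1 : ℕ) : ℝ)

lemma fLow_eq (c : LPCutoff) (m : ℕ) : fLow c (16 * m) = fS (bet c (2 ^ (8 * m))) (2 ^ (8 * m)) := by
  funext x
  set P : ℕ := 2 ^ (8 * m) with hP
  have hPpos : (0:ℝ) < P := by rw [hP]; positivity
  unfold fLow LPlow
  have e0 : (((16 * m : ℕ) : ℤ) / 2) = ((8 * m : ℕ) : ℤ) := by omega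
  have e1 : ∀ ξ : ℤ, (2:ℝ) ^ (-((8 * m : ℕ) : ℤ)) * ξ = ξ / P := by
    intro ξ
    rw [zpow_neg, zpow_natCast, hP]; push_cast; ring
  rw [e0]
  simp only [e1]
  set G : ℤ → ℂ := fun ξ => (c.χ ((ξ:ℝ) / P) : ℂ) * fCoeff (toC hFun) ξ *
    Complex.exp (Complex.I * x * ξ) with hG
  let p1 : ℕ → ℤ := fun i => 2 * i + 1
  let p2 : ℕ → ℤ := fun i => -(2 * i + 1)
  have hp1 : Function.Injective p1 := fun a b h => by simp only [p1] at h; omega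
  have hp2 : Function.Injective p2 := fun a b h => by simp only [p2] at h; omega
  have hsum : ∑' ξ, G ξ = ∑ i ∈ Finset.range P, (G (p1 i) + G (p2 i)) := by
    rw [tsum_eq_sum (s := (Finset.range P).image p1 ∪ (Finset.range P).image p2),
      Finset.sum_union, Finset.sum_image hp1.injOn, Finset.sum_image hp2.injOn,
      Finset.sum_add_distrib]
    · rw [Finset.disjoint_left]
      intro a ha hb
      simp only [Finset.mem_image, p1, p2] at ha hb
      obtain ⟨i, -, rfl⟩ := ha
      obtain ⟨j, -, h⟩ := hb
      omega
    · intro ξ hξ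
      simp only [hG]
      rcases Int.even_or_odd ξ with h | h
      · rw [fCoeff_h_even h]; simp
      · rw [chi_abs_zero]
        · simp
        · rw [abs_div, Nat.abs_cast, le_div_iff₀ hPpos]
          by_contra hc
          push Not at hc
          have hc2 : |ξ| < 2 * P := by
            have : |(ξ:ℝ)| < 2 * P := by linarith
            exact_mod_cast this
          apply hξ
          rw [Finset.mem_union, Finset.mem_image, Finset.mem_image]
          obtain ⟨r, rfl⟩ := h
          rw [abs_lt] at hc2
          rcases le_or_gt 0 r with hr | hr
          · left
            exact ⟨r.toNat, Finset.mem_range.2 (by omega), by simp only [p1]; omega⟩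
          · right
            exact ⟨(-r - 1).toNat, Finset.mem_range.2 (by omega), by simp only [p2]; omega⟩
  rw [hsum, Finset.mul_sum, Complex.re_sum, fS]
  refine Finset.sum_congr rfl fun i _ => ?_
  have o1 : Odd (p1 i) := ⟨i, rfl⟩
  have o2 : Odd (p2 i) := ⟨-i - 1, by simp only [p2]; ring⟩
  have key : G (p1 i) + G (p2 i) = ((c.χ (((2 * i + 1 : ℕ) : ℝ) / P) * (4 / ((2 * i + 1 : ℕ) : ℝ))
      * Real.sin (((2 * i + 1 : ℕ) : ℝ) * x) : ℝ) : ℂ) := by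
    simp only [hG]
    rw [fCoeff_h_odd o1, fCoeff_h_odd o2]
    have q1 : ((p1 i : ℤ) : ℝ) = ((2 * i + 1 : ℕ) : ℝ) := by simp [p1]
    have q2 : ((p2 i : ℤ) : ℝ) = -((2 * i + 1 : ℕ) : ℝ) := by simp [p2]
    have q1' : ((p1 i : ℤ) : ℂ) = (((2 * i + 1 : ℕ) : ℝ) : ℂ) := by simp [p1]
    have q2' : ((p2 i : ℤ) : ℂ) = -(((2 * i + 1 : ℕ) : ℝ) : ℂ) := by simp [p2]
    rw [q1, q2, q1', q2', neg_div, c.even]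
    generalize ((2 * i + 1 : ℕ) : ℝ) = k
    rw [Complex.ofReal_mul, Complex.ofReal_sin, Complex.sin]
    push_cast
    have e1 : Complex.I * (x:ℂ) * -(k:ℂ) = -(k * x) * Complex.I := by ring
    have e2 : Complex.I * (x:ℂ) * (k:ℂ) = (k * x) * Complex.I := by ring
    rw [e1, e2]
    simp only [div_neg]
    ring
  rw [key]
  have e3 : (1 / (2 * (Real.pi:ℂ))) = ((1 / (2 * Real.pi) : ℝ) : ℂ) := by push_cast; ring
  rw [e3, ← Complex.ofReal_mul, Complex.ofReal_re, bet]
  have := Real.pi_pos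
  field_simp
  ring

lemma bet_nonneg (c : LPCutoff) (P i : ℕ) : 0 ≤ bet c P i := by
  have := Real.pi_pos
  have := c.nonneg (((2 * i + 1 : ℕ) : ℝ) / P)
  unfold bet
  positivity

lemma bet_anti (c : LPCutoff) (P : ℕ) : Antitone (bet c P) := by
  intro i j hij
  have := Real.pi_pos
  have h0 := c.nonneg (((2 * i + 1 : ℕ) : ℝ) / P)
  have hc : ((2 * i + 1 : ℕ) : ℝ) ≤ ((2 * j + 1 : ℕ) : ℝ) := by
    have : 2 * i + 1 ≤ 2 * j + 1 := by omega
    exact_mod_cast this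
  have h1 : c.χ (((2 * j + 1 : ℕ) : ℝ) / P) ≤ c.χ (((2 * i + 1 : ℕ) : ℝ) / P) := by
    apply c.decay
    · exact Set.mem_Ici.2 (by positivity)
    · exact Set.mem_Ici.2 (by positivity)
    · gcongr
  unfold bet
  gcongr

lemma bet_le (c : LPCutoff) (P i : ℕ) : bet c P i * ((2 * i + 1 : ℕ) : ℝ) ≤ 1 := by
  have hp := Real.pi_gt_three
  have h0 := c.le_one (((2 * i + 1 : ℕ) : ℝ) / P)
  have h1 := c.nonneg (((2 * i + 1 : ℕ) : ℝ) / P)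
  unfold bet
  rw [div_mul_cancel₀ _ (by positivity)]
  have : 2 / Real.pi ≤ 1 := by rw [div_le_one (by linarith)]; linarith
  exact mul_le_one₀ this h1 h0

lemma bet_eq (c : LPCutoff) {P i : ℕ} (h : 4 * (2 * i + 1) ≤ 3 * P) :
    bet c P i = 2 / Real.pi / ((2 * i + 1 : ℕ) : ℝ) := by
  unfold bet
  have h' : 4 * ((2 * i + 1 : ℕ) : ℝ) ≤ 3 * P := by exact_mod_cast h
  have hP : (0:ℝ) < P := by
    have : 0 < P := by omega
    exact_mod_cast this
  rw [c.eq_one, mul_one]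
  have : (0:ℝ) ≤ ((2 * i + 1 : ℕ) : ℝ) / P := by positivity
  refine ⟨by linarith, ?_⟩
  rw [div_le_iff₀ hP]
  linarith

end
end

section
noncomputable section

/-- abstract data -/
def vD (a L : ℝ) (Q : ℕ) (f : ℝ → ℝ) (x : ℝ) : ℝ :=
  a * L / Q * Real.cos (Q * x) * (1 + a * f x) + a
/-- derivative -/
def vD' (a L : ℝ) (Q : ℕ) (f f' : ℝ → ℝ) (x : ℝ) : ℝ :=
  -(a * L) * (Real.sin (Q * x) * (1 + a * f x)) + a * L / Q * (Real.cos (Q * x) * (a * f' x))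

lemma vD_deriv {a L : ℝ} {Q : ℕ} {f f' : ℝ → ℝ} (hQ : 0 < Q) (df : ∀ x, HasDerivAt f (f' x) x) (x : ℝ) :
    HasDerivAt (vD a L Q f) (vD' a L Q f f' x) x := by
  have h1 := ((hasDerivAt_id x).const_mul (Q:ℝ)).cos
  have h2 := ((df x).const_mul a).const_add 1
  have h3 := (((h1.const_mul (a * L / Q)).mul h2)).add_const a
  unfold vD vD'
  have hq : (Q:ℝ) ≠ 0 := by positivity
  convert! h3 using 1
  simp only [id]
  field_simp

section
variable {a L P : ℝ} {Q : ℕ} {f f' : ℝ → ℝ}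

lemma vD_close (ha : 0 ≤ a) (ha1 : a ≤ 1) (hL : 0 ≤ L) (bf : ∀ x, |f x| ≤ 3) (x : ℝ) :
    |vD a L Q f x - a| ≤ 4 * (a * L / Q) := by
  have hf := bf x
  have h1 : |1 + a * f x| ≤ 4 := by
    rw [abs_le] at hf ⊢; constructor <;> nlinarith
  have h2 := Real.abs_cos_le_one (Q * x)
  have h0 : 0 ≤ a * L / Q := by positivity
  unfold vD
  rw [add_sub_cancel_right, abs_mul, abs_mul, abs_of_nonneg h0]
  calc a * L / Q * |Real.cos (Q * x)| * |1 + a * f x| ≤ a * L / Q * 1 * 4 := by gcongr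
    _ = _ := by ring

lemma vD'_bd (ha : 0 ≤ a) (ha1 : a ≤ 1) (hL : 0 ≤ L) (hQ : 0 < Q) (bf : ∀ x, |f x| ≤ 3)
    (bf' : ∀ x, |f' x| ≤ P) (hPQ : P ≤ Q) (x : ℝ) :
    |vD' a L Q f f' x| ≤ 5 * (a * L) := by
  have hf := bf x
  have h1 : |1 + a * f x| ≤ 4 := by
    rw [abs_le] at hf ⊢; constructor <;> nlinarith
  have h2 := Real.abs_cos_le_one (Q * x)
  have h3 := Real.abs_sin_le_one (Q * x)
  have h0 : 0 ≤ a * L := by positivity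
  have hP : 0 ≤ P := (abs_nonneg _).trans (bf' x)
  have hq : (0:ℝ) < Q := by exact_mod_cast hQ
  unfold vD'
  refine (abs_add_le _ _).trans ?_
  rw [abs_mul, abs_mul, abs_mul, abs_mul, abs_mul, abs_neg, abs_of_nonneg h0, abs_of_nonneg (div_nonneg h0 hq.le),
    abs_of_nonneg ha]
  calc a * L * (|Real.sin (Q * x)| * |1 + a * f x|) + a * L / Q * (|Real.cos (Q * x)| * (a * |f' x|))
      ≤ a * L * (1 * 4) + a * L / Q * (1 * (1 * P)) := by gcongr; exact bf' x
    _ ≤ a * L * (1 * 4) + a * L / Q * (1 * (1 * Q)) := by gcongr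
    _ = _ := by field_simp; ring

lemma vD_per (pf : Periodic f (2 * Real.pi)) : Periodic (vD a L Q f) (2 * Real.pi) := by
  intro x
  unfold vD
  rw [pf x, mul_add (Q:ℝ), Real.cos_add_nat_mul_two_pi]

lemma vD_int1 {K K' : ℝ → ℝ} {Λ Λ' : ℝ} (hK : Ker K K' Λ Λ') (ha : 0 ≤ a) (ha1 : a ≤ 1) (hL : 0 ≤ L) (hQ : 0 < Q)
    (df : ∀ x, HasDerivAt f (f' x) x) (cf' : Continuous f') (pf : Periodic f (2 * Real.pi))
    (bf : ∀ x, |f x| ≤ 3) :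
    |∫ y in (-Real.pi)..Real.pi, vD' a L Q f f' y * K y| ≤ 4 * (a * L / Q) * Λ' := by
  have cf : Continuous f := continuous_iff_continuousAt.2 fun x => (df x).continuousAt
  have cv : Continuous (vD' a L Q f f') := by unfold vD'; fun_prop
  have h := ibp (w := fun x => vD a L Q f x - a) (w' := vD' a L Q f f')
    (fun x => (vD_deriv hQ df x).sub_const a) cv (fun x => by simp only [vD_per pf x]) hK.dK hK.cK' hK.per
  rw [h, abs_neg]
  have h2 : |∫ y in (-Real.pi)..Real.pi, (vD a L Q f y - a) * K' y| ≤
      ∫ y in (-Real.pi)..Real.pi, 4 * (a * L / Q) * |K' y| := by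
    have := hK.cK'
    refine abs_int_le (by fun_prop) fun y _ => ?_
    rw [abs_mul]
    gcongr
    exact vD_close ha ha1 hL bf y
  refine h2.trans ?_
  rw [intervalIntegral.integral_const_mul]
  have := hK.b4
  gcongr

lemma cos_int {K K' : ℝ → ℝ} {Λ Λ' : ℝ} (hK : Ker K K' Λ Λ') (hQ : 0 < Q)
    (df : ∀ x, HasDerivAt f (f' x) x) (cf' : Continuous f') (pf : Periodic f (2 * Real.pi))
    (bf : ∀ x, |f x| ≤ 3) (bf' : ∀ x, |f' x| ≤ P) :
    |∫ y in (-Real.pi)..Real.pi, Real.cos (2 * Q * y) * (f y * K y)| ≤ (P * Λ + 3 * Λ') / (2 * Q) := by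
  have cf : Continuous f := continuous_iff_continuousAt.2 fun x => (df x).continuousAt
  have hq : (0:ℝ) < Q := by exact_mod_cast hQ
  have hP : 0 ≤ P := (abs_nonneg _).trans (bf' 0)
  have cK := hK.cK
  have cK' := hK.cK'
  have h := ibp (w := fun x => Real.sin (2 * Q * x) / (2 * Q)) (w' := fun x => Real.cos (2 * Q * x))
    (K := fun x => f x * K x) (K' := fun x => f' x * K x + f x * K' x)
    (fun x => by
      have h1 := (((hasDerivAt_id x).const_mul (2 * (Q:ℝ))).sin).div_const (2 * Q)
      convert! h1 using 1
      simp only [id]; field_simp) (by fun_prop)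
    (fun x => by
      have : 2 * (Q:ℝ) * (x + 2 * Real.pi) = 2 * Q * x + (2 * Q : ℕ) * (2 * Real.pi) := by push_cast; ring
      simp only [this, Real.sin_add_nat_mul_two_pi])
    (fun x => (df x).mul (hK.dK x)) (by fun_prop) (fun x => by simp only [pf x, hK.per x])
  rw [h, abs_neg]
  have h2 : |∫ y in (-Real.pi)..Real.pi, Real.sin (2 * Q * y) / (2 * Q) * (f' y * K y + f y * K' y)| ≤
      ∫ y in (-Real.pi)..Real.pi, 1 / (2 * (Q:ℝ)) * (P * |K y| + 3 * |K' y|) := by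
    refine abs_int_le (by fun_prop) fun y _ => ?_
    rw [abs_mul, abs_div, abs_of_pos (by positivity : (0:ℝ) < 2 * Q)]
    have := Real.abs_sin_le_one (2 * Q * y)
    have h3 : |f' y * K y + f y * K' y| ≤ P * |K y| + 3 * |K' y| := by
      refine (abs_add_le _ _).trans ?_
      rw [abs_mul, abs_mul]
      have := bf y
      have := bf' y
      gcongr
    gcongr
  refine h2.trans ?_
  rw [intervalIntegral.integral_const_mul, intervalIntegral.integral_add
    (Continuous.intervalIntegrable (by fun_prop) _ _) (Continuous.intervalIntegrable (by fun_prop) _ _),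
    intervalIntegral.integral_const_mul, intervalIntegral.integral_const_mul, one_div, inv_mul_eq_div]
  have := hK.b4
  have := hK.b1
  gcongr

lemma vD_int2 {K K' : ℝ → ℝ} {Λ Λ' : ℝ} (hK : Ker K K' Λ Λ') (ha : 0 ≤ a) (ha1 : a ≤ 1) (hL : 0 ≤ L) (hQ : 0 < Q)
    (df : ∀ x, HasDerivAt f (f' x) x) (cf' : Continuous f') (pf : Periodic f (2 * Real.pi))
    (of : ∀ x, f (-x) = - f x)
    (bf : ∀ x, |f x| ≤ 3) (bf' : ∀ x, |f' x| ≤ P) (hPQ : P ≤ Q) :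
    a ^ 3 * L ^ 2 * ((∫ y in (-Real.pi)..Real.pi, f y * K y) - ((P * Λ + 3 * Λ') / (2 * Q) + 9 * P * Λ / Q)) ≤
    ∫ y in (-Real.pi)..Real.pi, (vD' a L Q f f' y) ^ 2 * K y := by
  have cf : Continuous f := continuous_iff_continuousAt.2 fun x => (df x).continuousAt
  have hq : (0:ℝ) < Q := by exact_mod_cast hQ
  have hP : 0 ≤ P := (abs_nonneg _).trans (bf' 0)
  have cK := hK.cK
  have hc := cos_int hK hQ df cf' pf bf bf'
  set o : ℝ → ℝ := fun y => a ^ 2 * L ^ 2 * ((Real.sin (Q * y) ^ 2 + a ^ 2 * Real.sin (Q * y) ^ 2 * f y ^ 2) * K y) with ho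
  set R : ℝ → ℝ := fun y => a ^ 2 * L ^ 2 * ((-(2 * a / Q) * Real.sin (Q * y) * Real.cos (Q * y) * (1 + a * f y) * f' y
      + a ^ 2 / Q ^ 2 * Real.cos (Q * y) ^ 2 * f' y ^ 2) * K y) with hR
  have e : ∀ y, (vD' a L Q f f' y) ^ 2 * K y = o y + a ^ 3 * L ^ 2 * (f y * K y) -
      a ^ 3 * L ^ 2 * (Real.cos (2 * Q * y) * (f y * K y)) + R y := by
    intro y
    have : 2 * (Q:ℝ) * y = 2 * (Q * y) := by ring
    rw [this, Real.cos_two_mul']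
    have h2 := Real.sin_sq_add_cos_sq (Q * y)
    simp only [vD', ho, hR]
    have hcc : Real.cos (Q * y) ^ 2 = 1 - Real.sin (Q * y) ^ 2 := by linarith
    generalize Real.sin (Q * y) = s at *
    generalize Real.cos (Q * y) = t at *
    have : a * L / Q * (t * (a * f' y)) = a * L * (a * (t * f' y / Q)) := by ring
    rw [this]
    linear_combination (a ^ 3 * L ^ 2 * f y * K y) * h2
  have co : Continuous o := by simp only [ho]; fun_prop
  have cR : Continuous R := by simp only [hR]; fun_prop
  have I0 : ∫ y in (-Real.pi)..Real.pi, o y = 0 := by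
    apply odd_int_zero
    intro y
    simp only [ho, of, hK.odd, mul_neg, Real.sin_neg]; ring
  have IR : |∫ y in (-Real.pi)..Real.pi, R y| ≤ a ^ 3 * L ^ 2 * (9 * P * Λ / Q) := by
    have : |∫ y in (-Real.pi)..Real.pi, R y| ≤ ∫ y in (-Real.pi)..Real.pi, a ^ 3 * L ^ 2 * (9 * P / Q) * |K y| := by
      refine abs_int_le (by fun_prop) fun y _ => ?_
      simp only [hR]
      rw [abs_mul, abs_mul _ (K y), abs_of_nonneg (by positivity : 0 ≤ a ^ 2 * L ^ 2)]
      have hf := bf y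
      have hf' := bf' y
      have h1 : |1 + a * f y| ≤ 4 := by
        rw [abs_le] at hf ⊢; constructor <;> nlinarith
      have h2 := Real.abs_cos_le_one (Q * y)
      have h3 := Real.abs_sin_le_one (Q * y)
      have h4 : |-(2 * a / Q) * Real.sin (Q * y) * Real.cos (Q * y) * (1 + a * f y) * f' y
          + a ^ 2 / Q ^ 2 * Real.cos (Q * y) ^ 2 * f' y ^ 2| ≤ a * (9 * P / Q) := by
        refine (abs_add_le _ _).trans ?_
        simp only [abs_mul, abs_neg, abs_pow, abs_div, abs_of_nonneg ha, abs_of_pos hq, abs_two]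
        calc 2 * a / Q * |Real.sin (Q * y)| * |Real.cos (Q * y)| * |1 + a * f y| * |f' y|
          + a ^ 2 / Q ^ 2 * |Real.cos (Q * y)| ^ 2 * |f' y| ^ 2
          ≤ 2 * a / Q * 1 * 1 * 4 * P + a ^ 2 / Q ^ 2 * 1 ^ 2 * P ^ 2 := by gcongr
          _ = a * (8 * P / Q + a * (P / Q) * (P / Q)) := by field_simp; ring
          _ ≤ a * (8 * P / Q + 1 * (P / Q) * 1) := by
              gcongr
              rw [div_le_one hq]; exact hPQ
          _ = _ := by ring
      calc _ ≤ a ^ 2 * L ^ 2 * (a * (9 * P / Q) * |K y|) := by gcongr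
        _ = _ := by ring
    refine this.trans ?_
    rw [intervalIntegral.integral_const_mul]
    have := hK.b1
    calc a ^ 3 * L ^ 2 * (9 * P / Q) * _ ≤ a ^ 3 * L ^ 2 * (9 * P / Q) * Λ := by gcongr
      _ = _ := by ring
  simp only [e]
  have i1 : IntervalIntegrable (fun y => a ^ 3 * L ^ 2 * (f y * K y)) volume (-Real.pi) Real.pi :=
    Continuous.intervalIntegrable (by fun_prop) _ _
  have i2 : IntervalIntegrable (fun y => a ^ 3 * L ^ 2 * (Real.cos (2 * Q * y) * (f y * K y))) volume (-Real.pi) Real.pi :=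
    Continuous.intervalIntegrable (by fun_prop) _ _
  have i3 := co.intervalIntegrable (μ := volume) (-Real.pi) Real.pi
  have i4 := cR.intervalIntegrable (μ := volume) (-Real.pi) Real.pi
  rw [intervalIntegral.integral_add ((i3.add i1).sub i2) i4, intervalIntegral.integral_sub (i3.add i1) i2,
    intervalIntegral.integral_add i3 i1, I0, intervalIntegral.integral_const_mul, intervalIntegral.integral_const_mul]
  have h5 := (abs_le.1 IR).1
  have h6 := (abs_le.1 hc).2
  have h7 := mul_le_mul_of_nonneg_left h6 (by positivity : 0 ≤ a ^ 3 * L ^ 2)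
  linarith
end

end
end

section
noncomputable section

lemma chi_lip (c : LPCutoff) : ∃ B : ℝ, 0 ≤ B ∧ ∀ x y, |c.χ x - c.χ y| ≤ B * |x - y| := by
  have hs : HasCompactSupport c.χ := by
    refine HasCompactSupport.intro (K := Set.Icc (-(4/3)) (4/3)) isCompact_Icc fun x hx => ?_
    by_contra h
    exact hx ⟨(c.supp x h).1.le, (c.supp x h).2.le⟩
  obtain ⟨C, hC⟩ := ContDiff.lipschitzWith_of_hasCompactSupport hs c.smooth (by simp)
  refine ⟨C, C.2, fun x y => ?_⟩
  have := hC.dist_le_mul x y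
  rwa [Real.dist_eq, Real.dist_eq] at this

/-- multiplier action -/
def Mt (c : LPCutoff) (k : ℕ) (u w : ℝ → ℂ) : Prop :=
  Continuous u ∧ ∀ x, LPblock c ((k:ℤ) - 1) u x = w x

lemma Mt.add {c : LPCutoff} {k : ℕ} {u w u' w' : ℝ → ℂ} (h : Mt c k u w) (h' : Mt c k u' w') :
    Mt c k (fun x => u x + u' x) (fun x => w x + w' x) := by
  have c1 := h.1
  have c2 := h'.1
  refine ⟨by fun_prop, fun x => ?_⟩
  beta_reduce
  rw [← h.2, ← h'.2]
  have e : ∀ ξ, fCoeff (fun x => u x + u' x) ξ = fCoeff u ξ + fCoeff u' ξ := by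
    intro ξ
    unfold fCoeff
    rw [← intervalIntegral.integral_add (Continuous.intervalIntegrable (by fun_prop) _ _)
      (Continuous.intervalIntegrable (by fun_prop) _ _)]
    simp only [mul_add]
  rw [LPblock_TP, LPblock_TP, LPblock_TP]
  simp only [TP, e]
  rw [← Finset.sum_add_distrib]
  refine Finset.sum_congr rfl fun ξ _ => by ring

lemma Mt.smul {c : LPCutoff} {k : ℕ} {u w : ℝ → ℂ} (h : Mt c k u w) (r : ℂ) :
    Mt c k (fun x => r * u x) (fun x => r * w x) := by
  have c1 := h.1
  refine ⟨by fun_prop, fun x => ?_⟩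
  beta_reduce
  rw [← h.2]
  have e : ∀ ξ, fCoeff (fun x => r * u x) ξ = r * fCoeff u ξ := by
    intro ξ
    unfold fCoeff
    rw [← intervalIntegral.integral_const_mul]
    congr 1; funext x; ring
  rw [LPblock_TP, LPblock_TP]
  simp only [TP, e]
  rw [Finset.mul_sum]
  refine Finset.sum_congr rfl fun ξ _ => by ring

lemma Mt.congr {c : LPCutoff} {k : ℕ} {u w u' w' : ℝ → ℂ} (h : Mt c k u w) (h1 : ∀ x, u' x = u x)
    (h2 : ∀ x, w' x = w x) : Mt c k u' w' := by
  have e1 : u' = u := funext h1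
  have e2 : w' = w := funext h2
  rw [e1, e2]; exact h

lemma Mt.zero (c : LPCutoff) (k : ℕ) : Mt c k (fun _ => 0) (fun _ => 0) := by
  refine ⟨by fun_prop, fun x => ?_⟩
  rw [LPblock_TP]
  simp [TP, fCoeff]

lemma Mt.sum {c : LPCutoff} {k : ℕ} {u w : ℕ → ℝ → ℂ} (s : Finset ℕ) (h : ∀ i, Mt c k (u i) (w i)) :
    Mt c k (fun x => ∑ i ∈ s, u i x) (fun x => ∑ i ∈ s, w i x) := by
  induction s using Finset.induction_on with
  | empty => simpa using Mt.zero c k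
  | insert a s ha ih =>
    simp only [Finset.sum_insert ha]
    exact (h a).add ih

lemma Mt.exp (c : LPCutoff) (k : ℕ) (ξ : ℤ) :
    Mt c k (fun x => Complex.exp (Complex.I * x * ξ)) (fun x => mlt c k ξ * Complex.exp (Complex.I * x * ξ)) := by
  refine ⟨by fun_prop, fun x => ?_⟩
  have e : (fun x : ℝ => Complex.exp (Complex.I * x * ξ)) = TP {ξ} (fun _ => 1) := by
    funext x; simp [TP]
  rw [LPblock_eq, e, tsum_eq_single ξ]
  · rw [fCoeff_TP]
    have hp : (Real.pi : ℂ) ≠ 0 := by exact_mod_cast Real.pi_ne_zero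
    simp
    field_simp
  · intro η hη
    rw [fCoeff_TP]
    simp [hη]

lemma Mt.cos (c : LPCutoff) (k : ℕ) (ξ : ℤ) :
    Mt c k (fun x => ((Real.cos (ξ * x) : ℝ) : ℂ)) (fun x => ((mlt c k ξ * Real.cos (ξ * x) : ℝ) : ℂ)) := by
  have h := ((Mt.exp c k ξ).smul (1/2)).add ((Mt.exp c k (-ξ)).smul (1/2))
  have e1 : ∀ x : ℝ, Complex.I * x * ξ = (ξ * x) * Complex.I := fun x => by ring
  have e2 : ∀ x : ℝ, Complex.I * x * ((-ξ : ℤ) : ℂ) = -(ξ * x) * Complex.I := fun x => by push_cast; ring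
  refine h.congr (fun x => ?_) (fun x => ?_)
  · rw [e1, e2]; push_cast; rw [Complex.cos]; ring
  · rw [e1, e2, mlt_even]; push_cast; rw [Complex.cos]; ring

lemma Mt.sin (c : LPCutoff) (k : ℕ) (ξ : ℤ) :
    Mt c k (fun x => ((Real.sin (ξ * x) : ℝ) : ℂ)) (fun x => ((mlt c k ξ * Real.sin (ξ * x) : ℝ) : ℂ)) := by
  have h := ((Mt.exp c k ξ).smul (-Complex.I/2)).add ((Mt.exp c k (-ξ)).smul (Complex.I/2))
  have e1 : ∀ x : ℝ, Complex.I * x * ξ = (ξ * x) * Complex.I := fun x => by ring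
  have e2 : ∀ x : ℝ, Complex.I * x * ((-ξ : ℤ) : ℂ) = -(ξ * x) * Complex.I := fun x => by push_cast; ring
  refine h.congr (fun x => ?_) (fun x => ?_)
  · rw [e1, e2]; push_cast; rw [Complex.sin]; ring
  · rw [e1, e2, mlt_even]; push_cast; rw [Complex.sin]; ring

/-- the block of the data -/
def wB (c : LPCutoff) (k : ℕ) (a L : ℝ) (Q : ℕ) (β : ℕ → ℝ) (P : ℕ) (x : ℝ) : ℝ :=
  mlt c k 0 * a + a * L / Q * (mlt c k Q * Real.cos (Q * x) + a / 2 * ∑ i ∈ Finset.range P,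
    β i * (mlt c k (Q + (2 * i + 1 : ℕ)) * Real.sin ((Q + (2 * i + 1 : ℕ)) * x)
      - mlt c k (Q - (2 * i + 1 : ℕ)) * Real.sin ((Q - (2 * i + 1 : ℕ)) * x)))

lemma vD_block (c : LPCutoff) (k : ℕ) (a L : ℝ) (Q : ℕ) (β : ℕ → ℝ) (P : ℕ) (x : ℝ) :
    LPblock c ((k:ℤ) - 1) (toC (vD a L Q (fS β P))) x = (wB c k a L Q β P x : ℂ) := by
  have h : Mt c k (toC (vD a L Q (fS β P))) (fun x => (wB c k a L Q β P x : ℂ)) := by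
    have h0 := (Mt.cos c k 0).smul a
    have h1 := Mt.cos c k (Q:ℤ)
    have h2 := (Mt.sum (Finset.range P) fun i => ((Mt.sin c k ((Q:ℤ) + (2 * i + 1 : ℕ))).add
      ((Mt.sin c k ((Q:ℤ) - (2 * i + 1 : ℕ))).smul (-1))).smul (β i : ℂ)).smul ((a / 2 : ℝ) : ℂ)
    refine (h0.add ((h1.add h2).smul ((a * L / Q : ℝ) : ℂ))).congr (fun x => ?_) (fun x => ?_)
    · have hr : vD a L Q (fS β P) x = a * Real.cos (((0:ℤ):ℝ) * x) + a * L / Q * (Real.cos (((Q:ℤ):ℝ) * x) +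
          a / 2 * ∑ i ∈ Finset.range P, β i * (Real.sin ((((Q:ℤ) + ((2 * i + 1 : ℕ):ℤ) : ℤ) : ℝ) * x) +
            (-1) * Real.sin ((((Q:ℤ) - ((2 * i + 1 : ℕ):ℤ) : ℤ) : ℝ) * x))) := by
        unfold vD fS
        have e : ∀ i : ℕ, β i * (Real.sin ((((Q:ℤ) + ((2 * i + 1 : ℕ):ℤ) : ℤ) : ℝ) * x) + (-1) * Real.sin ((((Q:ℤ) - ((2 * i + 1 : ℕ):ℤ) : ℤ) : ℝ) * x)) =
            2 * Real.cos (Q * x) * (β i * Real.sin (((2 * i + 1 : ℕ) : ℝ) * x)) := by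
          intro i
          have e1 : (((Q:ℤ) + ((2 * i + 1 : ℕ):ℤ) : ℤ) : ℝ) * x = Q * x + ((2 * i + 1 : ℕ) : ℝ) * x := by push_cast; ring
          have e2 : (((Q:ℤ) - ((2 * i + 1 : ℕ):ℤ) : ℤ) : ℝ) * x = Q * x - ((2 * i + 1 : ℕ) : ℝ) * x := by push_cast; ring
          rw [e1, e2, Real.sin_add, Real.sin_sub]; ring
        simp only [e, ← Finset.mul_sum]
        simp only [Int.cast_zero, zero_mul, Real.cos_zero, Int.cast_natCast]
        ring
      simp only [toC, hr]
      push_cast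
      ring
    · simp only [wB]
      push_cast
      simp only [zero_mul, Complex.cos_zero, neg_one_mul, ← sub_eq_add_neg]
      ring
  exact h.2 x

lemma mlt_abs (c : LPCutoff) (k : ℕ) (ξ : ℤ) : |mlt c k ξ| ≤ 1 := by
  rcases k with _ | k
  · simp only [mlt, if_true]
    rw [abs_le]; constructor <;> linarith [c.nonneg ξ, c.le_one ξ]
  · rw [mlt_eq, abs_le]
    constructor <;> linarith [c.nonneg ((ξ:ℝ) / 2 ^ (k+1)), c.le_one ((ξ:ℝ) / 2 ^ (k+1)),
      c.nonneg ((ξ:ℝ) / 2 ^ k), c.le_one ((ξ:ℝ) / 2 ^ k)]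

lemma mlt_small (c : LPCutoff) {k : ℕ} {ξ : ℤ} (h : |(ξ:ℝ)| ≤ 3/4 * 2 ^ k) : mlt c (k+1) ξ = 0 := by
  have hp : (0:ℝ) < 2 ^ k := by positivity
  have key : ∀ d : ℝ, 2 ^ k ≤ d → c.χ ((ξ:ℝ) / d) = 1 := by
    intro d hd
    have hd0 : 0 < d := by linarith
    apply c.eq_one
    rw [Set.mem_Icc, ← abs_le, abs_div, abs_of_pos hd0, div_le_iff₀ hd0]
    linarith
  rw [mlt_eq, key _ le_rfl, key, sub_self]
  rw [pow_succ]; linarith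

lemma mlt_lip {c : LPCutoff} {B : ℝ} (hB0 : 0 ≤ B) (hB : ∀ x y, |c.χ x - c.χ y| ≤ B * |x - y|) (k : ℕ) (ξ η : ℤ) :
    |mlt c (k+1) ξ - mlt c (k+1) η| ≤ 2 * B * |(ξ:ℝ) - η| / 2 ^ k := by
  rw [mlt_eq, mlt_eq]
  have h1 := hB ((ξ:ℝ) / 2 ^ (k+1)) ((η:ℝ) / 2 ^ (k+1))
  have h2 := hB ((ξ:ℝ) / 2 ^ k) ((η:ℝ) / 2 ^ k)
  rw [← sub_div, abs_div, abs_of_pos (by positivity : (0:ℝ) < 2 ^ (k+1))] at h1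
  rw [← sub_div, abs_div, abs_of_pos (by positivity : (0:ℝ) < 2 ^ k)] at h2
  have h3 : |(ξ:ℝ) - η| / 2 ^ (k+1) ≤ |(ξ:ℝ) - η| / 2 ^ k := by
    gcongr <;> simp
  have h4 := mul_le_mul_of_nonneg_left h3 hB0
  have h5 : 2 * B * |(ξ:ℝ) - η| / 2 ^ k = B * (|(ξ:ℝ) - η| / 2 ^ k) + B * (|(ξ:ℝ) - η| / 2 ^ k) := by ring
  rw [h5]
  have := abs_sub (c.χ ((ξ:ℝ) / 2 ^ (k+1)) - c.χ ((η:ℝ) / 2 ^ (k+1))) (c.χ ((ξ:ℝ) / 2 ^ k) - c.χ ((η:ℝ) / 2 ^ k))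
  calc _ = |(c.χ ((ξ:ℝ) / 2 ^ (k+1)) - c.χ ((η:ℝ) / 2 ^ (k+1))) - (c.χ ((ξ:ℝ) / 2 ^ k) - c.χ ((η:ℝ) / 2 ^ k))| := by
        congr 1; ring
    _ ≤ _ := by linarith

end
end

section
noncomputable section

section
variable {c : LPCutoff} {a L B : ℝ} {n P : ℕ} {β : ℕ → ℝ}

lemma wB_zero {k : ℕ} (hz : ∀ ξ : ℤ, 3 * (2:ℝ) ^ n / 4 ≤ |(ξ:ℝ)| → |(ξ:ℝ)| ≤ 5 * 2 ^ n / 4 → mlt c k ξ = 0)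
    (hP : 8 * P ≤ 2 ^ n) (x : ℝ) : wB c k a L (2 ^ n) β P x = mlt c k 0 * a := by
  have hP' : 8 * (P:ℝ) ≤ 2 ^ n := by exact_mod_cast hP
  have hp : (0:ℝ) < 2 ^ n := by positivity
  have hq : mlt c k ((2 ^ n : ℕ) : ℤ) = 0 := by
    apply hz <;> push_cast <;> rw [abs_of_pos (by positivity)] <;> linarith
  unfold wB
  rw [hq, Finset.sum_eq_zero]
  · simp
  · intro i hi
    have hi : ((i:ℝ)) + 1 ≤ P := by exact_mod_cast Finset.mem_range.1 hi
    have h0 : (0:ℝ) ≤ i := by positivity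
    have h1 : mlt c k (((2 ^ n : ℕ) : ℤ) + (2 * i + 1 : ℕ)) = 0 := by
      apply hz <;> push_cast <;> rw [abs_of_pos (by positivity)] <;> linarith
    have h2 : mlt c k (((2 ^ n : ℕ) : ℤ) - (2 * i + 1 : ℕ)) = 0 := by
      apply hz <;> push_cast <;> rw [abs_of_pos (by linarith)] <;> linarith
    rw [h1, h2]; ring

lemma wB_bound {k : ℕ} (hB0 : 0 ≤ B) (hB : ∀ x y, |c.χ x - c.χ y| ≤ B * |x - y|) (ha : 0 ≤ a) (ha1 : a ≤ 1) (hL : 0 ≤ L)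
    (bf : ∀ x, |fS β P x| ≤ 3) (hb0 : ∀ i, 0 ≤ β i)
    (hb1 : ∀ i, β i * ((2 * i + 1 : ℕ) : ℝ) ≤ 1) (hP : 8 * P ≤ 2 ^ n) (hk : n ≤ k + 2) (x : ℝ) :
    |wB c (k+1) a L (2 ^ n) β P x| ≤ a * L / 2 ^ n * (4 + 8 * B) := by
  set Q : ℕ := 2 ^ n with hQ
  have hQr : (Q:ℝ) = 2 ^ n := by rw [hQ]; push_cast; rfl
  have hq : (0:ℝ) < Q := by rw [hQr]; positivity
  have hP' : 8 * (P:ℝ) ≤ Q := by exact_mod_cast hP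
  have h0 : mlt c (k+1) 0 = 0 := by apply mlt_small; simp
  have hk2 : (Q:ℝ) ≤ 4 * 2 ^ k := by
    rw [hQr]; calc (2:ℝ) ^ n ≤ 2 ^ (k+2) := pow_le_pow_right₀ (by norm_num) hk
      _ = _ := by ring
  have e : wB c (k+1) a L Q β P x = mlt c (k+1) Q * (vD a L Q (fS β P) x - a) + a * L / Q * (a / 2 * ∑ i ∈ Finset.range P,
      β i * ((mlt c (k+1) (Q + (2 * i + 1 : ℕ)) - mlt c (k+1) Q) * Real.sin ((Q + (2 * i + 1 : ℕ)) * x)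
      - (mlt c (k+1) (Q - (2 * i + 1 : ℕ)) - mlt c (k+1) Q) * Real.sin ((Q - (2 * i + 1 : ℕ)) * x))) := by
    have e1 : Real.cos (Q * x) * fS β P x = 1/2 * ∑ i ∈ Finset.range P,
        β i * (Real.sin ((Q + (2 * i + 1 : ℕ)) * x) - Real.sin ((Q - (2 * i + 1 : ℕ)) * x)) := by
      unfold fS
      rw [Finset.mul_sum, Finset.mul_sum]
      refine Finset.sum_congr rfl fun i _ => ?_
      rw [add_mul, sub_mul, Real.sin_add, Real.sin_sub]; ring
    have e2 : ∑ i ∈ Finset.range P,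
      β i * (mlt c (k+1) (Q + (2 * i + 1 : ℕ)) * Real.sin ((Q + (2 * i + 1 : ℕ)) * x)
      - mlt c (k+1) (Q - (2 * i + 1 : ℕ)) * Real.sin ((Q - (2 * i + 1 : ℕ)) * x)) = (∑ i ∈ Finset.range P,
      β i * ((mlt c (k+1) (Q + (2 * i + 1 : ℕ)) - mlt c (k+1) Q) * Real.sin ((Q + (2 * i + 1 : ℕ)) * x)
      - (mlt c (k+1) (Q - (2 * i + 1 : ℕ)) - mlt c (k+1) Q) * Real.sin ((Q - (2 * i + 1 : ℕ)) * x))) +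
      mlt c (k+1) Q * ∑ i ∈ Finset.range P,
        β i * (Real.sin ((Q + (2 * i + 1 : ℕ)) * x) - Real.sin ((Q - (2 * i + 1 : ℕ)) * x)) := by
      rw [Finset.mul_sum, ← Finset.sum_add_distrib]
      refine Finset.sum_congr rfl fun i _ => ?_
      ring
    unfold wB vD
    rw [e2, h0]
    linear_combination (- (a * L / Q) * mlt c (k+1) Q * a) * e1
  rw [e]
  have hS : |∑ i ∈ Finset.range P,
      β i * ((mlt c (k+1) (Q + (2 * i + 1 : ℕ)) - mlt c (k+1) Q) * Real.sin ((Q + (2 * i + 1 : ℕ)) * x)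
      - (mlt c (k+1) (Q - (2 * i + 1 : ℕ)) - mlt c (k+1) Q) * Real.sin ((Q - (2 * i + 1 : ℕ)) * x))| ≤
      16 * B := by
    refine (Finset.abs_sum_le_sum_abs _ _).trans ?_
    have ht : ∀ i ∈ Finset.range P, |β i * ((mlt c (k+1) (Q + (2 * i + 1 : ℕ)) - mlt c (k+1) Q) * Real.sin ((Q + (2 * i + 1 : ℕ)) * x)
      - (mlt c (k+1) (Q - (2 * i + 1 : ℕ)) - mlt c (k+1) Q) * Real.sin ((Q - (2 * i + 1 : ℕ)) * x))| ≤ 16 * B / Q := by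
      intro i _
      have m1 := mlt_lip hB0 hB k (Q + (2 * i + 1 : ℕ)) Q
      have m2 := mlt_lip hB0 hB k (Q - (2 * i + 1 : ℕ)) Q
      have s1 := Real.abs_sin_le_one ((Q + (2 * i + 1 : ℕ)) * x)
      have s2 := Real.abs_sin_le_one ((Q - (2 * i + 1 : ℕ)) * x)
      have hk0 : (0:ℝ) ≤ ((2 * i + 1 : ℕ):ℝ) := by positivity
      have d1 : |((((Q:ℤ) + ((2 * i + 1 : ℕ) : ℤ) : ℤ)) : ℝ) - ((Q:ℤ):ℝ)| = ((2 * i + 1 : ℕ):ℝ) := by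
        rw [Int.cast_add, add_sub_cancel_left, Int.cast_natCast, abs_of_nonneg hk0]
      have d2 : |((((Q:ℤ) - ((2 * i + 1 : ℕ) : ℤ) : ℤ)) : ℝ) - ((Q:ℤ):ℝ)| = ((2 * i + 1 : ℕ):ℝ) := by
        rw [Int.cast_sub, sub_sub_cancel_left, abs_neg, Int.cast_natCast, abs_of_nonneg hk0]
      rw [d1] at m1
      rw [d2] at m2
      have hb := hb1 i
      have hbi := hb0 i
      set κ : ℝ := ((2 * i + 1 : ℕ):ℝ)
      rw [abs_mul, abs_of_nonneg hbi]
      calc β i * |(mlt c (k+1) (Q + (2 * i + 1 : ℕ)) - mlt c (k+1) Q) * Real.sin ((Q + κ) * x)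
          - (mlt c (k+1) (Q - (2 * i + 1 : ℕ)) - mlt c (k+1) Q) * Real.sin ((Q - κ) * x)|
          ≤ β i * (2 * B * κ / 2 ^ k * 1 + 2 * B * κ / 2 ^ k * 1) := by
            gcongr
            refine (abs_sub _ _).trans ?_
            rw [abs_mul, abs_mul]
            gcongr
        _ = (β i * κ) * (4 * B / 2 ^ k) := by ring
        _ ≤ 1 * (4 * B / 2 ^ k) := by gcongr
        _ ≤ 16 * B / Q := by
            rw [one_mul, div_le_div_iff₀ (by positivity) hq]
            nlinarith
    refine (Finset.sum_le_card_nsmul _ _ _ ht).trans ?_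
    rw [Finset.card_range, nsmul_eq_mul]
    have : (P:ℝ) ≤ Q := by linarith
    calc (P:ℝ) * (16 * B / Q) ≤ Q * (16 * B / Q) := by gcongr
      _ = _ := by field_simp
  have hv := vD_close (Q := Q) ha ha1 hL bf x
  have hm := mlt_abs c (k+1) Q
  refine (abs_add_le _ _).trans ?_
  have hal : 0 ≤ a * L / Q := by positivity
  rw [← hQr, abs_mul, abs_mul, abs_mul, abs_of_nonneg hal, abs_of_nonneg (by positivity : 0 ≤ a / 2)]
  calc _ ≤ 1 * (4 * (a * L / Q)) + a * L / Q * (1 / 2 * (16 * B)) := by gcongr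
    _ = _ := by ring

lemma besov_upper (hB0 : 0 ≤ B) (hB : ∀ x y, |c.χ x - c.χ y| ≤ B * |x - y|) (ha : 0 ≤ a) (ha1 : a ≤ 1) (hL : 0 ≤ L)
    (bf : ∀ x, |fS β P x| ≤ 3) (hb0 : ∀ i, 0 ≤ β i)
    (hb1 : ∀ i, β i * ((2 * i + 1 : ℕ) : ℝ) ≤ 1) (hP : 8 * P ≤ 2 ^ n) (hn : 3 ≤ n) :
    besov1E c (toC (vD a L (2 ^ n) (fS β P))) ≤ ENNReal.ofReal (4 * (a + a * L * (4 + 8 * B))) := by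
  have hal : 0 ≤ a * L := by positivity
  set A : ℝ := a + a * L * (4 + 8 * B) with hA
  have hA0 : 0 ≤ A := by positivity
  have term : ∀ k : ℕ, (∀ x, (2:ℝ) ^ ((k:ℤ) - 1) * |wB c k a L (2 ^ n) β P x| ≤ A) →
      (2:ℝ≥0∞) ^ ((k:ℤ) - 1) * supNormE (LPblock c ((k:ℤ) - 1) (toC (vD a L (2 ^ n) (fS β P)))) ≤ ENNReal.ofReal A := by
    intro k hk
    rw [two_zpow, supNormE, ENNReal.mul_iSup]
    refine iSup_le fun x => ?_
    rw [vD_block]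
    have : (‖(wB c k a L (2 ^ n) β P x : ℂ)‖₊ : ℝ≥0∞) = ENNReal.ofReal |wB c k a L (2 ^ n) β P x| := by
      rw [← Real.norm_eq_abs, ← Complex.norm_real, ofReal_norm_eq_enorm]; rfl
    rw [this, ← ENNReal.ofReal_mul (by positivity)]
    exact ENNReal.ofReal_le_ofReal (hk x)
  have hz : ∀ k, k ∉ ({0, n-1, n, n+1} : Finset ℕ) → 
      (2:ℝ≥0∞) ^ ((k:ℤ) - 1) * supNormE (LPblock c ((k:ℤ) - 1) (toC (vD a L (2 ^ n) (fS β P)))) = 0 := by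
    intro k hk
    simp only [Finset.mem_insert, Finset.mem_singleton, not_or] at hk
    obtain ⟨k, rfl⟩ : ∃ r, k = r + 1 := ⟨k - 1, by omega⟩
    have hw : ∀ x, wB c (k+1) a L (2 ^ n) β P x = 0 := by
      intro x
      rw [wB_zero _ hP, mlt_small (ξ := 0) c (by simp), zero_mul]
      intro ξ h1 h2
      rcases lt_or_ge k n with h | h
      · apply mlt_zero
        refine le_trans ?_ h1
        have : (2:ℝ) ^ (k + 1 + 1) * 2 ≤ 2 ^ n := by
          rw [← pow_succ]; exact pow_le_pow_right₀ (by norm_num) (by omega)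
        have : (0:ℝ) < 2 ^ n := by positivity
        linarith
      · apply mlt_small
        refine h2.trans ?_
        have : (2:ℝ) ^ n * 2 ≤ 2 ^ k := by
          rw [← pow_succ]; exact pow_le_pow_right₀ (by norm_num) (by omega)
        have : (0:ℝ) < 2 ^ n := by positivity
        linarith
    have : supNormE (LPblock c (((k+1:ℕ):ℤ) - 1) (toC (vD a L (2 ^ n) (fS β P)))) = 0 := by
      rw [supNormE, ENNReal.iSup_eq_zero]
      intro x
      rw [vD_block, hw]; simp
    rw [this, mul_zero]
  rw [besov1E, tsum_eq_sum hz]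
  have hle : ∀ k ∈ ({0, n-1, n, n+1} : Finset ℕ), (2:ℝ≥0∞) ^ ((k:ℤ) - 1) * supNormE (LPblock c ((k:ℤ) - 1) (toC (vD a L (2 ^ n) (fS β P)))) ≤ ENNReal.ofReal A := by
    intro k hk
    apply term
    intro x
    rcases Nat.eq_zero_or_pos k with h | h
    · subst h
      rw [wB_zero _ hP, abs_mul, abs_of_nonneg ha]
      · have := mlt_abs c 0 0
        have h1 : (2:ℝ) ^ (((0:ℕ):ℤ) - 1) ≤ 1 := by norm_num
        have h2 : 0 ≤ a * L * (4 + 8 * B) := by positivity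
        calc _ ≤ 1 * (1 * a) := by gcongr
          _ ≤ A := by rw [hA]; linarith
      · intro ξ h1 h2
        apply mlt_zero
        refine le_trans ?_ h1
        have : (2:ℝ) ^ 3 ≤ 2 ^ n := pow_le_pow_right₀ (by norm_num) hn
        norm_num at this ⊢
        linarith
    · obtain ⟨k, rfl⟩ : ∃ r, k = r + 1 := ⟨k - 1, by omega⟩
      simp only [Finset.mem_insert, Finset.mem_singleton] at hk
      have hb := wB_bound (k := k) hB0 hB ha ha1 hL bf hb0 hb1 hP (by omega) x
      have e : (2:ℝ) ^ (((k+1:ℕ):ℤ) - 1) = 2 ^ k := by push_cast; rw [add_sub_cancel_right, zpow_natCast]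
      have h2 : (2:ℝ) ^ k ≤ 2 ^ n := pow_le_pow_right₀ (by norm_num) (by omega)
      rw [e]
      calc _ ≤ (2:ℝ) ^ n * (a * L / 2 ^ n * (4 + 8 * B)) := by gcongr
        _ = a * L * (4 + 8 * B) := by field_simp
        _ ≤ A := by rw [hA]; linarith
  refine (Finset.sum_le_card_nsmul _ _ _ hle).trans ?_
  have hc : ({0, n-1, n, n+1} : Finset ℕ).card ≤ 4 := Finset.card_le_four
  rw [nsmul_eq_mul, ENNReal.ofReal_mul (by norm_num)]
  gcongr
  simp only [ENNReal.ofReal_ofNat]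
  exact_mod_cast hc
end

end
end

section
noncomputable section

lemma err_bound {a L T Λ Λ' ε M : ℝ} (ha : 0 ≤ a) (ha1 : a ≤ 1) (hL : 1 ≤ L) (hT : T * L = 1) (hM : M = 10 * (a * L))
    (hΛ0 : 0 ≤ Λ) (hΛ : a ^ 4 * Λ ≤ 38) (h1 : ε * Λ ≤ 152 * (a * L)) (h2 : ε * Λ' ≤ 204 * (a * L))
    (hexp : 2 * M ^ 2 * T ≤ 1) :
    ((3/2)*(ε+3*M^3*T)*M^2*Λ + 13*Real.pi^2*M^3 + 2*M^2*(2*ε*Λ' + (11/2)*M^3*Real.exp (2*M^2*T)*T*Λ)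
      + (3/2)*a*(13*M^4*Λ*T))*T ≤ 1000000000 * (a * L ^ 3) := by
  have hMT : M * T = 10 * a := by rw [hM]; linear_combination 10 * a * hT
  have hE : Real.exp (2*M^2*T) ≤ 3 := by
    have := Real.exp_one_lt_d9
    have h := Real.exp_le_exp.2 hexp
    linarith
  have hE0 := Real.exp_nonneg (2*M^2*T)
  set E := Real.exp (2*M^2*T)
  have hpi : Real.pi ^ 2 ≤ 10 := by nlinarith [Real.pi_lt_d2, Real.pi_pos]
  have e : ((3/2)*(ε+3*M^3*T)*M^2*Λ + 13*Real.pi^2*M^3 + 2*M^2*(2*ε*Λ' + (11/2)*M^3*E*T*Λ)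
      + (3/2)*a*(13*M^4*Λ*T))*T = (3/2)*(ε*Λ)*M*(M*T) + (9/2)*M^3*(M*T)^2*Λ + 13*Real.pi^2*M^2*(M*T)
      + 4*(ε*Λ')*M*(M*T) + 11*M^3*(M*T)^2*E*Λ + (39/2)*a*M^2*(M*T)^2*Λ := by ring
  rw [e, hMT, hM]
  have hy : 0 ≤ a * L ^ 3 := by positivity
  have y1 : a ^ 3 * L ^ 2 ≤ a * L ^ 3 := by
    have : a ^ 2 ≤ 1 := pow_le_one₀ ha ha1
    calc a ^ 3 * L ^ 2 = a * L ^ 2 * a ^ 2 := by ring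
      _ ≤ a * L ^ 2 * L := by gcongr; linarith
      _ = _ := by ring
  have t1 : (3/2)*(ε*Λ)*(10 * (a * L))*(10*a) ≤ 22800 * (a * L ^ 3) := by
    calc (3/2)*(ε*Λ)*(10 * (a * L))*(10*a) ≤ (3/2)*(152 * (a * L))*(10 * (a * L))*(10*a) := by gcongr
      _ = 22800 * (a ^ 3 * L ^ 2) := by ring
      _ ≤ _ := by gcongr
  have t2 : (9/2)*(10 * (a * L))^3*(10 * a)^2*Λ ≤ 450000 * 38 * (a * L ^ 3) := by
    calc (9/2)*(10 * (a * L))^3*(10 * a)^2*Λ = 450000 * (a * L ^ 3) * (a ^ 4 * Λ) := by ring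
      _ ≤ 450000 * (a * L ^ 3) * 38 := by gcongr
      _ = _ := by ring
  have t3 : 13*Real.pi^2*(10 * (a * L))^2*(10 * a) ≤ 130000 * (a * L ^ 3) := by
    calc 13*Real.pi^2*(10 * (a * L))^2*(10 * a) ≤ 13*10*(10 * (a * L))^2*(10 * a) := by gcongr
      _ = 130000 * (a ^ 3 * L ^ 2) := by ring
      _ ≤ _ := by gcongr
  have t4 : 4*(ε*Λ')*(10 * (a * L))*(10 * a) ≤ 81600 * (a * L ^ 3) := by
    calc 4*(ε*Λ')*(10 * (a * L))*(10 * a) ≤ 4*(204 * (a * L))*(10 * (a * L))*(10 * a) := by gcongr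
      _ = 81600 * (a ^ 3 * L ^ 2) := by ring
      _ ≤ _ := by gcongr
  have t5 : 11*(10 * (a * L))^3*(10 * a)^2*E*Λ ≤ 1100000 * 3 * 38 * (a * L ^ 3) := by
    calc 11*(10 * (a * L))^3*(10 * a)^2*E*Λ = 1100000 * (a * L ^ 3) * E * (a ^ 4 * Λ) := by ring
      _ ≤ 1100000 * (a * L ^ 3) * 3 * 38 := by gcongr
      _ = _ := by ring
  have t6 : (39/2)*a*(10 * (a * L))^2*(10 * a)^2*Λ ≤ 195000 * 38 * (a * L ^ 3) := by
    calc (39/2)*a*(10 * (a * L))^2*(10 * a)^2*Λ = 195000 * (a * L ^ 2 * 1) * (a ^ 4 * Λ) := by ring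
      _ ≤ 195000 * (a * L ^ 2 * L) * 38 := by gcongr
      _ = _ := by ring
  linarith

/-- size -/
def aN (n : ℕ) : ℝ := (n:ℝ) ^ (-(1:ℝ)/4)

lemma aN_pow {n : ℕ} : aN n ^ 4 = (n:ℝ)⁻¹ := by
  unfold aN
  rw [← Real.rpow_natCast, ← Real.rpow_mul (by positivity)]
  norm_num
  exact Real.rpow_neg_one _

lemma ev_small (C : ℝ) : ∀ᶠ n : ℕ in atTop, C * (aN n * Real.log n ^ 3) ≤ 1 := by
  have h := isLittleO_log_rpow_rpow_atTop (s := 1/4) 3 (by norm_num)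
  have h2 := h.tendsto_div_nhds_zero.comp tendsto_natCast_atTop_atTop
  have h3 := (h2.const_mul C)
  rw [mul_zero] at h3
  filter_upwards [h3.eventually (ge_mem_nhds one_pos), eventually_ge_atTop 1] with n hn h1
  simp only [Function.comp] at hn
  refine le_trans (le_of_eq ?_) hn
  congr 1
  have : (0:ℝ) ≤ n := by positivity
  rw [aN, neg_div, Real.rpow_neg this, div_eq_mul_inv, mul_comm]
  congr 1
  norm_cast

lemma ev_log : ∀ᶠ n : ℕ in atTop, Real.log (Real.log n) ≤ (Real.log n / 4 - 1) / (320 * Real.pi) := by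
  have h := Real.isLittleO_log_id_atTop
  have h1 := h.bound (c := 1 / (4 * (640 * Real.pi))) (by positivity)
  have hl : Tendsto (fun n : ℕ => Real.log n) atTop atTop := Real.tendsto_log_atTop.comp tendsto_natCast_atTop_atTop
  have h2 := hl.eventually h1
  filter_upwards [h2, hl.eventually (eventually_ge_atTop 8)] with n hn h8
  simp only [id, Real.norm_eq_abs] at hn
  rw [abs_of_pos (by linarith : 0 < Real.log n)] at hn
  refine (le_abs_self _).trans (hn.trans ?_)
  have hp := Real.pi_pos
  rw [div_mul_eq_mul_div, one_mul, div_le_div_iff₀ (by positivity) (by positivity)]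
  nlinarith
end
end

section
noncomputable section

lemma v0_eq (c : LPCutoff) (m : ℕ) : v0NV c (16 * m) = vD (aN (16 * m)) (Real.log ((16 * m : ℕ) : ℝ)) (2 ^ (16 * m))
    (fS (bet c (2 ^ (8 * m))) (2 ^ (8 * m))) := by
  funext x
  unfold v0NV vD aN
  rw [fLow_eq, zpow_neg, zpow_natCast]
  push_cast
  ring

set_option maxHeartbeats 1600000 in
lemma lower_main (c : LPCutoff) {m : ℕ} (hm : 1 ≤ m) {a L : ℝ} (ha : 0 ≤ a) (ha1 : a ≤ 1) (ha4 : a ^ 4 * (16 * m) = 1)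
    (hL : 1 ≤ L) (hs : 10000000000 * (a * L ^ 3) ≤ 1) {u : ℝ → ℝ → ℝ} (hu : IsNovikovSolution (1 / L) u)
    (h0 : ∀ x, u 0 x = vD a L (2 ^ (16 * m)) (fS (bet c (2 ^ (8 * m))) (2 ^ (8 * m))) x) :
    ENNReal.ofReal ((L / 4 - 1) / (320 * Real.pi)) ≤ besov1E c (toC (u (1 / L))) := by
  have hp := Real.pi_pos
  have hm' : (1:ℝ) ≤ m := by exact_mod_cast hm
  obtain ⟨g, gx, ut, gt, R, S, H⟩ := Sys.of_novikov hu
  set T := 1 / L with hT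
  have hTL : T * L = 1 := by rw [hT]; field_simp
  have hT0 : 0 ≤ T := by positivity
  set P : ℕ := 2 ^ (8 * m) with hP
  set Q : ℕ := 2 ^ (16 * m) with hQ
  set q : ℕ := 2 ^ (4 * m - 1) with hq
  have hN : 2 * q = 2 ^ (4 * m) := by rw [hq, ← pow_succ']; congr 1; omega
  have hqpos : 0 < q := by positivity
  have hQpos : 0 < Q := by positivity
  have hQr : (0:ℝ) < Q := by exact_mod_cast hQpos
  have hm2 : 16 * m ≤ P := by
    have : m < 2 ^ m := Nat.lt_two_pow_self
    calc 16 * m ≤ 2 ^ 4 * 2 ^ m := by omega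
      _ = 2 ^ (4 + m) := by rw [pow_add]
      _ ≤ P := Nat.pow_le_pow_right (by norm_num) (by omega)
  have hPP : P * P = Q := by rw [hP, hQ, ← pow_add]; congr 1; omega
  have hPn : P * (16 * m) ≤ Q := by rw [← hPP]; gcongr
  have hNQ : 2 * q * 8 ≤ Q := by
    rw [hN, hQ]
    calc 2 ^ (4 * m) * 8 = 2 ^ (4 * m + 3) := by rw [pow_add]; norm_num
      _ ≤ _ := Nat.pow_le_pow_right (by norm_num) (by omega)
  have hPQ : P ≤ Q := by nlinarith
  have hPnr : (P:ℝ) * (16 * m) ≤ Q := by exact_mod_cast hPn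
  have hNQr : ((2 * q : ℕ) : ℝ) * 8 ≤ Q := by exact_mod_cast hNQ
  have hnQ : (16 * m : ℝ) ≤ Q := by exact_mod_cast hm2.trans hPQ
  have hPQr : (P:ℝ) ≤ Q := by exact_mod_cast hPQ
  have hK := KN_ker (N := 2 * q) (by omega)
  set Λ := 38 * Real.log (1 + ((2 * q : ℕ) : ℝ) * Real.pi) with hΛ
  set Λ' := 16 * (((2 * q : ℕ) : ℝ) * Real.pi) with hΛ'
  have hN1 : (1:ℝ) ≤ ((2 * q : ℕ) : ℝ) := by exact_mod_cast (by omega : 1 ≤ 2 * q)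
  have hΛn : Λ ≤ 38 * (16 * m) := by
    rw [hΛ]
    have h1 : 1 + ((2 * q : ℕ) : ℝ) * Real.pi ≤ 2 ^ (16 * m) := by
      have : (Q:ℝ) = 2 ^ (16 * m) := by rw [hQ]; push_cast; rfl
      rw [← this]
      nlinarith [Real.pi_lt_d2]
    have h2 := Real.log_le_log (by positivity) h1
    rw [Real.log_pow] at h2
    have h3 := Real.log_two_lt_d9
    push_cast at h2 ⊢
    nlinarith
  have hΛ0 : 0 ≤ Λ := by
    rw [hΛ]; have : 0 ≤ Real.log (1 + ((2 * q : ℕ) : ℝ) * Real.pi) := Real.log_nonneg (by nlinarith)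
    positivity
  have hΛ'Q : Λ' ≤ 51 * Q := by
    rw [hΛ']
    nlinarith [Real.pi_lt_d2]
  have hΛ'0 : 0 ≤ Λ' := by positivity
  have hPΛ : P * Λ ≤ 38 * Q := by
    calc (P:ℝ) * Λ ≤ P * (38 * (16 * m)) := by gcongr
      _ ≤ _ := by linarith
  have hal : 0 ≤ a * L := by positivity
  -- data
  have df := fS_deriv (bet c P) P
  have cf' := fS'_cont (bet c P) P
  have pf := fS_per (bet c P) P
  have bf := fS_bdd (bet_anti c P) (bet_nonneg c P) (bet_le c P) P
  have bf' := fS'_bdd (bet_nonneg c P) (bet_le c P) P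
  have of := fS_odd (bet c P) P
  have hu0 : u 0 = vD a L Q (fS (bet c P) P) := funext h0
  have hg0 : ∀ x, g 0 x = vD' a L Q (fS (bet c P) P) (fS' (bet c P) P) x := by
    intro x
    have h1 := H.dux 0 x
    rw [hu0] at h1
    exact h1.unique (vD_deriv hQpos df x)
  have hcl : ∀ x, |u 0 x - a| ≤ 4 * (a * L / Q) := fun x => by
    rw [h0]; exact vD_close ha ha1 (by linarith) bf x
  have hgb : ∀ x, |g 0 x| ≤ 5 * (a * L) := fun x => by
    rw [hg0]; exact vD'_bd ha ha1 (by linarith) hQpos bf bf' hPQr x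
  set ε := 4 * (a * L / Q) with hε
  have hε0 : 0 ≤ ε := by positivity
  have hεQ : ε * Q = 4 * (a * L) := by rw [hε]; field_simp
  have hεM : ε ≤ 4 * (a * L) := by
    have : (1:ℝ) ≤ Q := by exact_mod_cast hQpos
    nlinarith
  have haL : a ≤ a * L := le_mul_of_one_le_right ha hL
  obtain ⟨M, hM⟩ : ∃ M, M = 10 * (a * L) := ⟨_, rfl⟩
  have ha0 : 0 < a := by
    rcases ha.eq_or_lt with h | h
    · rw [← h] at ha4; norm_num at ha4
    · exact h
  have hM0 : 0 < M := by rw [hM]; positivity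
  have hsm : 10000000000 * (a ^ 2 * L) ≤ 1 := by
    refine le_trans ?_ hs
    have h1 : a ^ 2 ≤ a := by nlinarith
    have h2 : L ≤ L ^ 3 := le_self_pow₀ hL (by norm_num)
    gcongr
  have hM2T : M ^ 2 * T = 100 * (a ^ 2 * L) := by
    rw [hM]; linear_combination 100 * a ^ 2 * L * hTL
  have hb := H.boot hM0 hT0 (fun x => by
      constructor
      · have h1 := hcl x
        rw [abs_le] at h1 ⊢
        constructor <;> linarith [h1.1, h1.2]
      · linarith [hgb x]) (by
      have : (9/2) * M ^ 3 * T = (9/2) * M * (M ^ 2 * T) := by ring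
      rw [this, hM2T]
      nlinarith)
  obtain ⟨x0, hx0⟩ := H.dyn hK hb hcl hε0 ha hT0
  have hE := err_bound (Λ := Λ) (Λ' := Λ') (ε := ε) (M := M) ha ha1 hL hTL hM hΛ0
    (by
      calc a ^ 4 * Λ ≤ a ^ 4 * (38 * (16 * m)) := by gcongr
        _ = 38 := by linear_combination 38 * ha4)
    (by
      calc ε * Λ ≤ ε * (38 * Q) := by gcongr; linarith
        _ = _ := by linear_combination 38 * hεQ)
    (by
      calc ε * Λ' ≤ ε * (51 * Q) := by gcongr
        _ = _ := by linear_combination 51 * hεQ)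
    (by rw [mul_assoc, hM2T]; linarith)
  have hI0 := vD_int1 (a := a) (L := L) hK ha ha1 (by linarith) hQpos df cf' pf bf
  have hJ := vD_int2 (a := a) (L := L) hK ha ha1 (by linarith) hQpos df cf' pf of bf bf' hPQr
  simp only [hg0] at hx0
  have hq4 : 2 * q * 4 ≤ P := by
    rw [hN, hP]
    calc 2 ^ (4 * m) * 4 = 2 ^ (4 * m + 2) := by rw [pow_add]; norm_num
      _ ≤ _ := Nat.pow_le_pow_right (by norm_num) (by omega)
  have hfK := int_fS_KN (β := bet c P) (P := P) (q := q) (bet_nonneg c P) hqpos (by omega)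
    (fun i hi => bet_eq c (by omega))
  have hlogq : Real.log q = (4 * m - 1) * Real.log 2 := by
    rw [hq]; push_cast
    rw [Real.log_pow, Nat.cast_sub (by omega)]; push_cast; ring
  have hlogq' : 2.76 * m - 0.7 ≤ Real.log q := by
    rw [hlogq]
    have h3 := Real.log_two_gt_d9
    have h4 : (0:ℝ) ≤ 4 * m - 1 := by linarith
    have h5 := mul_le_mul_of_nonneg_left h3.le h4
    linarith
  set F := ∫ y in (-Real.pi)..Real.pi, fS (bet c P) P y * KN (2 * q) y
  set I1 := ∫ y in (-Real.pi)..Real.pi, g T (x0 + y) * KN (2 * q) y with hI1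
  set I0 := ∫ y in (-Real.pi)..Real.pi, vD' a L Q (fS (bet c P) P) (fS' (bet c P) P) y * KN (2 * q) y
  set J := ∫ y in (-Real.pi)..Real.pi, (vD' a L Q (fS (bet c P) P) (fS' (bet c P) P) y) ^ 2 * KN (2 * q) y
  have hE2 : (P * Λ + 3 * Λ') / (2 * Q) + 9 * P * Λ / Q ≤ 438 := by
    have h1 : (P * Λ + 3 * Λ') / (2 * Q) ≤ 96 := by
      rw [div_le_iff₀ (by positivity)]; linarith
    have h2 : 9 * P * Λ / Q ≤ 342 := by
      rw [div_le_iff₀ (by positivity)]; linarith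
    linarith
  have hJ2 : a ^ 3 * L ^ 2 * (2.76 * m - 440) ≤ J := by
    refine le_trans (mul_le_mul_of_nonneg_left ?_ (by positivity)) hJ
    linarith
  have hmain : L / 4 - 660 * (a * L ^ 3) ≤ (3/2) * a * T * J := by
    have h1 : (3/2) * a * T * (a ^ 3 * L ^ 2 * (2.76 * m - 440)) ≤ (3/2) * a * T * J := by gcongr
    have h2 : (3/2) * a * T * (a ^ 3 * L ^ 2 * (2.76 * m - 440)) = 0.25875 * L - 660 * (a ^ 4 * L) := by
      linear_combination (3/2) * a ^ 4 * L * (2.76 * m - 440) * hTL + (1.5 * 2.76 / 16) * L * ha4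
    have h3 : a ^ 4 * L ≤ a * L ^ 3 := by
      have h1 : a ^ 4 ≤ a := pow_le_of_le_one ha ha1 (by norm_num)
      have h2 : L ≤ L ^ 3 := le_self_pow₀ hL (by norm_num)
      gcongr
    linarith
  have hI0' : |I0| ≤ 204 * (a * L ^ 3) := by
    refine hI0.trans ?_
    have h2 : L ≤ L ^ 3 := le_self_pow₀ hL (by norm_num)
    calc ε * Λ' ≤ ε * (51 * Q) := by gcongr
        _ = 204 * (a * L) := by linear_combination 51 * hεQ
        _ ≤ _ := by gcongr
  have hfin : L / 4 - 1 ≤ |I1| := by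
    have h1 := (abs_le.1 (hx0.trans hE)).1
    have h2 := (abs_le.1 hI0').1
    have h3 := le_abs_self I1
    linarith
  have hlow := besov_lower_real c (w := u T) (w' := g T) (H.dux T)
    (H.cg.comp (by fun_prop : Continuous fun x : ℝ => (T, x))) (H.pu T) x0 (N := 2 * q) (by omega)
  refine le_trans (ENNReal.ofReal_le_ofReal ?_) hlow
  gcongr

theorem main_thm (c : LPCutoff) :
    ∃ N : ℕ, ∀ n : ℕ, 16 ∣ n → N ≤ n →
      besov1E c (toC (v0NV c n)) ≤ ENNReal.ofReal (1 / Real.log (Real.log n)) ∧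
      ∀ u : ℝ → ℝ → ℝ, IsNovikovSolution (1 / Real.log n) u → (∀ x, u 0 x = v0NV c n x) →
        ∃ t₀ ∈ Set.Ioc (0:ℝ) (1 / Real.log n),
          ENNReal.ofReal (Real.log (Real.log n)) ≤ besov1E c (toC (u t₀)) := by
  obtain ⟨B, hB0, hB⟩ := chi_lip c
  have hl : Tendsto (fun n : ℕ => Real.log n) atTop atTop := Real.tendsto_log_atTop.comp tendsto_natCast_atTop_atTop
  obtain ⟨N, hN⟩ := eventually_atTop.1 (((ev_small 10000000000).and (ev_small (4 * (5 + 8 * B)))).and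
    ((ev_log).and ((hl.eventually (eventually_ge_atTop 3)).and (eventually_ge_atTop 16))))
  refine ⟨N, fun n hn hNn => ?_⟩
  obtain ⟨⟨h1, h2⟩, h3, h4, h5⟩ := hN n hNn
  obtain ⟨m, rfl⟩ := hn
  have hm : 1 ≤ m := by omega
  have hn0 : (1:ℝ) ≤ ((16 * m : ℕ) : ℝ) := by exact_mod_cast (by omega : 1 ≤ 16 * m)
  have ha : 0 ≤ aN (16 * m) := by unfold aN; positivity
  have ha1 : aN (16 * m) ≤ 1 := by
    unfold aN; exact Real.rpow_le_one_of_one_le_of_nonpos hn0 (by norm_num)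
  have ha4 : aN (16 * m) ^ 4 * (16 * (m:ℝ)) = 1 := by
    rw [aN_pow]; push_cast; field_simp
  rw [v0_eq]
  set a := aN (16 * m)
  set L := Real.log ((16 * m : ℕ) : ℝ)
  constructor
  · have bf := fS_bdd (bet_anti c (2 ^ (8 * m))) (bet_nonneg c (2 ^ (8 * m))) (bet_le c (2 ^ (8 * m))) (2 ^ (8 * m))
    refine (besov_upper hB0 hB ha ha1 (by linarith) bf (bet_nonneg c _) (bet_le c _) ?_ (by omega)).trans
      (ENNReal.ofReal_le_ofReal ?_)
    · calc 8 * 2 ^ (8 * m) = 2 ^ (3 + 8 * m) := by rw [pow_add]; norm_num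
        _ ≤ _ := Nat.pow_le_pow_right (by norm_num) (by omega)
    · have hlog0 : 0 < Real.log L := Real.log_pos (by linarith)
      have hlogL : Real.log L ≤ L := (Real.log_le_sub_one_of_pos (by linarith)).trans (by linarith)
      rw [le_div_iff₀ hlog0]
      refine le_trans ?_ h2
      have haL : a ≤ a * L := le_mul_of_one_le_right ha (by linarith)
      have hL2 : L ^ 2 ≤ L ^ 3 := pow_le_pow_right₀ (by linarith) (by norm_num)
      calc 4 * (a + a * L * (4 + 8 * B)) * Real.log L ≤ 4 * (a * L + a * L * (4 + 8 * B)) * L := by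
            have : 0 ≤ a * L := by positivity
            gcongr
        _ = 4 * (5 + 8 * B) * (a * L ^ 2) := by ring
        _ ≤ _ := by gcongr
  · intro u hu h0
    refine ⟨1 / L, ⟨by positivity, le_rfl⟩, ?_⟩
    exact (ENNReal.ofReal_le_ofReal h3).trans (lower_main c hm ha ha1 ha4 (by linarith) h1 hu h0)
end
end

/-- Norm inflation for the periodic Novikov equation in `B^1_{∞,1}(𝕋)`:
for all sufficiently large `n ∈ 16ℕ`, `‖v_{0,n}‖_{B^1_{∞,1}} ≤ 1/(log log n)`, while any
smooth solution on `[0, 1/log n]` with data `v_{0,n}` satisfies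
`‖u(t₀)‖_{B^1_{∞,1}} ≥ log log n` for some `t₀ ∈ (0, 1/log n]`. -/
theorem Novikov_norm_inflation (c : LPCutoff) :
    ∃ N : ℕ, ∀ n : ℕ, 16 ∣ n → N ≤ n →
      besov1E c (toC (v0NV c n)) ≤ ENNReal.ofReal (1 / Real.log (Real.log n)) ∧
      ∀ u : ℝ → ℝ → ℝ, IsNovikovSolution (1 / Real.log n) u → (∀ x, u 0 x = v0NV c n x) →
        ∃ t₀ ∈ Set.Ioc (0:ℝ) (1 / Real.log n),
          ENNReal.ofReal (Real.log (Real.log n)) ≤ besov1E c (toC (u t₀)) := by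
  exact main_thm c
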